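/- arXiv:2206.08820 — 4 statements merged into one kernel-verified Lean document; each statement's English description precedes it below -/
import Mathlib

section
/- Under the standing assumptions on a and q, there exist constants C > 0 and μ₀ > 0 such that for every real μ ≥ μ₀ and every smooth compactly supported function u : ℝ → ℂ one has ‖−u'' + q·u‖ ≤ C·‖T(μ)u‖, where T(μ)u = −u'' + q·u + 2μ·a·u + μ²·u. (This is the statement that H_q T(μ)^{-1} is uniformly bounded, expressed on the core C_c^∞(ℝ).) -/
open MeasureTheory Filter
open scoped ENNReal

/-- The quadratic operator family `T(λ)u = -u'' + q·u + 2λ·a·u + λ²·u`. -/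
noncomputable def Tq (a q : ℝ → ℝ) (lam : ℂ) (u : ℝ → ℂ) : ℝ → ℂ :=
  fun x => -deriv (deriv u) x + (q x : ℂ) * u x + 2 * lam * (a x : ℂ) * u x + lam ^ 2 * u x

/-- Standing assumptions on the damping `a` and the potential `q`. -/
structure Standing (a q : ℝ → ℝ) : Prop where
  smooth_a : ContDiff ℝ (⊤ : ℕ∞) a
  smooth_q : ContDiff ℝ (⊤ : ℕ∞) q
  nonneg_a : ∀ x, 0 ≤ a x
  nonneg_q : ∀ x, 0 ≤ q x
  unbounded_a : Tendsto a (cocompact ℝ) atTop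
  deriv_a : ∀ n : ℕ, 1 ≤ n → ∃ C : ℝ, 0 < C ∧ ∀ x : ℝ,
      |iteratedDeriv n a x| ≤ C * (1 + a x) * (1 + x ^ 2) ^ (-(n : ℝ) / 2)
  deriv_q : ∀ n : ℕ, 1 ≤ n → ∃ C : ℝ, 0 < C ∧ ∀ x : ℝ,
      |iteratedDeriv n q x| ≤ C * (1 + q x) * (1 + x ^ 2) ^ (-(n : ℝ) / 2)
  q_le_a : ∃ K₀ : ℝ, 0 < K₀ ∧ ∃ x₀ : ℝ, 0 < x₀ ∧ ∀ x : ℝ, x₀ < |x| → q x ≤ K₀ * a x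

lemma aux_eLpNorm_le (f g : ℝ → ℂ) (hf : MemLp f 2 volume) (hg : MemLp g 2 volume)
    (hfg : ∫ x, ‖g x‖ ^ 2 ≤ ∫ x, ‖f x‖ ^ 2) : eLpNorm g 2 volume ≤ eLpNorm f 2 volume := by
  rw [hf.eLpNorm_eq_integral_rpow_norm (by norm_num) (by norm_num),
    hg.eLpNorm_eq_integral_rpow_norm (by norm_num) (by norm_num)]
  apply ENNReal.ofReal_le_ofReal
  apply Real.rpow_le_rpow
  · positivity
  · simpa using hfg
  · norm_num

lemma aux_pointwise (z w s : ℂ) (q V V' K : ℝ) (hq : 0 ≤ q) (hV : 0 ≤ V) (hK : 0 ≤ K)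
    (hVK : K ^ 2 ≤ V) (hV' : |V'| ≤ K * V) :
    0 ≤ ‖-s + (q : ℂ) * z + (V : ℂ) * z‖ ^ 2 - ‖-s + (q : ℂ) * z‖ ^ 2
      + 2 * (V' * inner ℝ z w + V * (inner ℝ z s + inner ℝ w w)) := by
  have h1 : |V' * inner ℝ z w| ≤ K * V * (‖z‖ * ‖w‖) := by
    rw [abs_mul]
    exact mul_le_mul hV' (abs_real_inner_le_norm z w) (abs_nonneg _) (by positivity)
  have h2 : ‖-s + (q : ℂ) * z + (V : ℂ) * z‖ ^ 2 - ‖-s + (q : ℂ) * z‖ ^ 2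
      = -2 * V * inner ℝ z s + 2 * q * V * ‖z‖ ^ 2 + V ^ 2 * ‖z‖ ^ 2 := by
    simp only [← Complex.normSq_eq_norm_sq, Complex.normSq_apply, Complex.inner]
    simp
    ring
  rw [h2, real_inner_self_eq_norm_sq]
  have h3 := (abs_le.1 h1).1
  have h4 : 0 ≤ V * (K * ‖z‖ - ‖w‖) ^ 2 := by positivity
  have h5 : 0 ≤ V * ‖z‖ ^ 2 * (V - K ^ 2) := mul_nonneg (by positivity) (by linarith)
  have h6 : 0 ≤ q * V * ‖z‖ ^ 2 := by positivity
  have h7 : 0 ≤ V * ‖w‖ ^ 2 := by positivity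
  nlinarith

theorem stmt1 (a q : ℝ → ℝ) (h : Standing a q) :
    ∃ C : ℝ, 0 < C ∧ ∃ μ₀ : ℝ, 0 < μ₀ ∧ ∀ μ : ℝ, μ₀ ≤ μ →
      ∀ u : ℝ → ℂ, ContDiff ℝ (⊤ : ℕ∞) u → HasCompactSupport u →
        eLpNorm (fun x => -deriv (deriv u) x + (q x : ℂ) * u x) 2 volume
          ≤ ENNReal.ofReal C * eLpNorm (Tq a q (μ : ℂ) u) 2 volume := by
  obtain ⟨C, hC, hCa⟩ := h.deriv_a 1 le_rfl
  have hda : ∀ x, |deriv a x| ≤ C * (1 + a x) := by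
    intro x
    have h1 := hCa x
    rw [iteratedDeriv_one] at h1
    refine h1.trans ?_
    have h2 : (1 + x ^ 2 : ℝ) ^ (-((1 : ℕ) : ℝ) / 2) ≤ 1 :=
      Real.rpow_le_one_of_one_le_of_nonpos (by nlinarith [sq_nonneg x]) (by norm_num)
    have := h.nonneg_a x
    exact mul_le_of_le_one_right (by positivity) h2
  refine ⟨1, one_pos, 1 + 2 * C, by positivity, fun μ hμ u hu hc => ?_⟩
  rw [ENNReal.ofReal_one, one_mul]
  have hμ1 : 1 ≤ μ := by linarith
  have hu1 : ContDiff ℝ (⊤ : ℕ∞) (deriv u) := (contDiff_infty_iff_deriv.1 hu).2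
  have hu2 : ContDiff ℝ (⊤ : ℕ∞) (deriv (deriv u)) := (contDiff_infty_iff_deriv.1 hu1).2
  have hc1 : HasCompactSupport (deriv u) := hc.deriv
  have hc2 : HasCompactSupport (deriv (deriv u)) := hc1.deriv
  have ca : Continuous a := h.smooth_a.continuous
  have cq : Continuous q := h.smooth_q.continuous
  have cu := hu.continuous
  have cu1 := hu1.continuous
  have cu2 := hu2.continuous
  have cda : Continuous (deriv a) := (contDiff_infty_iff_deriv.1 h.smooth_a).2.continuous
  have du : ∀ x, HasDerivAt u (deriv u x) x := fun x =>
    ((contDiff_infty_iff_deriv.1 hu).1 x).hasDerivAt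
  have du1 : ∀ x, HasDerivAt (deriv u) (deriv (deriv u) x) x := fun x =>
    ((contDiff_infty_iff_deriv.1 hu1).1 x).hasDerivAt
  have da : ∀ x, HasDerivAt a (deriv a x) x := fun x =>
    ((contDiff_infty_iff_deriv.1 h.smooth_a).1 x).hasDerivAt
  set V : ℝ → ℝ := fun x => 2 * μ * a x + μ ^ 2 with hVdef
  have cV : Continuous V := by fun_prop
  have dV : ∀ x, HasDerivAt V (2 * μ * deriv a x) x := fun x =>
    ((da x).const_mul (2 * μ)).add_const _
  set g : ℝ → ℂ := fun x => -deriv (deriv u) x + (q x : ℂ) * u x with hg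
  have hT : Tq a q (μ : ℂ) u = fun x => -deriv (deriv u) x + (q x : ℂ) * u x + (V x : ℂ) * u x := by
    funext x
    simp only [Tq, hVdef]
    push_cast
    ring
  rw [hT]
  set f : ℝ → ℂ := fun x => -deriv (deriv u) x + (q x : ℂ) * u x + (V x : ℂ) * u x with hf
  have cg : Continuous g := by fun_prop
  have cf : Continuous f := by fun_prop
  have hcg : HasCompactSupport g := hc2.neg.add hc.mul_left
  have hcf : HasCompactSupport f := hcg.add hc.mul_left
  have mg : MemLp g 2 volume := cg.memLp_of_hasCompactSupport hcg
  have mf : MemLp f 2 volume := cf.memLp_of_hasCompactSupport hcf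
  apply aux_eLpNorm_le f g mf mg
  have ig : Integrable (fun x => ‖g x‖ ^ 2) := mg.integrable_norm_pow (by norm_num)
  have iff' : Integrable (fun x => ‖f x‖ ^ 2) := mf.integrable_norm_pow (by norm_num)
  set P : ℝ → ℝ := fun x => V x * inner ℝ (u x) (deriv u x) with hP
  set P' : ℝ → ℝ := fun x => 2 * μ * deriv a x * inner ℝ (u x) (deriv u x)
    + V x * (inner ℝ (u x) (deriv (deriv u) x) + inner ℝ (deriv u x) (deriv u x)) with hP'
  have dP : ∀ x, HasDerivAt P (P' x) x := fun x => (dV x).mul ((du x).inner ℝ (du1 x))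
  have cP : Continuous P := by fun_prop
  have cP' : Continuous P' := by fun_prop
  have hcP : HasCompactSupport P := by
    refine HasCompactSupport.mul_left ?_
    exact hc.mono' (fun x hx => subset_tsupport _ (by
      intro h0
      apply hx
      simp [h0]))
  have hcP' : HasCompactSupport P' := by
    have : P' = deriv P := by
      funext x
      exact (dP x).deriv.symm
    rw [this]
    exact hcP.deriv
  have iP : Integrable P := cP.integrable_of_hasCompactSupport hcP
  have iP' : Integrable P' := cP'.integrable_of_hasCompactSupport hcP'
  have h0 : ∫ x, P' x = 0 := integral_eq_zero_of_hasDerivAt_of_integrable dP iP' iP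
  have hnn : 0 ≤ ∫ x, (‖f x‖ ^ 2 - ‖g x‖ ^ 2 + 2 * P' x) := by
    apply integral_nonneg
    intro x
    have ha := h.nonneg_a x
    have hVn : 0 ≤ V x := by positivity
    refine aux_pointwise (u x) (deriv u x) (deriv (deriv u) x) (q x) (V x) _ (2 * C)
      (h.nonneg_q x) hVn (by positivity) ?_ ?_
    · simp only [hVdef]
      have : 0 ≤ μ * a x := by positivity
      nlinarith
    · rw [abs_mul, abs_of_nonneg (by positivity : 0 ≤ 2 * μ)]
      have h1 : 2 * μ * |deriv a x| ≤ 2 * μ * (C * (1 + a x)) :=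
        mul_le_mul_of_nonneg_left (hda x) (by positivity)
      refine h1.trans ?_
      simp only [hVdef]
      have e1 : 0 ≤ C * (μ * a x) := by positivity
      have e2 : 0 ≤ C * (μ * (μ - 1)) := mul_nonneg hC.le (mul_nonneg (by linarith) (by linarith))
      nlinarith
  have e : ∫ x, (‖f x‖ ^ 2 - ‖g x‖ ^ 2 + 2 * P' x)
      = (∫ x, ‖f x‖ ^ 2) - (∫ x, ‖g x‖ ^ 2) + 2 * ∫ x, P' x := by
    have isub : Integrable (fun x => ‖f x‖ ^ 2 - ‖g x‖ ^ 2) := iff'.sub ig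
    rw [integral_add isub (iP'.const_mul 2), integral_sub iff' ig, integral_const_mul]
  rw [e, h0] at hnn
  linarith
end

section
/- Under the standing assumptions on a and q, for every bounded set K ⊂ [0,∞) there exist constants C > 0 and b₀ > 0 such that for all c ∈ K, all real b with |b| ≥ b₀, and every smooth compactly supported function u : ℝ → ℂ, setting λ = −c + i·b, one has ‖u''‖² + ‖q·u‖² + b²·‖a·u‖² ≤ C·(‖T(λ)u‖² + b⁴·‖u‖²). -/
open MeasureTheory Filter
open scoped ENNReal

set_option maxHeartbeats 1000000 in
/-- The pointwise inequality, in real variables. -/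
lemma aux_real (r p s X R I a q a' q' b c D E K₀ M C1 C2 Fsq Tsq G C v : ℝ)
    (_hr : 0 ≤ r) (hp : 0 ≤ p) (hs : 0 ≤ s)
    (hX : |X| ≤ r * s) (hR : |R| ≤ p * s) (hI : |I| ≤ p * s)
    (ha : 0 ≤ a) (hq : 0 ≤ q) (hqa : q ≤ K₀ * a + M) (hK₀ : 0 ≤ K₀) (hM : 0 ≤ M)
    (hC1 : 0 ≤ C1) (hC2 : 0 ≤ C2)
    (ha' : |a'| ≤ C1 * (1 + a)) (hq' : |q'| ≤ C2 * (1 + q))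
    (hb : 1 ≤ |b|) (hc : 0 ≤ c) (hcb : 4 * c ≤ |b|)
    (hD : D = 2 * C2 * (1 + M + K₀) + 4 * C1) (hE : E = D ^ 2)
    (hFG : Fsq + G = r ^ 2 + (v ^ 2 + 4 * b ^ 2 * a ^ 2) * s ^ 2 + 4 * c * a * X
      + 2 * q' * R + 2 * q * p ^ 2 + E * p ^ 2 + E * X + 4 * b * a' * I)
    (hFT : Fsq ≤ 2 * Tsq + 8 * b ^ 4 * s ^ 2) (hT : 0 ≤ Tsq)
    (hC : C = (1 + 2 * K₀ ^ 2) * (18 + 2 * E ^ 2) + 2 * M ^ 2) :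
    r ^ 2 + q ^ 2 * s ^ 2 + b ^ 2 * (a ^ 2 * s ^ 2)
      ≤ C * (Tsq + b ^ 4 * s ^ 2) + 2 * (1 + 2 * K₀ ^ 2) * G := by
  have hB : b ^ 2 = |b| ^ 2 := (sq_abs b).symm
  have hB1 : 1 ≤ b ^ 2 := by rw [hB]; exact one_le_pow₀ hb
  have hB4 : b ^ 2 ≤ b ^ 4 := by
    have t1 := mul_le_mul_of_nonneg_left hB1 (sq_nonneg b)
    linarith
  have hB41 : 1 ≤ b ^ 4 := by linarith
  have hc2 : 16 * c ^ 2 ≤ b ^ 2 := by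
    rw [hB]
    have t1 := pow_le_pow_left₀ (by positivity) hcb 2
    linarith
  have hD0 : 0 ≤ D := by rw [hD]; positivity
  have hps : 0 ≤ p * s := by positivity
  -- cross terms with derivatives
  have h1 : 2 * |q'| + 4 * |b| * |a'| ≤ D * |b| * (1 + a) := by
    have e1 : |q'| ≤ C2 * (1 + M + K₀) * (1 + a) := by
      refine hq'.trans ?_
      rw [mul_assoc]
      apply mul_le_mul_of_nonneg_left _ hC2
      have t1 := mul_nonneg hM ha
      linarith
    have e2 : C2 * (1 + M + K₀) * (1 + a) ≤ |b| * (C2 * (1 + M + K₀) * (1 + a)) := by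
      apply le_mul_of_one_le_left _ hb
      positivity
    have e3 : |b| * |a'| ≤ |b| * (C1 * (1 + a)) :=
      mul_le_mul_of_nonneg_left ha' (abs_nonneg b)
    rw [hD]
    linarith
  have h2 : -(2 * q' * R + 4 * b * a' * I) ≤ D * |b| * (1 + a) * (p * s) := by
    have e1 : -(q' * R) ≤ |q'| * (p * s) := by
      refine (neg_le_abs _).trans ?_
      rw [abs_mul]; exact mul_le_mul_of_nonneg_left hR (abs_nonneg _)
    have e2 : -(b * a' * I) ≤ |b| * |a'| * (p * s) := by
      refine (neg_le_abs _).trans ?_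
      rw [abs_mul, abs_mul]; exact mul_le_mul_of_nonneg_left hI (by positivity)
    have e3 := mul_le_mul_of_nonneg_right h1 hps
    linarith
  have h3 : D * |b| * (1 + a) * (p * s) ≤ b ^ 2 * s ^ 2 + b ^ 2 * a ^ 2 * s ^ 2 + E * p ^ 2 := by
    rw [hB, hE]
    have e1 := sq_nonneg (D * p - |b| * (1 + a) * s)
    have e2 : 0 ≤ (|b| * s * (1 - a)) ^ 2 := sq_nonneg _
    have e3 : 0 ≤ (D * p) ^ 2 := sq_nonneg _
    linarith
  have h4 : -(4 * c * a * X) ≤ r ^ 2 / 4 + b ^ 2 * a ^ 2 * s ^ 2 := by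
    have e1 : -(c * a * X) ≤ c * a * (r * s) := by
      have t1 : -X ≤ r * s := (neg_le_abs X).trans hX
      have t2 := mul_le_mul_of_nonneg_left t1 (mul_nonneg hc ha)
      linarith
    have e2 := sq_nonneg (r / 2 - 4 * c * a * s)
    have e3 : 16 * c ^ 2 * (a ^ 2 * s ^ 2) ≤ b ^ 2 * (a ^ 2 * s ^ 2) :=
      mul_le_mul_of_nonneg_right hc2 (by positivity)
    linarith
  have hE0 : 0 ≤ E := by rw [hE]; positivity
  have h5 : -(E * X) ≤ r ^ 2 / 4 + E ^ 2 * s ^ 2 := by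
    have e1 : -(E * X) ≤ E * (r * s) := by
      have t1 : -X ≤ r * s := (neg_le_abs X).trans hX
      have t2 := mul_le_mul_of_nonneg_left t1 hE0
      linarith
    have e2 := sq_nonneg (r / 2 - E * s)
    linarith
  have h6 : r ^ 2 + b ^ 2 * a ^ 2 * s ^ 2 ≤ 2 * (Fsq + G) + 2 * (b ^ 2 + E ^ 2) * s ^ 2 := by
    have e1 : 0 ≤ v ^ 2 * s ^ 2 := by positivity
    have e2 : 0 ≤ q * p ^ 2 := by positivity
    have e3 : 0 ≤ b ^ 2 * a ^ 2 * s ^ 2 := by positivity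
    rw [hFG]
    linarith
  have hs2 : 0 ≤ s ^ 2 := by positivity
  have h7 : r ^ 2 + b ^ 2 * a ^ 2 * s ^ 2 ≤ (18 + 2 * E ^ 2) * (Tsq + b ^ 4 * s ^ 2) + 2 * G := by
    have e1 : b ^ 2 * s ^ 2 ≤ b ^ 4 * s ^ 2 := mul_le_mul_of_nonneg_right hB4 hs2
    have e2 : E ^ 2 * (1 * s ^ 2) ≤ E ^ 2 * (b ^ 4 * s ^ 2) :=
      mul_le_mul_of_nonneg_left (mul_le_mul_of_nonneg_right hB41 hs2) (by positivity)
    have e3 : 0 ≤ E ^ 2 * Tsq := by positivity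
    linarith
  have h8 : q ^ 2 * s ^ 2 ≤ 2 * K₀ ^ 2 * (b ^ 2 * a ^ 2 * s ^ 2) + 2 * M ^ 2 * (b ^ 4 * s ^ 2) := by
    have e0 : q ^ 2 ≤ 2 * K₀ ^ 2 * a ^ 2 + 2 * M ^ 2 := by
      have : q ^ 2 ≤ (K₀ * a + M) ^ 2 := pow_le_pow_left₀ hq hqa 2
      have t1 := sq_nonneg (K₀ * a - M)
      linarith
    have e1 := mul_le_mul_of_nonneg_right e0 hs2
    have e2 : M ^ 2 * (1 * s ^ 2) ≤ M ^ 2 * (b ^ 4 * s ^ 2) :=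
      mul_le_mul_of_nonneg_left (mul_le_mul_of_nonneg_right hB41 hs2) (by positivity)
    have e3 : K₀ ^ 2 * a ^ 2 * s ^ 2 * 1 ≤ K₀ ^ 2 * a ^ 2 * s ^ 2 * b ^ 2 :=
      mul_le_mul_of_nonneg_left hB1 (by positivity)
    linarith
  have h9 := mul_le_mul_of_nonneg_left h7 (by positivity : (0 : ℝ) ≤ 1 + 2 * K₀ ^ 2)
  have h10 : 0 ≤ K₀ ^ 2 * r ^ 2 := by positivity
  have h11 : 0 ≤ M ^ 2 * Tsq := by positivity
  rw [hC]
  linarith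

set_option maxHeartbeats 1000000 in
/-- The pointwise inequality, in complex variables. -/
lemma aux_cplx (u u1 u2 : ℂ) (a q a' q' b c D E K₀ M C1 C2 C : ℝ)
    (ha : 0 ≤ a) (hq : 0 ≤ q) (hqa : q ≤ K₀ * a + M) (hK₀ : 0 ≤ K₀) (hM : 0 ≤ M)
    (hC1 : 0 ≤ C1) (hC2 : 0 ≤ C2)
    (ha' : |a'| ≤ C1 * (1 + a)) (hq' : |q'| ≤ C2 * (1 + q))
    (hb : 1 ≤ |b|) (hc : 0 ≤ c) (hcb : 4 * c ≤ |b|)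
    (hD : D = 2 * C2 * (1 + M + K₀) + 4 * C1) (hE : E = D ^ 2)
    (hC : C = (1 + 2 * K₀ ^ 2) * (18 + 2 * E ^ 2) + 2 * M ^ 2) :
    ‖u2‖ ^ 2 + ‖(q : ℂ) * u‖ ^ 2 + b ^ 2 * ‖(a : ℂ) * u‖ ^ 2
      ≤ C * (‖-u2 + (q : ℂ) * u + 2 * (-(c : ℂ) + Complex.I * (b : ℂ)) * (a : ℂ) * u
          + (-(c : ℂ) + Complex.I * (b : ℂ)) ^ 2 * u‖ ^ 2 + b ^ 4 * ‖u‖ ^ 2)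
        + 2 * (1 + 2 * K₀ ^ 2) *
          ((2 * (q' : ℂ) - 4 * b * Complex.I * (a' : ℂ)) * (u1 * star u)
          + (2 * (q : ℂ) + E - 4 * b * Complex.I * (a : ℂ)) * (u2 * star u + u1 * star u1)).re := by
  set lam : ℂ := -(c : ℂ) + Complex.I * (b : ℂ) with hlam
  set T : ℂ := -u2 + (q : ℂ) * u + 2 * lam * (a : ℂ) * u + lam ^ 2 * u with hT
  have hbnd : ∀ z w : ℂ, |(z * star w).re| ≤ ‖z‖ * ‖w‖ := fun z w => by
    refine (Complex.abs_re_le_norm _).trans ?_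
    rw [norm_mul, norm_star]
  have hbndi : ∀ z w : ℂ, |(z * star w).im| ≤ ‖z‖ * ‖w‖ := fun z w => by
    refine (Complex.abs_im_le_norm _).trans ?_
    rw [norm_mul, norm_star]
  have hB : b ^ 2 = |b| ^ 2 := (sq_abs b).symm
  have e1 : ‖(q : ℂ) * u‖ ^ 2 = q ^ 2 * ‖u‖ ^ 2 := by
    rw [norm_mul, mul_pow, Complex.norm_real, Real.norm_eq_abs, sq_abs]
  have e2 : ‖(a : ℂ) * u‖ ^ 2 = a ^ 2 * ‖u‖ ^ 2 := by
    rw [norm_mul, mul_pow, Complex.norm_real, Real.norm_eq_abs, sq_abs]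
  rw [e1, e2]
  refine aux_real ‖u2‖ ‖u1‖ ‖u‖ (u2 * star u).re (u1 * star u).re (u1 * star u).im
    a q a' q' b c D E K₀ M C1 C2 (‖T - lam ^ 2 * u‖ ^ 2) (‖T‖ ^ 2) _ C (q - 2 * c * a)
    (norm_nonneg _) (norm_nonneg _) (norm_nonneg _) (hbnd _ _) (hbnd _ _) (hbndi _ _)
    ha hq hqa hK₀ hM hC1 hC2 ha' hq' hb hc hcb hD hE ?_ ?_ (by positivity) hC
  · have : T - lam ^ 2 * u = -u2 + (q : ℂ) * u + 2 * lam * (a : ℂ) * u := by rw [hT]; ring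
    rw [this, hlam]
    simp only [← Complex.normSq_eq_norm_sq, Complex.normSq_apply]
    simp
    ring
  · have hl : ‖lam‖ ^ 2 ≤ 2 * b ^ 2 := by
      rw [← Complex.normSq_eq_norm_sq, Complex.normSq_apply, hlam]
      simp
      have t1 : c ≤ |b| := by linarith
      have t2 := pow_le_pow_left₀ hc t1 2
      rw [← hB] at t2
      linarith
    have hl2 : ‖lam ^ 2 * u‖ ^ 2 ≤ 4 * b ^ 4 * ‖u‖ ^ 2 := by
      rw [norm_mul, norm_pow, mul_pow]
      apply mul_le_mul_of_nonneg_right _ (by positivity)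
      calc (‖lam‖ ^ 2) ^ 2 ≤ (2 * b ^ 2) ^ 2 := pow_le_pow_left₀ (by positivity) hl 2
        _ = 4 * b ^ 4 := by ring
    have h3 := norm_sub_le T (lam ^ 2 * u)
    have h4 := pow_le_pow_left₀ (norm_nonneg _) h3 2
    have h5 := sq_nonneg (‖T‖ - ‖lam ^ 2 * u‖)
    linarith

lemma aux_int (f : ℝ → ℂ) (hf : Continuous f) (hs : HasCompactSupport f) :
    Integrable (fun x => ‖f x‖ ^ 2) := by
  have h1 : Continuous (fun x => ‖f x‖ ^ 2) := by fun_prop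
  have h2 : HasCompactSupport (fun x => ‖f x‖ ^ 2) :=
    HasCompactSupport.comp_left (g := fun z : ℂ => ‖z‖ ^ 2) hs (by simp)
  exact h1.integrable_of_hasCompactSupport h2

lemma aux_eLp (f : ℝ → ℂ) (hf : Continuous f) (hs : HasCompactSupport f) :
    eLpNorm f 2 volume ^ 2 = ENNReal.ofReal (∫ x, ‖f x‖ ^ 2) := by
  have hi : Integrable (fun x => ‖f x‖ ^ 2) :=
    aux_int f hf hs
  rw [ofReal_integral_eq_lintegral_ofReal hi (Eventually.of_forall fun x => by positivity)]
  have := eLpNorm_nnreal_pow_eq_lintegral (f := f) (p := 2) (μ := volume) (by norm_num)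
  have h2 : ((2 : NNReal) : ℝ≥0∞) = 2 := rfl
  rw [h2] at this
  norm_num at this
  rw [this]
  congr 1
  ext x
  rw [ENNReal.ofReal_pow (norm_nonneg _), ofReal_norm]

lemma aux_deriv (a : ℝ → ℝ) (ha : ∀ x, 0 ≤ a x)
    (h : ∀ n : ℕ, 1 ≤ n → ∃ C : ℝ, 0 < C ∧ ∀ x : ℝ,
      |iteratedDeriv n a x| ≤ C * (1 + a x) * (1 + x ^ 2) ^ (-(n : ℝ) / 2)) :
    ∃ C : ℝ, 0 ≤ C ∧ ∀ x, |deriv a x| ≤ C * (1 + a x) := by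
  obtain ⟨C, hC, hh⟩ := h 1 le_rfl
  refine ⟨C, hC.le, fun x => ?_⟩
  have h1 := hh x
  rw [iteratedDeriv_one] at h1
  refine h1.trans (mul_le_of_le_one_right (by have := ha x; positivity) ?_)
  apply Real.rpow_le_one_of_one_le_of_nonpos
  · nlinarith [sq_nonneg x]
  · norm_num

set_option maxHeartbeats 2000000 in
theorem stmt4 (a q : ℝ → ℝ) (h : Standing a q)
    (K : Set ℝ) (hKb : Bornology.IsBounded K) (hK : K ⊆ Set.Ici 0) :
    ∃ C : ℝ, 0 < C ∧ ∃ b₀ : ℝ, 0 < b₀ ∧ ∀ c ∈ K, ∀ b : ℝ, b₀ ≤ |b| →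
      ∀ u : ℝ → ℂ, ContDiff ℝ (⊤ : ℕ∞) u → HasCompactSupport u →
        eLpNorm (fun x => deriv (deriv u) x) 2 volume ^ 2
            + eLpNorm (fun x => (q x : ℂ) * u x) 2 volume ^ 2
            + ENNReal.ofReal (b ^ 2) * eLpNorm (fun x => (a x : ℂ) * u x) 2 volume ^ 2
          ≤ ENNReal.ofReal C *
              (eLpNorm (Tq a q (-(c : ℂ) + Complex.I * (b : ℂ)) u) 2 volume ^ 2
                + ENNReal.ofReal (b ^ 4) * eLpNorm u 2 volume ^ 2) := by
  obtain ⟨C1, hC1, ha'⟩ := aux_deriv a h.nonneg_a h.deriv_a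
  obtain ⟨C2, hC2, hq'⟩ := aux_deriv q h.nonneg_q h.deriv_q
  obtain ⟨K₀, hK₀, x₀, hx₀, hqa0⟩ := h.q_le_a
  have hqc : Continuous q := h.smooth_q.continuous
  have hac : Continuous a := h.smooth_a.continuous
  obtain ⟨M, hM, hqa⟩ : ∃ M : ℝ, 0 ≤ M ∧ ∀ x, q x ≤ K₀ * a x + M := by
    obtain ⟨M, hM⟩ := (isCompact_Icc (a := -x₀) (b := x₀)).bddAbove_image hqc.continuousOn
    refine ⟨max M 0, le_max_right _ _, fun x => ?_⟩
    have hax := mul_nonneg hK₀.le (h.nonneg_a x)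
    by_cases hx : x₀ < |x|
    · have := hqa0 x hx
      have := le_max_right M 0
      linarith
    · have : q x ≤ M := hM ⟨x, abs_le.1 (not_lt.1 hx), rfl⟩
      have := le_max_left M 0
      linarith
  obtain ⟨c0, hc0⟩ := hKb.exists_norm_le
  set D := 2 * C2 * (1 + M + K₀) + 4 * C1 with hD
  set E := D ^ 2 with hE
  set C := (1 + 2 * K₀ ^ 2) * (18 + 2 * E ^ 2) + 2 * M ^ 2 with hC
  have hCpos : 0 < C := by positivity
  refine ⟨C, hCpos, max 1 (4 * c0), by positivity, ?_⟩
  intro c hc b hb u hu hus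
  have hb1 : 1 ≤ |b| := (le_max_left _ _).trans hb
  have hcn : 0 ≤ c := hK hc
  have hcb : 4 * c ≤ |b| := by
    have h1 := hc0 c hc
    rw [Real.norm_eq_abs, abs_of_nonneg hcn] at h1
    have := (le_max_right 1 (4 * c0)).trans hb
    linarith
  have hu1 : ContDiff ℝ (⊤ : ℕ∞) (deriv u) := (contDiff_infty_iff_deriv.1 hu).2
  have hu2 : ContDiff ℝ (⊤ : ℕ∞) (deriv (deriv u)) := (contDiff_infty_iff_deriv.1 hu1).2
  have hus1 : HasCompactSupport (deriv u) := hus.deriv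
  have hus2 : HasCompactSupport (deriv (deriv u)) := hus1.deriv
  have hda : Continuous (deriv a) := (contDiff_infty_iff_deriv.1 h.smooth_a).2.continuous
  have hdq : Continuous (deriv q) := (contDiff_infty_iff_deriv.1 h.smooth_q).2.continuous
  have huc := hu.continuous
  have hu1c := hu1.continuous
  have hu2c := hu2.continuous
  set lam : ℂ := -(c : ℂ) + Complex.I * (b : ℂ) with hlam
  have hTc : Continuous (Tq a q lam u) := by unfold Tq; fun_prop
  have hqus : HasCompactSupport (fun x => (q x : ℂ) * u x) := hus.mul_left
  have haus : HasCompactSupport (fun x => (a x : ℂ) * u x) := hus.mul_left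
  have hTs : HasCompactSupport (Tq a q lam u) := by
    have e1 : HasCompactSupport (fun x => -deriv (deriv u) x) := hus2.neg
    have e2 : HasCompactSupport (fun x => 2 * lam * (a x : ℂ) * u x) := hus.mul_left
    have e3 : HasCompactSupport (fun x => lam ^ 2 * u x) := hus.mul_left
    exact ((e1.add hqus).add e2).add e3
  have hquc : Continuous (fun x => (q x : ℂ) * u x) := by fun_prop
  have hauc : Continuous (fun x => (a x : ℂ) * u x) := by fun_prop
  rw [aux_eLp _ hu2c hus2, aux_eLp _ hquc hqus, aux_eLp _ hauc haus, aux_eLp _ hTc hTs,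
    aux_eLp _ huc hus]
  have key : ∀ f : ℝ → ℂ, Continuous f → HasCompactSupport f →
      Integrable (fun x => ‖f x‖ ^ 2) := fun f hf hs =>
    aux_int f hf hs
  have i1 := key _ hu2c hus2
  have i2 := key _ hquc hqus
  have i3 := key _ hauc haus
  have i4 := key _ hTc hTs
  have i5 := key _ huc hus
  -- the divergence term
  set W : ℝ → ℂ := fun x => 2 * (q x : ℂ) + E - 4 * b * Complex.I * (a x : ℂ) with hW
  set W' : ℝ → ℂ := fun x => 2 * ((deriv q x : ℝ) : ℂ) - 4 * b * Complex.I * ((deriv a x : ℝ) : ℂ) with hW'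
  have hstar : HasCompactSupport (fun x => star (u x)) := hus.comp_left (g := star) (by simp)
  have hstar1 : HasCompactSupport (fun x => star (deriv u x)) :=
    hus1.comp_left (g := star) (by simp)
  set H : ℝ → ℂ := fun x => W x * (deriv u x * star (u x)) with hH
  set H' : ℝ → ℂ := fun x => W' x * (deriv u x * star (u x))
    + W x * (deriv (deriv u) x * star (u x) + deriv u x * star (deriv u x)) with hH'
  have hHs : HasCompactSupport H := (hstar.mul_left (f := deriv u)).mul_left (f := W)
  have hHs' : HasCompactSupport H' :=
    ((hstar.mul_left (f := deriv u)).mul_left (f := W')).add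
      (((hstar.mul_left (f := deriv (deriv u))).add (hstar1.mul_left (f := deriv u))).mul_left
        (f := W))
  have hHc : Continuous H := by rw [hH, hW]; fun_prop
  have hHc' : Continuous H' := by rw [hH', hW, hW']; fun_prop
  have hder : ∀ x, HasDerivAt H (H' x) x := by
    intro x
    have d1 : HasDerivAt u (deriv u x) x :=
      (hu.differentiable (by simp)).differentiableAt.hasDerivAt
    have d2 : HasDerivAt (deriv u) (deriv (deriv u) x) x :=
      (hu1.differentiable (by simp)).differentiableAt.hasDerivAt
    have d3 : HasDerivAt (fun x => (q x : ℂ)) ((deriv q x : ℝ) : ℂ) x :=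
      ((h.smooth_q.differentiable (by simp)).differentiableAt (x := x)).hasDerivAt.ofReal_comp
    have d4 : HasDerivAt (fun x => (a x : ℂ)) ((deriv a x : ℝ) : ℂ) x :=
      ((h.smooth_a.differentiable (by simp)).differentiableAt (x := x)).hasDerivAt.ofReal_comp
    have d5 : HasDerivAt W (W' x) x :=
      ((d3.const_mul 2).add_const (E : ℂ)).sub (d4.const_mul (4 * b * Complex.I))
    exact d5.mul (d2.mul d1.star)
  have hHi := hHc.integrable_of_hasCompactSupport (μ := volume) hHs
  have hHi' := hHc'.integrable_of_hasCompactSupport (μ := volume) hHs'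
  have hzero : ∫ x, H' x = 0 := integral_eq_zero_of_hasDerivAt_of_integrable hder hHi' hHi
  have hzre : ∫ x, (H' x).re = 0 := by
    have := integral_re hHi'
    simp only [RCLike.re_to_complex] at this
    rw [this, hzero]; simp
  have hrei : Integrable (fun x => (H' x).re) := hHi'.re
  have hpt : ∀ x, ‖deriv (deriv u) x‖ ^ 2 + ‖(q x : ℂ) * u x‖ ^ 2 + b ^ 2 * ‖(a x : ℂ) * u x‖ ^ 2
      ≤ C * (‖Tq a q lam u x‖ ^ 2 + b ^ 4 * ‖u x‖ ^ 2) + 2 * (1 + 2 * K₀ ^ 2) * (H' x).re :=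
    fun x => aux_cplx (u x) (deriv u x) (deriv (deriv u) x) (a x) (q x) (deriv a x) (deriv q x)
      b c D E K₀ M C1 C2 C (h.nonneg_a x) (h.nonneg_q x) (hqa x) hK₀.le hM hC1 hC2 (ha' x) (hq' x)
      hb1 hcn hcb hD hE hC
  have i12 : Integrable (fun x => ‖deriv (deriv u) x‖ ^ 2 + ‖(q x : ℂ) * u x‖ ^ 2) := i1.add i2
  have i45 : Integrable (fun x => C * (‖Tq a q lam u x‖ ^ 2 + b ^ 4 * ‖u x‖ ^ 2)) :=
    (i4.add (i5.const_mul (b ^ 4))).const_mul C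
  have hmono := integral_mono ((i1.add i2).add (i3.const_mul (b ^ 2)))
    (((i4.add (i5.const_mul (b ^ 4))).const_mul C).add (hrei.const_mul (2 * (1 + 2 * K₀ ^ 2)))) hpt
  have l1 : ∫ x, (‖deriv (deriv u) x‖ ^ 2 + ‖(q x : ℂ) * u x‖ ^ 2
      + b ^ 2 * ‖(a x : ℂ) * u x‖ ^ 2) = (∫ x, ‖deriv (deriv u) x‖ ^ 2)
      + (∫ x, ‖(q x : ℂ) * u x‖ ^ 2) + b ^ 2 * ∫ x, ‖(a x : ℂ) * u x‖ ^ 2 := by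
    rw [integral_add i12 (i3.const_mul (b ^ 2)), integral_add i1 i2, integral_const_mul]
  have l2 : ∫ x, (C * (‖Tq a q lam u x‖ ^ 2 + b ^ 4 * ‖u x‖ ^ 2)
      + 2 * (1 + 2 * K₀ ^ 2) * (H' x).re)
      = C * ((∫ x, ‖Tq a q lam u x‖ ^ 2) + b ^ 4 * ∫ x, ‖u x‖ ^ 2) := by
    rw [integral_add i45
      (hrei.const_mul (2 * (1 + 2 * K₀ ^ 2))), integral_const_mul, integral_const_mul, hzre,
      integral_add i4 (i5.const_mul (b ^ 4)), integral_const_mul]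
    ring
  have hfin : (∫ x, ‖deriv (deriv u) x‖ ^ 2)
      + (∫ x, ‖(q x : ℂ) * u x‖ ^ 2) + b ^ 2 * ∫ x, ‖(a x : ℂ) * u x‖ ^ 2
      ≤ C * ((∫ x, ‖Tq a q lam u x‖ ^ 2) + b ^ 4 * ∫ x, ‖u x‖ ^ 2) := by
    rw [← l1, ← l2]; exact hmono
  have nn : ∀ f : ℝ → ℂ, 0 ≤ ∫ x, ‖f x‖ ^ 2 := fun f => integral_nonneg fun x => by positivity
  have n1 := nn (fun x => deriv (deriv u) x)
  have n2 := nn (fun x => (q x : ℂ) * u x)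
  have n3 := nn (fun x => (a x : ℂ) * u x)
  have n4 := nn (Tq a q lam u)
  have n5 := nn u
  have hb2 : 0 ≤ b ^ 2 := by positivity
  have hb4 : 0 ≤ b ^ 4 := by positivity
  rw [← ENNReal.ofReal_mul hb2, ← ENNReal.ofReal_mul hb4, ← ENNReal.ofReal_add n1 n2,
    ← ENNReal.ofReal_add (add_nonneg n1 n2) (mul_nonneg hb2 n3),
    ← ENNReal.ofReal_add n4 (mul_nonneg hb4 n5), ← ENNReal.ofReal_mul hCpos.le]
  exact ENNReal.ofReal_le_ofReal hfin
end

section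
/- Under the standing assumptions on a and q, for every bounded set K ⊂ [0,∞) there exist constants C > 0 and b₀ > 0 such that for all c ∈ K and all real b with |b| ≥ b₀, setting λ = −c + i·b: (i) for every Schwartz function u : ℝ → ℂ one has (2|b| − C)·‖u‖ ≤ N_A(c)·‖T(λ)u‖ (an inequality in [0,∞]); and (ii) for every real M with M < N_A(c) there exists a nonzero Schwartz function u : ℝ → ℂ with M·‖T(λ)u‖ ≤ (2|b| + C)·‖u‖. (Together these say that the resolvent norm ‖T(λ)^{-1}‖ equals N_A(c)·(2|b|)^{-1}·(1 + O_K(|b|^{-1})) as |b| → ∞.) -/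
open MeasureTheory Filter
open scoped ENNReal

/-- The norm of the resolvent `(A - c)⁻¹` of the generalised Airy operator
`A = -d/dx + a`, as the supremum of `‖u‖ / ‖-u' + a·u - c·u‖` over nonzero
Schwartz functions, valued in `[0,∞]`. -/
noncomputable def NA (a : ℝ → ℝ) (c : ℝ) : ℝ≥0∞ :=
  ⨆ (u : SchwartzMap ℝ ℂ) (_ : u ≠ 0),
    eLpNorm (⇑u) 2 volume /
      eLpNorm (fun x => -deriv (⇑u) x + (a x : ℂ) * u x - (c : ℂ) * u x) 2 volume

/-- Abstract operator data extracted from the Schwartz space. -/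
structure Sys (S H : Type*) [AddCommGroup S] [Module ℂ S] [NormedAddCommGroup H]
    [InnerProductSpace ℂ H] where
  J : S →ₗ[ℂ] H
  D : S →ₗ[ℂ] S
  A : S →ₗ[ℂ] S
  A1 : S →ₗ[ℂ] S
  Q : S →ₗ[ℂ] S
  D_skew : ∀ u v, inner ℂ (J (D u)) (J v) = - inner ℂ (J u) (J (D v))
  A_sym : ∀ u v, inner ℂ (J (A u)) (J v) = inner ℂ (J u) (J (A v))
  comm : ∀ u, D (A u) = A1 u + A (D u)
  C1 : ℝ
  C1_nonneg : 0 ≤ C1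
  A1_le : ∀ u, ‖J (A1 u)‖ ≤ C1 * ‖J (u + A u)‖
  K : ℝ
  K_nonneg : 0 ≤ K
  Q_le : ∀ u, ‖J (Q u)‖ ≤ K * ‖J (u + A u)‖
  Q_im : ∀ u, (inner ℂ (J (Q u)) (J (u + A u)) : ℂ).im = 0
  id_le : ∀ u, ‖J u‖ ≤ ‖J (u + A u)‖
  A_le : ∀ u, ‖J (A u)‖ ≤ ‖J (u + A u)‖

namespace Sys

variable {S H : Type*} [AddCommGroup S] [Module ℂ S] [NormedAddCommGroup H]
    [InnerProductSpace ℂ H] (s : Sys S H)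

/-- weighted norm -/
noncomputable def Z (u : S) : ℝ := ‖s.J (u + s.A u)‖

lemma re_le (x y : H) : (inner ℂ x y : ℂ).re ≤ ‖x‖ * ‖y‖ :=
  (Complex.re_le_norm _).trans (norm_inner_le_norm x y)

lemma neg_re_le (x y : H) : -(inner ℂ x y : ℂ).re ≤ ‖x‖ * ‖y‖ := by
  have := Complex.abs_re_le_norm (inner ℂ x y : ℂ)
  have h2 := norm_inner_le_norm (𝕜 := ℂ) x y
  have := neg_abs_le (inner ℂ x y : ℂ).re
  linarith

lemma Z_nonneg (u : S) : 0 ≤ s.Z u := norm_nonneg _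

lemma two_re_D (u : S) : 2 * (inner ℂ (s.J (s.D u)) (s.J (u + s.A u)) : ℂ).re
    = -(inner ℂ (s.J u) (s.J (s.A1 u)) : ℂ).re := by
  have h1 := s.D_skew u (u + s.A u)
  have h2 : s.D (u + s.A u) = s.D u + (s.A1 u + s.A (s.D u)) := by
    rw [map_add, s.comm]
  have h3 := s.A_sym u (s.D u)
  rw [h2] at h1
  have h4 : (inner ℂ (s.J u) (s.J (s.D u)) : ℂ).re = (inner ℂ (s.J (s.D u)) (s.J u) : ℂ).re :=
    inner_re_symm (𝕜 := ℂ) _ _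
  have h5 : (inner ℂ (s.J (s.A u)) (s.J (s.D u)) : ℂ).re
      = (inner ℂ (s.J (s.D u)) (s.J (s.A u)) : ℂ).re :=
    inner_re_symm (𝕜 := ℂ) _ _
  have h1r := congrArg Complex.re h1
  have h3r := congrArg Complex.re h3
  simp only [map_add, inner_add_right, Complex.add_re, Complex.neg_re] at h1r h3r ⊢
  linarith

lemma inner_self_re (x : H) : (inner ℂ x x : ℂ).re = ‖x‖ ^ 2 :=
  inner_self_eq_norm_sq (𝕜 := ℂ) x

lemma I_re (r : ℝ) (x : H) : (inner ℂ ((Complex.I * (r : ℂ)) • x) x : ℂ).re = 0 := by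
  rw [inner_smul_left, inner_self_eq_norm_sq_to_K]
  simp [← Complex.ofReal_pow]

lemma inner_A_im (u : S) : (inner ℂ (s.J u) (s.J (s.A u)) : ℂ).im = 0 := by
  have h := s.A_sym u u
  rw [← inner_conj_symm] at h
  have := congrArg Complex.im h
  simp only [Complex.conj_im] at this
  linarith

/-- first-order energy estimate -/
lemma energy1 (c β : ℝ) (hc : 0 ≤ c) (σ : ℝ) (hσ : |σ| ≤ 1) (u f : S)
    (hf : f = (σ : ℂ) • s.D u + s.A u - (c : ℂ) • u + (Complex.I * (β : ℂ)) • u) :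
    s.Z u ≤ ‖s.J f‖ + (1 + c + s.C1) * ‖s.J u‖ := by
  have h1 := s.two_re_D u
  set m := s.J (u + s.A u) with hm
  have e0 : s.J f = (σ : ℂ) • s.J (s.D u) + m - ((1 + c : ℝ) : ℂ) • s.J u
      + (Complex.I * (β : ℂ)) • s.J u := by
    rw [hf, hm]; simp only [map_add, map_sub, map_smul]; push_cast; module
  have e1 : (inner ℂ (s.J f) m : ℂ).re = σ * (inner ℂ (s.J (s.D u)) m : ℂ).re + ‖m‖ ^ 2
      - (1 + c) * (inner ℂ (s.J u) m : ℂ).re := by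
    have hi : (inner ℂ (s.J u) m : ℂ).im = 0 := by
      rw [hm, map_add, inner_add_right, Complex.add_im, s.inner_A_im]
      have := inner_self_im (𝕜 := ℂ) (s.J u)
      simpa using this
    rw [e0]
    simp only [inner_add_left, inner_sub_left, inner_smul_left, Complex.add_re, Complex.sub_re,
      inner_self_re, map_mul, Complex.conj_ofReal, Complex.conj_I, Complex.mul_re, Complex.mul_im,
      Complex.ofReal_re, Complex.ofReal_im, hi, Complex.neg_re, Complex.neg_im, Complex.I_re,
      Complex.I_im]
    ring
  have b1 : (inner ℂ (s.J f) m : ℂ).re ≤ ‖s.J f‖ * ‖m‖ := re_le _ _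
  have b2 : (inner ℂ (s.J u) m : ℂ).re ≤ ‖s.J u‖ * ‖m‖ := re_le _ _
  have b3 : |(inner ℂ (s.J (s.D u)) m : ℂ).re| ≤ ‖s.J u‖ * (s.C1 * ‖m‖) := by
    have h2 : |(inner ℂ (s.J u) (s.J (s.A1 u)) : ℂ).re| ≤ ‖s.J u‖ * (s.C1 * ‖m‖) :=
      (Complex.abs_re_le_norm _).trans ((norm_inner_le_norm _ _).trans
        (mul_le_mul_of_nonneg_left (s.A1_le u) (norm_nonneg _)))
    have h3 := abs_nonneg (inner ℂ (s.J u) (s.J (s.A1 u)) : ℂ).re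
    have : (inner ℂ (s.J (s.D u)) m : ℂ).re = -(inner ℂ (s.J u) (s.J (s.A1 u)) : ℂ).re / 2 := by
      linarith
    rw [this, abs_div, abs_neg, abs_two]
    linarith
  have b4 : -(σ * (inner ℂ (s.J (s.D u)) m : ℂ).re) ≤ ‖s.J u‖ * (s.C1 * ‖m‖) := by
    have := neg_abs_le (σ * (inner ℂ (s.J (s.D u)) m : ℂ).re)
    rw [abs_mul] at this
    have := mul_le_mul hσ b3 (abs_nonneg _) (by norm_num)
    linarith
  have b5 : (1 + c) * (inner ℂ (s.J u) m : ℂ).re ≤ (1 + c) * (‖s.J u‖ * ‖m‖) :=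
    mul_le_mul_of_nonneg_left b2 (by linarith)
  have key : ‖m‖ * ‖m‖ ≤ (‖s.J f‖ + (1 + c + s.C1) * ‖s.J u‖) * ‖m‖ := by nlinarith
  change ‖m‖ ≤ _
  rcases (norm_nonneg m).eq_or_lt with h0 | h0
  · rw [← h0]; have := s.C1_nonneg; positivity
  · exact le_of_mul_le_mul_right key h0

/-- the quadratic operator -/
noncomputable def T (c b : ℝ) (u : S) : S :=
  -s.D (s.D u) + s.Q u + (2 * (-(c : ℂ) + Complex.I * b)) • s.A u
    + ((-(c : ℂ) + Complex.I * b) ^ 2) • u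

lemma re_T (c b : ℝ) (u : S) : (inner ℂ (s.J (s.T c b u)) (s.J u) : ℂ).re
    = ‖s.J (s.D u)‖ ^ 2 - b ^ 2 * ‖s.J u‖ ^ 2 + c ^ 2 * ‖s.J u‖ ^ 2
      + (inner ℂ (s.J (s.Q u)) (s.J u) : ℂ).re - 2 * c * (inner ℂ (s.J (s.A u)) (s.J u) : ℂ).re := by
  have h1 := s.D_skew (s.D u) u
  have h2 : (inner ℂ (s.J (s.A u)) (s.J u) : ℂ).im = 0 := by
    rw [s.A_sym]; exact s.inner_A_im u
  have h3 : (inner ℂ (s.J u) (s.J u) : ℂ).im = 0 := by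
    simpa using inner_self_im (𝕜 := ℂ) (s.J u)
  unfold T
  simp only [map_add, map_neg, map_smul, inner_add_left, inner_neg_left, inner_smul_left,
    h1, neg_neg, Complex.add_re, inner_self_re, map_mul, Complex.conj_ofReal,
      Complex.conj_I, Complex.mul_re, Complex.mul_im, pow_two, Complex.add_im,
      Complex.ofReal_re, Complex.ofReal_im, h2, h3, Complex.neg_re, Complex.neg_im, Complex.I_re,
      Complex.I_im, map_ofNat, Complex.re_ofNat, Complex.im_ofNat]
  ring

lemma im_T (c b : ℝ) (u : S) :
    (inner ℂ (s.J (s.T c b u)) (s.J (u + s.A u)) : ℂ).im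
    = (inner ℂ (s.J (s.D u)) (s.J (s.A1 u)) : ℂ).im
      - 2 * b * (s.Z u ^ 2 - (1 + c) * (inner ℂ (s.J u) (s.J (u + s.A u)) : ℂ).re) := by
  have h1 := s.D_skew (s.D u) (u + s.A u)
  have hi : (inner ℂ (s.J u) (s.J (u + s.A u)) : ℂ).im = 0 := by
    rw [map_add, inner_add_right, Complex.add_im, s.inner_A_im]
    have := inner_self_im (𝕜 := ℂ) (s.J u)
    simpa using this
  have h2 : s.D (u + s.A u) = s.D u + (s.A1 u + s.A (s.D u)) := by
    rw [map_add, s.comm]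
  have h3 : (inner ℂ (s.J (s.D u)) (s.J (s.D (u + s.A u))) : ℂ).im
      = (inner ℂ (s.J (s.D u)) (s.J (s.A1 u)) : ℂ).im := by
    rw [h2]
    simp only [map_add, inner_add_right, Complex.add_im, s.inner_A_im]
    have := inner_self_im (𝕜 := ℂ) (s.J (s.D u))
    simp at this
    simp [this]
  have h4 : s.A u = (u + s.A u) - u := by abel
  have h5 : s.J (s.T c b u) = - s.J (s.D (s.D u)) + s.J (s.Q u)
      + (2 * (-(c : ℂ) + Complex.I * b)) • s.J (u + s.A u)
      + ((-(c : ℂ) + Complex.I * b) ^ 2 - (2 * (-(c : ℂ) + Complex.I * b))) • s.J u := by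
    unfold T; simp only [map_add, map_neg, map_smul]; module
  have hm : (inner ℂ (s.J (u + s.A u)) (s.J (u + s.A u)) : ℂ).im = 0 := by
    simpa using inner_self_im (𝕜 := ℂ) (s.J (u + s.A u))
  rw [h5]
  unfold Z
  simp only [inner_add_left, inner_neg_left, inner_smul_left,
    h1, neg_neg, Complex.add_im, h3, s.Q_im]
  generalize s.J (u + s.A u) = m at *
  simp only [inner_self_re, map_sub, map_add, map_neg, map_mul, Complex.conj_ofReal,
      Complex.conj_I, Complex.mul_re, Complex.mul_im, pow_two, Complex.add_im, Complex.sub_im,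
      Complex.sub_re, Complex.add_re,
      Complex.ofReal_re, Complex.ofReal_im, hi, hm, Complex.neg_re, Complex.neg_im, Complex.I_re,
      Complex.I_im, map_ofNat, Complex.re_ofNat, Complex.im_ofNat]
  ring

/-- second-order energy estimate -/
lemma energy2 (c b : ℝ) (hc : 0 ≤ c) (hb : 1 ≤ |b|) (hb1 : s.C1 ≤ |b|) (hb2 : c + s.K ≤ |b|)
    (u : S) :
    |b| * s.Z u ≤ (1 + s.C1) * ‖s.J (s.T c b u)‖ + (2 + 2 * c + 2 * s.C1) * |b| * ‖s.J u‖ := by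
  have e1 := s.im_T c b u
  have e2 := s.re_T c b u
  have hZ := s.Z_nonneg u
  have hC := s.C1_nonneg
  have hK := s.K_nonneg
  set F := ‖s.J (s.T c b u)‖
  set U := ‖s.J u‖
  set V := ‖s.J (s.D u)‖
  have hF : 0 ≤ F := norm_nonneg _
  have hU : 0 ≤ U := norm_nonneg _
  have hV : 0 ≤ V := norm_nonneg _
  have f1 : (inner ℂ (s.J (s.T c b u)) (s.J u) : ℂ).re ≤ F * U := re_le _ _
  have f2 : -(inner ℂ (s.J (s.Q u)) (s.J u) : ℂ).re ≤ (s.K * s.Z u) * U :=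
    (neg_re_le _ _).trans (mul_le_mul_of_nonneg_right (s.Q_le u) hU)
  have f3 : (inner ℂ (s.J (s.A u)) (s.J u) : ℂ).re ≤ s.Z u * U :=
    (re_le _ _).trans (mul_le_mul_of_nonneg_right (s.A_le u) hU)
  have f4 : V ^ 2 ≤ F * U + |b| ^ 2 * U ^ 2 + (2 * c + s.K) * s.Z u * U := by
    have : 2 * c * (inner ℂ (s.J (s.A u)) (s.J u) : ℂ).re ≤ 2 * c * (s.Z u * U) :=
      mul_le_mul_of_nonneg_left f3 (by linarith)
    rw [sq_abs]
    nlinarith [mul_nonneg (sq_nonneg c) (sq_nonneg U)]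
  have f5 : V ≤ F + |b| * U + s.Z u := by
    refine le_of_sq_le_sq ?_ (by positivity)
    have g1 : F * U ≤ F * (|b| * U) := by
      apply mul_le_mul_of_nonneg_left _ hF
      nlinarith
    have g2 : (2 * c + s.K) * s.Z u * U ≤ (2 * |b|) * s.Z u * U := by
      have : 2 * c + s.K ≤ 2 * |b| := by linarith
      gcongr
    have g3 : 0 ≤ F * (|b| * U) := by positivity
    have g4 : 0 ≤ F * s.Z u := by positivity
    nlinarith [sq_nonneg F, sq_nonneg (s.Z u)]
  have f6 : |(inner ℂ (s.J (s.T c b u)) (s.J (u + s.A u)) : ℂ).im| ≤ F * s.Z u :=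
    (Complex.abs_im_le_norm _).trans (norm_inner_le_norm _ _)
  have f7 : |(inner ℂ (s.J (s.D u)) (s.J (s.A1 u)) : ℂ).im| ≤ V * (s.C1 * s.Z u) :=
    (Complex.abs_im_le_norm _).trans ((norm_inner_le_norm _ _).trans
      (mul_le_mul_of_nonneg_left (s.A1_le u) hV))
  have f8 : (inner ℂ (s.J u) (s.J (u + s.A u)) : ℂ).re ≤ U * s.Z u := re_le _ _
  set X := s.Z u ^ 2 - (1 + c) * (inner ℂ (s.J u) (s.J (u + s.A u)) : ℂ).re with hX
  have f9 : 2 * |b| * X ≤ F * s.Z u + V * (s.C1 * s.Z u) := by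
    have : 2 * b * X = (inner ℂ (s.J (s.D u)) (s.J (s.A1 u)) : ℂ).im
      - (inner ℂ (s.J (s.T c b u)) (s.J (u + s.A u)) : ℂ).im := by linarith
    have h2 : |2 * b * X| ≤ F * s.Z u + V * (s.C1 * s.Z u) := by
      rw [this]
      exact (abs_sub _ _).trans (by linarith)
    rw [abs_mul, abs_mul, abs_two] at h2
    have := le_abs_self X
    have : 2 * |b| * X ≤ 2 * |b| * |X| := mul_le_mul_of_nonneg_left this (by positivity)
    linarith
  have f10 : (1 + c) * (inner ℂ (s.J u) (s.J (u + s.A u)) : ℂ).re ≤ (1 + c) * (U * s.Z u) :=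
    mul_le_mul_of_nonneg_left f8 (by linarith)
  have f11 : 2 * |b| * (s.Z u ^ 2 - (1 + c) * (U * s.Z u)) ≤ 2 * |b| * X :=
    mul_le_mul_of_nonneg_left (by linarith) (by positivity)
  have f12 : V * (s.C1 * s.Z u) ≤ (F + |b| * U + s.Z u) * (s.C1 * s.Z u) :=
    mul_le_mul_of_nonneg_right f5 (by positivity)
  have f13 : s.C1 * s.Z u * s.Z u ≤ |b| * s.Z u * s.Z u := by gcongr
  have hbU : 0 ≤ |b| * U := by positivity
  have key : (|b| * s.Z u) * s.Z u ≤
      ((1 + s.C1) * F + (2 + 2 * c + 2 * s.C1) * |b| * U) * s.Z u := by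
    nlinarith [mul_nonneg (mul_nonneg hC hbU) hZ]
  rcases hZ.eq_or_lt with h0 | h0
  · rw [← h0]; simp only [mul_zero]; positivity
  · exact le_of_mul_le_mul_right key h0


lemma g_inner (c b : ℝ) (u : S) :
    4 * b ^ 2 * ‖s.J u‖ ^ 2 ≤ ‖s.J (-s.D u + s.A u - (c : ℂ) • u + (Complex.I * (b : ℂ)) • u)‖ ^ 2
      + ‖s.J (s.D u + s.A u - (c : ℂ) • u + (Complex.I * (b : ℂ)) • u)‖ ^ 2
      + 2 * (-(inner ℂ (s.J (s.T c b u)) (s.J u) : ℂ).re + ‖s.J (s.A u)‖ ^ 2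
        - 4 * c * (inner ℂ (s.J (s.A u)) (s.J u) : ℂ).re
        + (inner ℂ (s.J (s.Q u)) (s.J u) : ℂ).re + 2 * c ^ 2 * ‖s.J u‖ ^ 2) := by
  rw [s.re_T]
  have hA : s.J (-s.D u + s.A u - (c : ℂ) • u + (Complex.I * (b : ℂ)) • u)
      = (s.J (s.A u - (c : ℂ) • u) + (Complex.I * (b : ℂ)) • s.J u) - s.J (s.D u) := by
    simp only [map_add, map_sub, map_neg, map_smul]; abel
  have hB : s.J (s.D u + s.A u - (c : ℂ) • u + (Complex.I * (b : ℂ)) • u)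
      = (s.J (s.A u - (c : ℂ) • u) + (Complex.I * (b : ℂ)) • s.J u) + s.J (s.D u) := by
    simp only [map_add, map_sub, map_smul]; abel
  have hp := parallelogram_law_with_norm ℂ
    (s.J (s.A u - (c : ℂ) • u) + (Complex.I * (b : ℂ)) • s.J u) (s.J (s.D u))
  have hi : (inner ℂ (s.J (s.A u)) (s.J u) : ℂ).im = 0 := by
    rw [s.A_sym]; exact s.inner_A_im u
  have h3 : (inner ℂ (s.J u) (s.J u) : ℂ).im = 0 := by
    simpa using inner_self_im (𝕜 := ℂ) (s.J u)
  have hs : (inner ℂ (s.J u) (s.J (s.A u)) : ℂ).re = (inner ℂ (s.J (s.A u)) (s.J u) : ℂ).re :=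
    inner_re_symm (𝕜 := ℂ) _ _
  have hW : ‖s.J (s.A u - (c : ℂ) • u) + (Complex.I * (b : ℂ)) • s.J u‖ ^ 2
      = ‖s.J (s.A u)‖ ^ 2 - 2 * c * (inner ℂ (s.J (s.A u)) (s.J u) : ℂ).re + c ^ 2 * ‖s.J u‖ ^ 2
        + b ^ 2 * ‖s.J u‖ ^ 2 := by
    rw [← inner_self_re]
    simp only [map_sub, map_smul, inner_add_left, inner_add_right, inner_sub_left, inner_sub_right,
      inner_smul_left, inner_smul_right, Complex.add_re, Complex.sub_re, inner_self_re, map_mul,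
      Complex.conj_ofReal, Complex.conj_I, Complex.mul_re, Complex.mul_im, Complex.add_im,
      Complex.sub_im, Complex.ofReal_re, Complex.ofReal_im, hi, h3, hs, s.inner_A_im,
      Complex.neg_re, Complex.neg_im, Complex.I_re, Complex.I_im]
    ring
  have hW0 : ‖s.J (s.A u - (c : ℂ) • u)‖ ^ 2
      = ‖s.J (s.A u)‖ ^ 2 - 2 * c * (inner ℂ (s.J (s.A u)) (s.J u) : ℂ).re
        + c ^ 2 * ‖s.J u‖ ^ 2 := by
    rw [← inner_self_re]
    simp only [map_sub, map_smul, inner_sub_left, inner_sub_right,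
      inner_smul_left, inner_smul_right, Complex.sub_re, inner_self_re,
      Complex.conj_ofReal, Complex.mul_re, Complex.mul_im,
      Complex.ofReal_re, Complex.ofReal_im, hi, h3, hs, s.inner_A_im]
    ring
  rw [hA, hB]
  nlinarith [hp, hW, hW0, sq_nonneg ‖s.J (s.A u - (c : ℂ) • u)‖]

lemma g_eq (c b : ℝ) (u : S) :
    let g := -s.D u + s.A u - (c : ℂ) • u + (Complex.I * (b : ℂ)) • u
    s.D g + s.A g - (c : ℂ) • g + (Complex.I * (b : ℂ)) • g
      = s.T c b u + (s.A (s.A u) - s.Q u + s.A1 u) := by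
  intro g
  simp only [g, T, map_add, map_sub, map_neg, map_smul, s.comm]
  module

lemma h_eq (c b : ℝ) (u : S) :
    let g : S := s.D u + s.A u - (c : ℂ) • u + (Complex.I * (b : ℂ)) • u;
    (-s.D g + s.A g - (c : ℂ) • g + (Complex.I * (b : ℂ)) • g)
      = s.T c b u + (s.A (s.A u) - s.Q u - s.A1 u) := by
  intro g
  simp only [g, T, map_add, map_sub, map_neg, map_smul, s.comm]
  module

/-- duality with sign `σ` -/
lemma adj (c b σ : ℝ) (u v : S) :
    inner ℂ (s.J ((σ : ℂ) • s.D u + s.A u - (c : ℂ) • u + (Complex.I * (b : ℂ)) • u)) (s.J v)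
    = inner ℂ (s.J u)
      (s.J (-((σ : ℂ) • s.D v) + s.A v - (c : ℂ) • v - (Complex.I * (b : ℂ)) • v)) := by
  simp only [map_add, map_sub, map_neg, map_smul, inner_add_left, inner_add_right, inner_sub_left,
    inner_sub_right, inner_neg_right, inner_smul_left, inner_smul_right, s.D_skew, s.A_sym, map_mul,
    Complex.conj_ofReal, Complex.conj_I]
  ring

lemma adj1 (c b : ℝ) (u v : S) :
    inner ℂ (s.J (s.D u + s.A u - (c : ℂ) • u + (Complex.I * (b : ℂ)) • u)) (s.J v)
    = inner ℂ (s.J u)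
      (s.J (-s.D v + s.A v - (c : ℂ) • v - (Complex.I * (b : ℂ)) • v)) := by
  have := s.adj c b 1 u v
  simpa using this

lemma adj2 (c b : ℝ) (u v : S) :
    inner ℂ (s.J (-s.D u + s.A u - (c : ℂ) • u + (Complex.I * (b : ℂ)) • u)) (s.J v)
    = inner ℂ (s.J u)
      (s.J (s.D v + s.A v - (c : ℂ) • v - (Complex.I * (b : ℂ)) • v)) := by
  have := s.adj c b (-1) u v
  simpa using this

/-- orthogonality of the two dual solutions -/
lemma cross (c b : ℝ) (φ ψ g h : S)
    (hφ : -s.D φ + s.A φ - (c : ℂ) • φ - (Complex.I * (b : ℂ)) • φ = g)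
    (hψ : s.D ψ + s.A ψ - (c : ℂ) • ψ - (Complex.I * (b : ℂ)) • ψ = h) :
    2 * |b| * ‖(inner ℂ (s.J φ) (s.J ψ) : ℂ)‖ ≤ ‖s.J g‖ * ‖s.J ψ‖ + ‖s.J φ‖ * ‖s.J h‖ := by
  have e : (2 * Complex.I * b) * inner ℂ (s.J φ) (s.J ψ)
      = inner ℂ (s.J g) (s.J ψ) - inner ℂ (s.J φ) (s.J h) := by
    rw [← hφ, ← hψ]
    simp only [map_add, map_sub, map_neg, map_smul, inner_add_left, inner_add_right, inner_sub_left,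
      inner_sub_right, inner_neg_left, inner_smul_left, inner_smul_right, s.D_skew, s.A_sym,
      map_mul, Complex.conj_ofReal, Complex.conj_I]
    ring
  have e2 := congrArg norm e
  rw [norm_mul] at e2
  have e3 : ‖(2 * Complex.I * b : ℂ)‖ = 2 * |b| := by simp
  rw [e3] at e2
  rw [e2]
  refine (norm_sub_le _ _).trans (add_le_add ?_ ?_) <;> exact norm_inner_le_norm _ _

/-- the key bound on `G² = ‖g‖² + ‖h‖²` -/
lemma keyG (c b N N1 : ℝ) (hc : 0 ≤ c) (hb : 0 < |b|) (hN : 0 ≤ N) (hN1 : N ≤ N1) (u φ ψ g h : S)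
    (hg : g = -s.D u + s.A u - (c : ℂ) • u + (Complex.I * (b : ℂ)) • u)
    (hh : h = s.D u + s.A u - (c : ℂ) • u + (Complex.I * (b : ℂ)) • u)
    (hφ : -s.D φ + s.A φ - (c : ℂ) • φ - (Complex.I * (b : ℂ)) • φ = g)
    (hψ : s.D ψ + s.A ψ - (c : ℂ) • ψ - (Complex.I * (b : ℂ)) • ψ = h)
    (hφN : ‖s.J φ‖ ≤ N * ‖s.J g‖) (hψN : ‖s.J ψ‖ ≤ N * ‖s.J h‖) :
    √(‖s.J g‖ ^ 2 + ‖s.J h‖ ^ 2) ≤ (N + 1 / (2 * |b|)) * ‖s.J (s.T c b u)‖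
      + 2 * ((1 + (1 + c + s.C1) * N1) + (s.K + s.C1) * N1) * s.Z u := by
  set G := √(‖s.J g‖ ^ 2 + ‖s.J h‖ ^ 2) with hG
  have hC := s.C1_nonneg
  have hK := s.K_nonneg
  have hZ := s.Z_nonneg u
  have hG0 : 0 ≤ G := Real.sqrt_nonneg _
  have hG2 : G ^ 2 = ‖s.J g‖ ^ 2 + ‖s.J h‖ ^ 2 := Real.sq_sqrt (by positivity)
  have hgG : ‖s.J g‖ ≤ G := le_of_sq_le_sq (by rw [hG2]; nlinarith [sq_nonneg ‖s.J h‖]) hG0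
  have hhG : ‖s.J h‖ ≤ G := le_of_sq_le_sq (by rw [hG2]; nlinarith [sq_nonneg ‖s.J g‖]) hG0
  have hN1' : 0 ≤ N1 := hN.trans hN1
  have hφG : ‖s.J φ‖ ≤ N1 * G := hφN.trans (mul_le_mul hN1 hgG (norm_nonneg _) hN1')
  have hψG : ‖s.J ψ‖ ≤ N1 * G := hψN.trans (mul_le_mul hN1 hhG (norm_nonneg _) hN1')
  have zφ : s.Z φ ≤ (1 + (1 + c + s.C1) * N1) * G := by
    have := s.energy1 c (-b) hc (-1) (by simp) φ g (by rw [← hφ]; push_cast; module)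
    have h2 := mul_le_mul_of_nonneg_left hφG (by positivity : 0 ≤ 1 + c + s.C1)
    linarith
  have zψ : s.Z ψ ≤ (1 + (1 + c + s.C1) * N1) * G := by
    have := s.energy1 c (-b) hc 1 (by simp) ψ h (by rw [← hψ]; push_cast; module)
    have h2 := mul_le_mul_of_nonneg_left hψG (by positivity : 0 ≤ 1 + c + s.C1)
    linarith
  have cr := s.cross c b φ ψ g h hφ hψ
  -- norm of the sum
  have hsum : ‖s.J (φ + ψ)‖ ≤ (N + 1 / (2 * |b|)) * G := by
    refine le_of_sq_le_sq ?_ (by positivity)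
    have e1 : ‖s.J (φ + ψ)‖ ^ 2 ≤ ‖s.J φ‖ ^ 2 + 2 * ‖(inner ℂ (s.J φ) (s.J ψ) : ℂ)‖
        + ‖s.J ψ‖ ^ 2 := by
      rw [map_add, norm_add_sq (𝕜 := ℂ)]
      have := Complex.re_le_norm (inner ℂ (s.J φ) (s.J ψ) : ℂ)
      simp only [RCLike.re_to_complex]
      linarith
    have e2 : 2 * ‖(inner ℂ (s.J φ) (s.J ψ) : ℂ)‖ ≤ N * G ^ 2 / |b| := by
      rw [le_div_iff₀ hb]
      have h1 := mul_le_mul_of_nonneg_left hψN (norm_nonneg (s.J g))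
      have h2 := mul_le_mul_of_nonneg_right hφN (norm_nonneg (s.J h))
      have h3 : 2 * (‖s.J g‖ * ‖s.J h‖) ≤ G ^ 2 := by
        rw [hG2]; nlinarith [sq_nonneg (‖s.J g‖ - ‖s.J h‖)]
      have h4 := mul_le_mul_of_nonneg_left h3 hN
      linarith
    have e3 : ‖s.J φ‖ ^ 2 ≤ N ^ 2 * ‖s.J g‖ ^ 2 := by
      rw [← mul_pow]; exact pow_le_pow_left₀ (norm_nonneg _) hφN 2
    have e4 : ‖s.J ψ‖ ^ 2 ≤ N ^ 2 * ‖s.J h‖ ^ 2 := by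
      rw [← mul_pow]; exact pow_le_pow_left₀ (norm_nonneg _) hψN 2
    have e5 : ((N + 1 / (2 * |b|)) * G) ^ 2
        = N ^ 2 * G ^ 2 + N * G ^ 2 / |b| + (1 / (2 * |b|) * G) ^ 2 := by
      field_simp; ring
    rw [e5]
    have : N ^ 2 * G ^ 2 = N ^ 2 * ‖s.J g‖ ^ 2 + N ^ 2 * ‖s.J h‖ ^ 2 := by rw [hG2]; ring
    nlinarith [sq_nonneg (1 / (2 * |b|) * G)]
  -- duality
  have d1 : (‖s.J g‖ ^ 2 : ℝ) = (inner ℂ (s.J (s.T c b u)) (s.J φ) : ℂ).re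
      + ((inner ℂ (s.J (s.A u)) (s.J (s.A φ)) : ℂ).re - (inner ℂ (s.J (s.Q u)) (s.J φ) : ℂ).re
        + (inner ℂ (s.J (s.A1 u)) (s.J φ) : ℂ).re) := by
    have h1 := s.adj1 c b g φ
    rw [hφ] at h1
    have h2 := s.g_eq c b u
    simp only [← hg] at h2
    rw [h2] at h1
    rw [← inner_self_re, ← h1]
    simp only [map_add, map_sub, inner_add_left, inner_sub_left, s.A_sym, Complex.add_re,
      Complex.sub_re]
  have d2 : (‖s.J h‖ ^ 2 : ℝ) = (inner ℂ (s.J (s.T c b u)) (s.J ψ) : ℂ).re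
      + ((inner ℂ (s.J (s.A u)) (s.J (s.A ψ)) : ℂ).re - (inner ℂ (s.J (s.Q u)) (s.J ψ) : ℂ).re
        - (inner ℂ (s.J (s.A1 u)) (s.J ψ) : ℂ).re) := by
    have h1 := s.adj2 c b h ψ
    rw [hψ] at h1
    have h2 := s.h_eq c b u
    simp only [← hh] at h2
    rw [h2] at h1
    rw [← inner_self_re, ← h1]
    simp only [map_add, map_sub, inner_add_left, inner_sub_left, s.A_sym, Complex.add_re,
      Complex.sub_re]
  have d3 : (inner ℂ (s.J (s.T c b u)) (s.J φ) : ℂ).re + (inner ℂ (s.J (s.T c b u)) (s.J ψ) : ℂ).re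
      ≤ ‖s.J (s.T c b u)‖ * ((N + 1 / (2 * |b|)) * G) := by
    rw [← Complex.add_re, ← inner_add_right, ← map_add]
    exact (re_le _ _).trans (mul_le_mul_of_nonneg_left hsum (norm_nonneg _))
  have t1 : ∀ χ, s.Z χ ≤ (1 + (1 + c + s.C1) * N1) * G →
      (inner ℂ (s.J (s.A u)) (s.J (s.A χ)) : ℂ).re ≤ s.Z u * ((1 + (1 + c + s.C1) * N1) * G) :=
    fun χ hχ => (re_le _ _).trans (mul_le_mul (s.A_le u) ((s.A_le χ).trans hχ) (norm_nonneg _) hZ)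
  have t2 : ∀ χ, ‖s.J χ‖ ≤ N1 * G →
      -(inner ℂ (s.J (s.Q u)) (s.J χ) : ℂ).re ≤ (s.K * s.Z u) * (N1 * G) :=
    fun χ hχ => (neg_re_le _ _).trans (mul_le_mul (s.Q_le u) hχ (norm_nonneg _) (by positivity))
  have t3 := (re_le (s.J (s.A1 u)) (s.J φ)).trans
    (mul_le_mul (s.A1_le u) hφG (norm_nonneg _) (mul_nonneg hC hZ))
  have t4 := (neg_re_le (s.J (s.A1 u)) (s.J ψ)).trans
    (mul_le_mul (s.A1_le u) hψG (norm_nonneg _) (mul_nonneg hC hZ))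
  have t5 := t1 φ zφ
  have t6 := t1 ψ zψ
  have t7 := t2 φ hφG
  have t8 := t2 ψ hψG
  change _ ≤ s.C1 * s.Z u * _ at t3
  change _ ≤ s.C1 * s.Z u * _ at t4
  have key : G * G ≤ ((N + 1 / (2 * |b|)) * ‖s.J (s.T c b u)‖
      + 2 * ((1 + (1 + c + s.C1) * N1) + (s.K + s.C1) * N1) * s.Z u) * G := by
    have : G * G = ‖s.J g‖ ^ 2 + ‖s.J h‖ ^ 2 := by rw [← hG2]; ring
    rw [this, d1, d2]
    linarith
  rcases hG0.eq_or_lt with h0 | h0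
  · rw [← h0]; positivity
  · exact le_of_mul_le_mul_right key h0


lemma real_final (C2 C4 C5 δ N1 : ℝ) (h2 : 0 ≤ C2) (h4 : 0 ≤ C4) (h5 : 0 ≤ C5) (hδ : 0 < δ)
    (hN1 : 0 ≤ N1) : ∃ C : ℝ, 0 < C ∧ ∃ b₀ : ℝ, 0 < b₀ ∧ ∀ β N F U Z G : ℝ, 1 ≤ β → b₀ ≤ β →
      δ ≤ N → N ≤ N1 → 0 ≤ F → 0 ≤ U → 0 ≤ Z → 0 ≤ G →
      G ≤ (N + 1 / (2 * β)) * F + C4 * Z → β * Z ≤ C2 * (F + β * U) →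
      4 * β ^ 2 * U ^ 2 ≤ G ^ 2 + 2 * (F * U + C5 * Z ^ 2) → (2 * β - C) * U ≤ N * F := by
  set E := 1 / 2 + C4 * C2 with hE
  set L := 2 + 2 * C5 * C2 ^ 2 with hL
  set ρ := (N1 + 2) / δ with hρ
  set κ := E * ρ + L * ρ ^ 2 with hκ
  have hE0 : 0 < E := by positivity
  have hL0 : 0 < L := by positivity
  have hρ0 : 0 < ρ := by positivity
  have hκ0 : 0 < κ := by positivity
  refine ⟨2 * κ, by positivity, 4 * E + 16 * L, by positivity, ?_⟩
  intro β N F U Z G hβ hb hδN hNN hF hU hZ hG h1 h2' h3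
  have hβ0 : 0 < β := by linarith
  have hN0 : 0 < N := by linarith
  obtain ⟨y, hy⟩ : ∃ y, y = β * U := ⟨_, rfl⟩
  have hy0 : 0 ≤ y := by rw [hy]; positivity
  obtain ⟨R, hR⟩ : ∃ R, R = F + y := ⟨_, rfl⟩
  have hR0 : 0 ≤ R := by linarith
  obtain ⟨t, ht⟩ : ∃ t, t = 1 / β := ⟨_, rfl⟩
  have ht0 : 0 < t := by rw [ht]; positivity
  have ht1 : t ≤ 1 := by rw [ht, div_le_one hβ0]; exact hβ
  have htb : t * β = 1 := by rw [ht]; field_simp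
  have hEt : E * t ≤ 1 / 4 := by
    have : (4 * E) * t ≤ β * t := mul_le_mul_of_nonneg_right (by linarith) ht0.le
    linarith
  have hLt : L * t ≤ 1 / 16 := by
    have : (16 * L) * t ≤ β * t := mul_le_mul_of_nonneg_right (by linarith) ht0.le
    linarith
  have hZ' : Z ≤ C2 * R * t := by
    have : t * (β * Z) ≤ t * (C2 * (F + β * U)) := mul_le_mul_of_nonneg_left h2' ht0.le
    rw [← hy, ← hR, ← mul_assoc, htb] at this
    linarith
  have hG' : G ≤ N * F + E * t * R := by
    have e1 : (N + 1 / (2 * β)) * F = N * F + t / 2 * F := by rw [ht]; field_simp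
    have e2 : C4 * Z ≤ C4 * (C2 * R * t) := mul_le_mul_of_nonneg_left hZ' h4
    have e3 : t / 2 * F ≤ t / 2 * R := mul_le_mul_of_nonneg_left (by linarith) (by positivity)
    rw [e1] at h1
    rw [hE]; linarith
  have hU' : U = t * y := by rw [hy, ← mul_assoc, htb, one_mul]
  have hFU : F * U ≤ t * R ^ 2 := by
    rw [hU', hR]; nlinarith [mul_nonneg ht0.le (mul_nonneg hF hy0), mul_nonneg ht0.le (sq_nonneg F),
      mul_nonneg ht0.le (sq_nonneg y)]
  have hZ2 : Z ^ 2 ≤ C2 ^ 2 * R ^ 2 * t := by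
    have : Z ^ 2 ≤ (C2 * R * t) ^ 2 := pow_le_pow_left₀ hZ hZ' 2
    have h' : (C2 * R * t) ^ 2 = C2 ^ 2 * R ^ 2 * t * t := by ring
    have : C2 ^ 2 * R ^ 2 * t * t ≤ C2 ^ 2 * R ^ 2 * t * 1 :=
      mul_le_mul_of_nonneg_left ht1 (by positivity)
    linarith
  have hmain : 4 * y ^ 2 ≤ (N * F + E * t * R) ^ 2 + L * t * R ^ 2 := by
    have e1 : 4 * y ^ 2 = 4 * β ^ 2 * U ^ 2 := by rw [hy]; ring
    have e2 : G ^ 2 ≤ (N * F + E * t * R) ^ 2 := pow_le_pow_left₀ hG hG' 2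
    have e3 : C5 * Z ^ 2 ≤ C5 * (C2 ^ 2 * R ^ 2 * t) := mul_le_mul_of_nonneg_left hZ2 h5
    rw [e1, hL]; linarith
  have hNF : N * F ≤ N1 * F := mul_le_mul_of_nonneg_right hNN hF
  have hNF0 : 0 ≤ N * F := by positivity
  have hyF : y ≤ (N1 + 1) * F := by
    have e1 : 2 * y ≤ N1 * F + R / 2 := by
      refine le_of_sq_le_sq ?_ (by positivity)
      have e2 : (N * F + E * t * R) ^ 2 ≤ (N1 * F + 1 / 4 * R) ^ 2 := by gcongr
      have e3 : L * t * R ^ 2 ≤ 1 / 16 * R ^ 2 := by gcongr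
      have e4 : (N1 * F + R / 2) ^ 2 = (N1 * F + 1 / 4 * R) ^ 2 + 1 / 16 * R ^ 2
          + (1 / 2 * (N1 * F * R) + 1 / 8 * R ^ 2) := by ring
      have e5 : 0 ≤ 1 / 2 * (N1 * F * R) + 1 / 8 * R ^ 2 := by positivity
      have e6 : (2 * y) ^ 2 = 4 * y ^ 2 := by ring
      rw [e4, e6]
      linarith
    rw [hR] at e1
    have e7 : 0 ≤ N1 * F := mul_nonneg hN1 hF
    have e8 : (N1 + 1) * F = N1 * F + F := by ring
    rw [e8]
    linarith
  have hRX : R ≤ ρ * (N * F) := by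
    have : R ≤ (N1 + 2) * F := by rw [hR]; linarith
    refine this.trans ?_
    have e1 : (N1 + 2) * F = ρ * (δ * F) := by rw [hρ]; field_simp
    rw [e1]
    gcongr
  set X := N * F
  have h2y : 2 * y ≤ X * (1 + κ * t) := by
    refine le_of_sq_le_sq ?_ (by positivity)
    have e2 : (X + E * t * R) ^ 2 ≤ (X + E * t * (ρ * X)) ^ 2 := by gcongr
    have e3 : L * t * R ^ 2 ≤ L * t * (ρ * X) ^ 2 := by gcongr
    have e4 : (X * (1 + κ * t)) ^ 2 - ((X + E * t * (ρ * X)) ^ 2 + L * t * (ρ * X) ^ 2)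
        = X ^ 2 * (L * ρ ^ 2 * t + 2 * (E * ρ * t) * (L * ρ ^ 2 * t) + (L * ρ ^ 2 * t) ^ 2) := by
      rw [hκ]; ring
    have e5 : 0 ≤ X ^ 2 * (L * ρ ^ 2 * t + 2 * (E * ρ * t) * (L * ρ ^ 2 * t)
      + (L * ρ ^ 2 * t) ^ 2) := by positivity
    have e6 : (2 * y) ^ 2 = 4 * y ^ 2 := by ring
    rw [e6]
    linarith
  have e1 : (2 * β - 2 * κ) * U = 2 * y * (1 - κ * t) := by
    rw [hU']; linear_combination (2 * y) * htb
  rw [e1]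
  rcases le_or_gt (κ * t) 1 with h | h
  · have : 2 * y * (1 - κ * t) ≤ X * (1 + κ * t) * (1 - κ * t) :=
      mul_le_mul_of_nonneg_right h2y (by linarith)
    have e3 : X * (1 + κ * t) * (1 - κ * t) = X - X * (κ * t) ^ 2 := by ring
    have e4 : 0 ≤ X * (κ * t) ^ 2 := by positivity
    linarith
  · have : 0 ≤ y * (κ * t - 1) := mul_nonneg hy0 (by linarith)
    linarith

/-- abstract form of (i) -/
lemma partI (c1 δ N1 : ℝ) (hc1 : 0 ≤ c1) (hδ : 0 < δ) (hN1 : 0 ≤ N1) :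
    ∃ C : ℝ, 0 < C ∧ ∃ b₀ : ℝ, 0 < b₀ ∧ ∀ c N b : ℝ, 0 ≤ c → c ≤ c1 → δ ≤ N → N ≤ N1 → b₀ ≤ |b| →
      ∀ u φ ψ g h : S,
      g = -s.D u + s.A u - (c : ℂ) • u + (Complex.I * (b : ℂ)) • u →
      h = s.D u + s.A u - (c : ℂ) • u + (Complex.I * (b : ℂ)) • u →
      -s.D φ + s.A φ - (c : ℂ) • φ - (Complex.I * (b : ℂ)) • φ = g →
      s.D ψ + s.A ψ - (c : ℂ) • ψ - (Complex.I * (b : ℂ)) • ψ = h →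
      ‖s.J φ‖ ≤ N * ‖s.J g‖ → ‖s.J ψ‖ ≤ N * ‖s.J h‖ →
      (2 * |b| - C) * ‖s.J u‖ ≤ N * ‖s.J (s.T c b u)‖ := by
  have hC := s.C1_nonneg
  have hK := s.K_nonneg
  obtain ⟨C, hC0, b0, hb0, key⟩ := real_final (2 + 2 * c1 + 2 * s.C1)
    (2 * ((1 + (1 + c1 + s.C1) * N1) + (s.K + s.C1) * N1)) (1 + 4 * c1 + s.K + 2 * c1 ^ 2) δ N1
    (by positivity) (by positivity) (by positivity) hδ hN1
  refine ⟨C, hC0, b0 + 1 + s.C1 + c1 + s.K, by positivity, ?_⟩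
  intro c N b hc hcc hδN hNN hb u φ ψ g h hg hh hφ hψ hφN hψN
  have hN0 : 0 ≤ N := by linarith
  have hZ := s.Z_nonneg u
  have k1 := s.keyG c b N N1 hc (by linarith) hN0 hNN u φ ψ g h hg hh hφ hψ hφN hψN
  have k2 := s.energy2 c b hc (by linarith) (by linarith) (by linarith) u
  have k3 := s.g_inner c b u
  rw [← hg, ← hh] at k3
  have hF : 0 ≤ ‖s.J (s.T c b u)‖ := norm_nonneg _
  have hU : 0 ≤ ‖s.J u‖ := norm_nonneg _
  have hUZ : ‖s.J u‖ ≤ s.Z u := s.id_le u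
  have hAZ : ‖s.J (s.A u)‖ ≤ s.Z u := s.A_le u
  refine key |b| N ‖s.J (s.T c b u)‖ ‖s.J u‖ (s.Z u) (√(‖s.J g‖ ^ 2 + ‖s.J h‖ ^ 2))
    (by linarith) (by linarith) hδN hNN hF hU hZ (Real.sqrt_nonneg _) ?_ ?_ ?_
  · refine k1.trans ?_
    gcongr
  · refine k2.trans ?_
    have : (2 + 2 * c1 + 2 * s.C1) * (‖s.J (s.T c b u)‖ + |b| * ‖s.J u‖)
      = (2 + 2 * c1 + 2 * s.C1) * ‖s.J (s.T c b u)‖ + (2 + 2 * c1 + 2 * s.C1) * |b| * ‖s.J u‖ := by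
      ring
    rw [this]
    refine add_le_add (mul_le_mul_of_nonneg_right (by linarith) hF)
      (mul_le_mul_of_nonneg_right (mul_le_mul_of_nonneg_right (by linarith) (abs_nonneg _)) hU)
  · rw [Real.sq_sqrt (by positivity), sq_abs]
    refine k3.trans ?_
    have a1 := neg_re_le (s.J (s.T c b u)) (s.J u)
    have a2 : ‖s.J (s.A u)‖ ^ 2 ≤ s.Z u ^ 2 := pow_le_pow_left₀ (norm_nonneg _) hAZ 2
    have a3 : -(inner ℂ (s.J (s.A u)) (s.J u) : ℂ).re ≤ s.Z u * s.Z u :=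
      (neg_re_le _ _).trans (mul_le_mul hAZ hUZ hU hZ)
    have a4 : (inner ℂ (s.J (s.Q u)) (s.J u) : ℂ).re ≤ s.K * s.Z u * s.Z u :=
      (re_le _ _).trans (mul_le_mul (s.Q_le u) hUZ hU (by positivity))
    have a5 : ‖s.J u‖ ^ 2 ≤ s.Z u ^ 2 := pow_le_pow_left₀ hU hUZ 2
    have a6 : 4 * c * -(inner ℂ (s.J (s.A u)) (s.J u) : ℂ).re ≤ 4 * c1 * (s.Z u * s.Z u) :=
      (mul_le_mul_of_nonneg_left a3 (by positivity)).trans (by gcongr)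
    have a7 : 2 * c ^ 2 * ‖s.J u‖ ^ 2 ≤ 2 * c1 ^ 2 * s.Z u ^ 2 := by gcongr
    linarith

/-- abstract form of (ii) -/
lemma partII (c1 δ N1 : ℝ) (hc1 : 0 ≤ c1) (hδ : 0 < δ) (hN1 : 0 ≤ N1) :
    ∃ C : ℝ, 0 < C ∧ ∀ c M b : ℝ, 0 ≤ c → c ≤ c1 → δ ≤ M → M ≤ N1 →
      ∀ f0 f1 f2 v : S,
      f0 = -s.D f1 + s.A f1 - (c : ℂ) • f1 →
      s.D f2 + s.A f2 - (c : ℂ) • f2 = f1 →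
      -s.D v + s.A v - (c : ℂ) • v = f2 →
      M * ‖s.J f0‖ ≤ ‖s.J f1‖ →
      (δ ^ 2 * ‖s.J f1‖ ≤ ‖s.J v‖) ∧
      M * ‖s.J ((2 * Complex.I * b) • f2 + (-s.D (s.D v) + s.Q v - (2 * c : ℂ) • s.A v
        + (c ^ 2 : ℂ) • v))‖ ≤ (2 * |b| + C) * ‖s.J v‖ := by
  have hC := s.C1_nonneg
  have hK := s.K_nonneg
  set B := 1 + c1 + s.C1 with hB
  have hB0 : 0 < B := by positivity
  -- constants
  set Cv := 1 / δ + B with hCv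
  set C2 := 1 / δ ^ 2 + B * (1 / δ) with hC2
  have hCv0 : 0 < Cv := by positivity
  have hC20 : 0 < C2 := by positivity
  refine ⟨N1 * (1 / δ ^ 2 + s.C1 * Cv + (C2 + s.C1 * Cv + B * Cv + Cv) + s.K * Cv) + 1,
    by positivity, ?_⟩
  intro c M b hc hcc hδM hMN f0 f1 f2 v h0 h1 h2 hM
  have hM0 : 0 < M := by linarith
  have i1 : ‖s.J f1‖ ^ 2 ≤ ‖s.J f0‖ * ‖s.J f2‖ := by
    have := s.adj2 c 0 f1 f2
    simp only [Complex.ofReal_zero, mul_zero, zero_smul, add_zero, sub_zero] at this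
    rw [h1, ← h0] at this
    rw [← inner_self_re, ← this]
    exact re_le _ _
  have i2 : ‖s.J f2‖ ^ 2 ≤ ‖s.J f1‖ * ‖s.J v‖ := by
    have := s.adj1 c 0 f2 v
    simp only [Complex.ofReal_zero, mul_zero, zero_smul, add_zero, sub_zero] at this
    rw [h1, h2] at this
    rw [← inner_self_re, ← this]
    exact re_le _ _
  have n0 := norm_nonneg (s.J f0)
  have n1 := norm_nonneg (s.J f1)
  have n2 := norm_nonneg (s.J f2)
  have nv := norm_nonneg (s.J v)
  have j1 : M * ‖s.J f1‖ ≤ ‖s.J f2‖ := by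
    rcases n1.eq_or_lt with h | h
    · rw [← h]; simpa using n2
    · refine le_of_mul_le_mul_right ?_ h
      have := mul_le_mul_of_nonneg_left i1 hM0.le
      have := mul_le_mul_of_nonneg_right hM n2
      nlinarith
  have j2 : M * ‖s.J f2‖ ≤ ‖s.J v‖ := by
    rcases n2.eq_or_lt with h | h
    · rw [← h]; simpa using nv
    · refine le_of_mul_le_mul_right ?_ h
      have := mul_le_mul_of_nonneg_left i2 hM0.le
      have := mul_le_mul_of_nonneg_right j1 nv
      nlinarith
  have j3 : δ * ‖s.J f2‖ ≤ ‖s.J v‖ := (mul_le_mul_of_nonneg_right hδM n2).trans j2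
  have j4 : δ * ‖s.J f1‖ ≤ ‖s.J f2‖ := (mul_le_mul_of_nonneg_right hδM n1).trans j1
  have j5 : δ ^ 2 * ‖s.J f1‖ ≤ ‖s.J v‖ := by nlinarith
  have k2 : ‖s.J f2‖ ≤ 1 / δ * ‖s.J v‖ := by
    rw [one_div, inv_mul_eq_div, le_div_iff₀ hδ]; linarith
  have k1 : ‖s.J f1‖ ≤ 1 / δ ^ 2 * ‖s.J v‖ := by
    rw [one_div, inv_mul_eq_div, le_div_iff₀ (by positivity)]; linarith
  have hBc : 1 + c + s.C1 ≤ B := by rw [hB]; linarith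
  have zv : s.Z v ≤ Cv * ‖s.J v‖ := by
    have := s.energy1 c 0 hc (-1) (by simp) v f2 (by rw [← h2]; push_cast; module)
    have := mul_le_mul_of_nonneg_right hBc nv
    rw [hCv]; linarith
  have z2 : s.Z f2 ≤ C2 * ‖s.J v‖ := by
    have := s.energy1 c 0 hc 1 (by simp) f2 f1 (by rw [← h1]; push_cast; module)
    have := mul_le_mul_of_nonneg_right hBc n2
    have := mul_le_mul_of_nonneg_left k2 hB0.le
    rw [hC2]; linarith
  have a1 : ‖s.J (s.A1 v)‖ ≤ s.C1 * Cv * ‖s.J v‖ := by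
    refine (s.A1_le v).trans ?_
    rw [mul_assoc]; exact mul_le_mul_of_nonneg_left zv hC
  have zw : s.Z (v + s.A v) ≤ (C2 + s.C1 * Cv + B * Cv) * ‖s.J v‖ := by
    have := s.energy1 c 0 hc (-1) (by simp) (v + s.A v) ((f2 + s.A f2) - s.A1 v) (by
      rw [← h2]; simp only [map_add, map_sub, map_neg, map_smul, s.comm]; push_cast; module)
    have e1 : ‖s.J ((f2 + s.A f2) - s.A1 v)‖ ≤ s.Z f2 + ‖s.J (s.A1 v)‖ := by
      rw [map_sub]; exact norm_sub_le _ _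
    have e2 : (1 + c + s.C1) * ‖s.J (v + s.A v)‖ ≤ B * (Cv * ‖s.J v‖) :=
      mul_le_mul hBc zv (norm_nonneg _) hB0.le
    linarith
  have aa : ‖s.J (s.A (s.A v))‖ ≤ (C2 + s.C1 * Cv + B * Cv + Cv) * ‖s.J v‖ := by
    have e1 : s.A (s.A v) = s.A (v + s.A v) - s.A v := by rw [map_add]; abel
    rw [e1, map_sub]
    have := norm_sub_le (s.J (s.A (v + s.A v))) (s.J (s.A v))
    have : ‖s.J (s.A (v + s.A v))‖ ≤ s.Z (v + s.A v) := s.A_le (v + s.A v)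
    have : ‖s.J (s.A v)‖ ≤ s.Z v := s.A_le v
    linarith
  have qq : ‖s.J (s.Q v)‖ ≤ s.K * Cv * ‖s.J v‖ := by
    refine (s.Q_le v).trans ?_
    rw [mul_assoc]; exact mul_le_mul_of_nonneg_left zv hK
  refine ⟨j5, ?_⟩
  have e : (2 * Complex.I * b) • f2 + (-s.D (s.D v) + s.Q v - (2 * c : ℂ) • s.A v
        + (c ^ 2 : ℂ) • v)
      = (2 * Complex.I * b) • f2 + (f1 - s.A1 v - s.A (s.A v) + s.Q v) := by
    rw [← h1, ← h2]; simp only [map_add, map_sub, map_neg, map_smul, s.comm]; module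
  rw [e]
  have t1 : ‖s.J ((2 * Complex.I * b) • f2 + (f1 - s.A1 v - s.A (s.A v) + s.Q v))‖
      ≤ 2 * |b| * ‖s.J f2‖ + (‖s.J f1‖ + ‖s.J (s.A1 v)‖ + ‖s.J (s.A (s.A v))‖ + ‖s.J (s.Q v)‖) := by
    simp only [map_add, map_sub, map_smul]
    refine (norm_add_le _ _).trans (add_le_add ?_ ?_)
    · rw [norm_smul]; simp
    · refine (norm_add_le _ _).trans (add_le_add ((norm_sub_le _ _).trans
        (add_le_add (norm_sub_le _ _) le_rfl)) le_rfl)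
  have t2 : ‖s.J f1‖ + ‖s.J (s.A1 v)‖ + ‖s.J (s.A (s.A v))‖ + ‖s.J (s.Q v)‖
      ≤ (1 / δ ^ 2 + s.C1 * Cv + (C2 + s.C1 * Cv + B * Cv + Cv) + s.K * Cv) * ‖s.J v‖ := by
    linarith
  set Y := 1 / δ ^ 2 + s.C1 * Cv + (C2 + s.C1 * Cv + B * Cv + Cv) + s.K * Cv with hY
  have hY0 : 0 < Y := by positivity
  calc _ ≤ M * (2 * |b| * ‖s.J f2‖ + Y * ‖s.J v‖) :=
        mul_le_mul_of_nonneg_left (t1.trans (by linarith)) hM0.le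
    _ = 2 * |b| * (M * ‖s.J f2‖) + M * (Y * ‖s.J v‖) := by ring
    _ ≤ 2 * |b| * ‖s.J v‖ + N1 * (Y * ‖s.J v‖) := by gcongr
    _ ≤ _ := by linarith

end Sys

lemma growth_pos (f : ℝ → ℝ) (k : ℕ) (hd : Differentiable ℝ f)
    (hb : ∀ x, |deriv f x| ≤ k * (1 + f x) * (√(1 + x ^ 2))⁻¹) (x : ℝ)
    (hx : 0 ≤ x) (h0 : 0 ≤ f 0) : 1 + f x ≤ (1 + f 0) * (1 + 2 * |x|) ^ k := by
  have hder : ∀ y, HasDerivAt (fun y => (1 + f y) * Real.exp (-(k * Real.arsinh y)))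
      ((deriv f y - k * (1 + f y) * (√(1 + y ^ 2))⁻¹) * Real.exp (-(k * Real.arsinh y))) y := by
    intro y
    have h1 : HasDerivAt (fun y => 1 + f y) (deriv f y) y := by
      simpa using (hd y).hasDerivAt.const_add 1
    have h2 := (((Real.hasDerivAt_arsinh y).const_mul (k:ℝ)).neg).exp
    exact (h1.mul h2).congr_deriv (by simp only [Pi.neg_apply]; ring)
  have hanti : Antitone (fun y => (1 + f y) * Real.exp (-(k * Real.arsinh y))) := by
    apply antitone_of_deriv_nonpos
    · exact fun y => (hder y).differentiableAt
    · intro y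
      rw [(hder y).deriv]
      apply mul_nonpos_of_nonpos_of_nonneg _ (Real.exp_pos _).le
      have := (le_abs_self _).trans (hb y)
      linarith
  have h := hanti hx
  simp only [Real.arsinh_zero, mul_zero, neg_zero, Real.exp_zero, mul_one] at h
  rw [Real.exp_neg, ← div_eq_mul_inv, div_le_iff₀ (Real.exp_pos _), Real.exp_nat_mul,
    Real.exp_arsinh] at h
  refine h.trans ?_
  have hs : √(1 + x ^ 2) ≤ 1 + |x| := by
    apply Real.sqrt_le_iff.mpr
    constructor
    · positivity
    · nlinarith [abs_nonneg x, sq_abs x]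
  have : x + √(1 + x ^ 2) ≤ 1 + 2 * |x| := by linarith [le_abs_self x]
  gcongr

lemma growth (f : ℝ → ℝ) (k : ℕ) (hd : Differentiable ℝ f)
    (hb : ∀ x, |deriv f x| ≤ k * (1 + f x) * (√(1 + x ^ 2))⁻¹) (x : ℝ)
    (h0 : 0 ≤ f 0) : 1 + f x ≤ (1 + f 0) * (1 + 2 * |x|) ^ k := by
  rcases le_total 0 x with hx | hx
  · exact growth_pos f k hd hb x hx h0
  · have := growth_pos (fun y => f (-y)) k (hd.comp differentiable_neg)
      (by
        intro y
        have h1 : deriv (fun y => f (-y)) y = - deriv f (-y) := deriv_comp_neg f y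
        rw [h1, abs_neg]
        simpa using hb (-y)) (-x) (by linarith) (by simpa using h0)
    simpa using this

lemma temperate_of (f : ℝ → ℝ) (hs : ContDiff ℝ (⊤ : ℕ∞) f) (h0 : ∀ x, 0 ≤ f x)
    (hb : ∀ n : ℕ, 1 ≤ n → ∃ C : ℝ, 0 < C ∧ ∀ x : ℝ,
      |iteratedDeriv n f x| ≤ C * (1 + f x) * (1 + x ^ 2) ^ (-(n : ℝ) / 2)) :
    f.HasTemperateGrowth := by
  have hd : Differentiable ℝ f := hs.differentiable (by simp)
  obtain ⟨C, hC, hCb⟩ := hb 1 le_rfl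
  obtain ⟨k, hk⟩ := exists_nat_ge C
  have hg := growth f k hd (by
    intro x
    have := hCb x
    rw [iteratedDeriv_one] at this
    refine this.trans ?_
    have e : (1 + x ^ 2) ^ (-((1:ℕ) : ℝ) / 2) = (√(1 + x ^ 2))⁻¹ := by
      rw [Real.sqrt_eq_rpow, ← Real.rpow_neg (by positivity)]
      norm_num
    rw [e]
    have := h0 x
    gcongr)
  have key : ∀ x, 1 + f x ≤ (1 + f 0) * 2 ^ k * (1 + ‖x‖) ^ k := by
    intro x
    refine (hg x (h0 0)).trans ?_
    rw [mul_assoc, ← mul_pow, Real.norm_eq_abs]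
    have := h0 0
    gcongr
    linarith [abs_nonneg x]
  refine ⟨hs, fun n => ?_⟩
  rcases Nat.eq_zero_or_pos n with rfl | hn
  · refine ⟨k, (1 + f 0) * 2 ^ k, fun x => ?_⟩
    rw [norm_iteratedFDeriv_zero, Real.norm_eq_abs, abs_of_nonneg (h0 x)]
    linarith [key x]
  · obtain ⟨D, hD, hDb⟩ := hb n hn
    refine ⟨k, D * ((1 + f 0) * 2 ^ k), fun x => ?_⟩
    rw [norm_iteratedFDeriv_eq_norm_iteratedDeriv, Real.norm_eq_abs]
    refine (hDb x).trans ?_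
    have h1 : (1 + x ^ 2) ^ (-(n : ℝ) / 2) ≤ 1 := by
      apply Real.rpow_le_one_of_one_le_of_nonpos
      · nlinarith [sq_nonneg x]
      · have : (0:ℝ) ≤ n := by positivity
        linarith
    have h2 := h0 x
    calc D * (1 + f x) * (1 + x ^ 2) ^ (-(n : ℝ) / 2) ≤ D * (1 + f x) * 1 := by gcongr
      _ ≤ D * ((1 + f 0) * 2 ^ k * (1 + ‖x‖) ^ k) * 1 := by gcongr; exact key x
      _ = _ := by ring

lemma temperate_deriv (f : ℝ → ℝ) (hf : f.HasTemperateGrowth) :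
    (deriv f).HasTemperateGrowth := by
  refine ⟨?_, fun n => ?_⟩
  · have := hf.1
    have h2 : ContDiff ℝ ((⊤:ℕ∞) + 1) f := by simpa using this
    exact (contDiff_succ_iff_deriv.mp h2).2.2
  · obtain ⟨k, C, h⟩ := hf.2 (n+1)
    refine ⟨k, C, fun x => ?_⟩
    have := h x
    rwa [norm_iteratedFDeriv_eq_norm_iteratedDeriv, iteratedDeriv_succ',
      ← norm_iteratedFDeriv_eq_norm_iteratedDeriv] at this

lemma deriv_expI (z : ℂ) : (deriv fun x : ℝ => Complex.exp (z * x)) =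
    fun x : ℝ => z * Complex.exp (z * x) := by
  funext x
  have h : HasDerivAt (fun x : ℝ => z * (x:ℂ)) (z * 1) x :=
    (Complex.ofRealCLM.hasDerivAt (x := x)).const_mul z
  rw [(h.cexp).deriv]; ring

lemma iteratedDeriv_expI (z : ℂ) (n : ℕ) : (iteratedDeriv n fun x : ℝ => Complex.exp (z * x)) =
    fun x : ℝ => z ^ n * Complex.exp (z * x) := by
  induction n with
  | zero => simp
  | succ n ih =>
    rw [iteratedDeriv_succ, ih]
    funext x
    rw [deriv_const_mul_field, deriv_expI]; ring

lemma norm_expI (b x : ℝ) : ‖Complex.exp (Complex.I * b * x)‖ = 1 := by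
  rw [Complex.norm_exp]; simp

lemma temperate_expI (b : ℝ) :
    (fun x : ℝ => Complex.exp (Complex.I * b * x)).HasTemperateGrowth := by
  refine ⟨?_, fun n => ⟨0, ‖(Complex.I * b : ℂ)‖ ^ n, fun x => ?_⟩⟩
  · exact (contDiff_const.mul Complex.ofRealCLM.contDiff).cexp
  · rw [norm_iteratedFDeriv_eq_norm_iteratedDeriv, iteratedDeriv_expI, norm_mul, norm_expI, norm_pow]
    simp

lemma phi_lower (a : ℝ → ℝ) (ha0 : ∀ x, 0 ≤ a x) (hinf : Tendsto a (cocompact ℝ) atTop)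
    (c1 : ℝ) (hc1 : 0 ≤ c1) : ∃ C0 : ℝ, 0 ≤ C0 ∧ ∃ m m' : ℝ → ℝ, (∀ x, HasDerivAt m (m' x) x) ∧
      Continuous m' ∧ (∀ x, |m x| ≤ C0) ∧ (∀ x, |m' x| ≤ C0) ∧
      ∀ x, c1 + 1 ≤ a x + m' x := by
  have h1 := hinf.eventually_ge_atTop (c1 + 1)
  rw [← Metric.cobounded_eq_cocompact] at h1
  obtain ⟨X, -, hX⟩ := (hasBasis_cobounded_norm (E := ℝ)).eventually_iff.mp h1
  set Y := max X 1 with hY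
  have hYpos : 0 < Y := lt_of_lt_of_le one_pos (le_max_right _ _)
  set L := 2 * (c1 + 1) with hL
  have hLpos : 0 < L := by positivity
  refine ⟨max L (L * Y * (Real.pi / 2)), le_max_of_le_left hLpos.le,
    fun x => L * Y * Real.arctan (x / Y),
    fun x => L * (1 + (x / Y) ^ 2)⁻¹, ?_, ?_, ?_, ?_, ?_⟩
  · intro x
    have h2 : HasDerivAt (fun x : ℝ => x / Y) (1 / Y) x := (hasDerivAt_id x).div_const Y
    exact ((h2.arctan).const_mul (L * Y)).congr_deriv (by field_simp)
  · refine continuous_const.mul (Continuous.inv₀ (by fun_prop) ?_)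
    intro x; positivity
  · intro x
    refine le_trans ?_ (le_max_right _ _)
    rw [abs_mul, abs_of_pos (by positivity : 0 < L * Y)]
    gcongr
    exact abs_le.mpr ⟨(Real.neg_pi_div_two_lt_arctan _).le, (Real.arctan_lt_pi_div_two _).le⟩
  · intro x
    refine le_trans ?_ (le_max_left _ _)
    rw [abs_of_pos (by positivity)]
    have : (1 + (x / Y) ^ 2)⁻¹ ≤ 1 := inv_le_one_of_one_le₀ (by nlinarith [sq_nonneg (x/Y)])
    nlinarith
  · intro x
    by_cases hx : X ≤ |x|
    · have := hX (show x ∈ {x | X ≤ ‖x‖} from hx)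
      have : 0 < L * (1 + (x / Y) ^ 2)⁻¹ := by positivity
      have := hX (show x ∈ {x | X ≤ ‖x‖} from hx)
      linarith
    · push Not at hx
      have h3 : (x / Y) ^ 2 ≤ 1 := by
        rw [sq_le_one_iff_abs_le_one, abs_div, abs_of_pos hYpos, div_le_one hYpos]
        exact hx.le.trans (le_max_left _ _)
      have h4 : (2:ℝ)⁻¹ ≤ (1 + (x / Y) ^ 2)⁻¹ := by
        apply inv_anti₀ (by positivity) (by linarith)
      have := ha0 x
      nlinarith

lemma pow_exp_bound (k : ℕ) (s : ℝ) (hs : 0 ≤ s) :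
    (1 + s) ^ k * Real.exp (-s) ≤ 2 ^ k * k.factorial * Real.exp (1/2) * Real.exp (-s/2) := by
  have h := Real.pow_div_factorial_le_exp ((1 + s)/2) (by positivity) k
  rw [div_le_iff₀ (by positivity), div_pow, div_le_iff₀ (by positivity)] at h
  calc (1 + s) ^ k * Real.exp (-s) ≤ (Real.exp ((1+s)/2) * k.factorial * 2 ^ k) * Real.exp (-s) := by
        gcongr
    _ = 2 ^ k * k.factorial * (Real.exp ((1+s)/2) * Real.exp (-s)) := by ring
    _ = 2 ^ k * k.factorial * (Real.exp (1/2) * Real.exp (-s/2)) := by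
        rw [← Real.exp_add, ← Real.exp_add]; ring_nf
    _ = _ := by ring

/-- bootstrapping to Schwartz -/
lemma schwartz_of_ode (p : ℝ → ℂ) (hp : p.HasTemperateGrowth) (g : SchwartzMap ℝ ℂ) (φ : ℝ → ℂ)
    (hφ : ∀ x, HasDerivAt φ (p x * φ x - g x) x)
    (hdec : ∀ k : ℕ, ∃ C : ℝ, ∀ x, (1 + ‖x‖) ^ k * ‖φ x‖ ≤ C) :
    ∃ f : SchwartzMap ℝ ℂ, ⇑f = φ := by
  have hder : deriv φ = fun x => p x * φ x - g x := funext fun x => (hφ x).deriv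
  have hdiff : Differentiable ℝ φ := fun x => (hφ x).differentiableAt
  have hsm : ∀ n : ℕ, ContDiff ℝ n φ := by
    intro n
    induction n with
    | zero => exact contDiff_zero.mpr hdiff.continuous
    | succ n ih =>
      have : ((n + 1 : ℕ) : WithTop ℕ∞) = (n : WithTop ℕ∞) + 1 := by norm_cast
      rw [this, contDiff_succ_iff_deriv]
      refine ⟨hdiff, by simp, ?_⟩
      rw [hder]
      have h1 : ContDiff ℝ n p := hp.1.of_le (by exact_mod_cast le_top)
      have h2 : ContDiff ℝ n g := (g.smooth n)
      exact (h1.mul ih).sub h2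
  have hsm' : ContDiff ℝ (⊤ : ℕ∞) φ := contDiff_infty.mpr hsm
  have key : ∀ n : ℕ, ∀ k : ℕ, ∃ C : ℝ, ∀ j ≤ n, ∀ x, (1 + ‖x‖) ^ k * ‖iteratedFDeriv ℝ j φ x‖ ≤ C := by
    intro n
    induction n with
    | zero =>
      intro k
      obtain ⟨C, hC⟩ := hdec k
      refine ⟨C, fun j hj x => ?_⟩
      obtain rfl : j = 0 := by omega
      rw [norm_iteratedFDeriv_zero]; exact hC x
    | succ n ih =>
      intro k
      obtain ⟨l, Cp, hCp, hp'⟩ := hp.norm_iteratedFDeriv_le_uniform n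
      obtain ⟨C, hC⟩ := ih (k + l)
      obtain ⟨C', hC'⟩ := ih k
      have hCnn : 0 ≤ C := le_trans (by positivity) (hC 0 (by omega) 0)
      set G := 2 ^ k * (Finset.Iic (k, n)).sup (fun m => SchwartzMap.seminorm ℝ m.1 m.2) g with hG
      set B := (∑ i ∈ Finset.range (n + 1), (n.choose i : ℝ) * Cp * C) + G with hB
      refine ⟨max C' B, fun j hj x => ?_⟩
      rcases Nat.lt_or_ge j (n+1) with hlt | hge
      · exact (hC' j (by omega) x).trans (le_max_left _ _)
      obtain rfl : j = n + 1 := by omega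
      refine le_trans ?_ (le_max_right _ _)
      have e : ‖iteratedFDeriv ℝ (n+1) φ x‖ = ‖iteratedFDeriv ℝ n (fun x => p x * φ x - g x) x‖ := by
        rw [norm_iteratedFDeriv_eq_norm_iteratedDeriv, iteratedDeriv_succ', hder,
          ← norm_iteratedFDeriv_eq_norm_iteratedDeriv]
      have h1 : ContDiff ℝ n p := hp.1.of_le (by exact_mod_cast le_top)
      have h2 : ContDiff ℝ n g := (g.smooth n)
      have e2 : iteratedFDeriv ℝ n (fun x => p x * φ x - g x) x =
          iteratedFDeriv ℝ n (fun x => p x * φ x) x - iteratedFDeriv ℝ n g x := by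
        have := iteratedFDeriv_sub_apply (𝕜 := ℝ) (i := n) (x := x) ((h1.mul (hsm n)).contDiffAt) h2.contDiffAt
        exact this
      rw [e, e2]
      have hg : (1 + ‖x‖) ^ k * ‖iteratedFDeriv ℝ n g x‖ ≤ G :=
        SchwartzMap.one_add_le_sup_seminorm_apply (𝕜 := ℝ) (m := (k, n)) le_rfl le_rfl g x
      have hm : (1 + ‖x‖) ^ k * ‖iteratedFDeriv ℝ n (fun x => p x * φ x) x‖ ≤
          ∑ i ∈ Finset.range (n + 1), (n.choose i : ℝ) * Cp * C := by
        calc (1 + ‖x‖) ^ k * ‖iteratedFDeriv ℝ n (fun x => p x * φ x) x‖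
            ≤ (1 + ‖x‖) ^ k * ∑ i ∈ Finset.range (n + 1),
              (n.choose i : ℝ) * ‖iteratedFDeriv ℝ i p x‖ * ‖iteratedFDeriv ℝ (n - i) φ x‖ := by
              gcongr
              exact norm_iteratedFDeriv_mul_le h1 (hsm n) x le_rfl
          _ = ∑ i ∈ Finset.range (n + 1), (1 + ‖x‖) ^ k *
              ((n.choose i : ℝ) * ‖iteratedFDeriv ℝ i p x‖ * ‖iteratedFDeriv ℝ (n - i) φ x‖) := by
              rw [Finset.mul_sum]
          _ ≤ _ := by
              apply Finset.sum_le_sum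
              intro i hi
              have hi' : i ≤ n := by simpa [Nat.lt_succ_iff] using hi
              calc
                (1 + ‖x‖) ^ k *
                  ((n.choose i : ℝ) * ‖iteratedFDeriv ℝ i p x‖ * ‖iteratedFDeriv ℝ (n - i) φ x‖)
                  ≤ (1 + ‖x‖) ^ k *
                ((n.choose i : ℝ) * (Cp * (1 + ‖x‖) ^ l) * ‖iteratedFDeriv ℝ (n - i) φ x‖) := by
                  gcongr
                  exact hp' i hi' x
                _ = (n.choose i : ℝ) * Cp * ((1 + ‖x‖) ^ (k + l) * ‖iteratedFDeriv ℝ (n - i) φ x‖) := by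
                  rw [pow_add]; ring
                _ ≤ _ := by
                  gcongr
                  exact hC _ (by omega) x
      calc _ ≤ (1 + ‖x‖) ^ k * (‖iteratedFDeriv ℝ n (fun x => p x * φ x) x‖ + ‖iteratedFDeriv ℝ n g x‖) := by
            gcongr
            exact norm_sub_le _ _
        _ ≤ B := by rw [mul_add]; linarith
  refine ⟨⟨φ, hsm', fun k n => ?_⟩, rfl⟩
  obtain ⟨C, hC⟩ := key n k
  refine ⟨C, fun x => le_trans ?_ (hC n le_rfl x)⟩
  gcongr
  linarith

lemma exists_sol_aux (a : ℝ → ℝ) (ha : a.HasTemperateGrowth) (ha0 : ∀ x, 0 ≤ a x)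
    (hinf : Tendsto a (cocompact ℝ) atTop) (c : ℝ) (hc : 0 ≤ c) (g : SchwartzMap ℝ ℂ) :
    ∃ φ : SchwartzMap ℝ ℂ, ∀ x, deriv φ x = ((a x : ℂ) - c) * φ x - g x := by
  obtain ⟨C0, hC0, m, m', hm, -, hmb, -, hmL⟩ := phi_lower a ha0 hinf c hc
  have hac : Continuous a := ha.1.continuous
  set Φ : ℝ → ℝ := fun x => ∫ t in (0:ℝ)..x, (a t - c) with hΦdef
  have hΦ : ∀ x, HasDerivAt Φ (a x - c) x := fun x =>
    intervalIntegral.integral_hasDerivAt_right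
      ((hac.sub continuous_const).intervalIntegrable _ _)
      ((hac.sub continuous_const).stronglyMeasurableAtFilter _ _)
      (hac.sub continuous_const).continuousAt
  have hΦc : Continuous Φ := continuous_iff_continuousAt.mpr fun x => (hΦ x).continuousAt
  have hmono : Monotone (fun x => Φ x + m x - x) := by
    have hd : ∀ x, HasDerivAt (fun x => Φ x + m x - x) (a x - c + m' x - 1) x := fun x =>
      ((hΦ x).add (hm x)).sub (hasDerivAt_id x)
    apply monotone_of_deriv_nonneg (fun x => (hd x).differentiableAt)
    intro x
    rw [(hd x).deriv]
    linarith [hmL x]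
  have hlow : ∀ x t, x ≤ t → Φ x - Φ t ≤ 2 * C0 - (t - x) := by
    intro x t hxt
    have h1 := hmono hxt
    simp only at h1
    have h2 := abs_le.mp (hmb x)
    have h3 := abs_le.mp (hmb t)
    linarith
  set h : ℝ → ℂ := fun t => ((Real.exp (-Φ t) : ℝ) : ℂ) * g t with hh
  have hhc : Continuous h := by
    have := g.continuous
    fun_prop
  have hnorm : ∀ t, ‖h t‖ = Real.exp (-Φ t) * ‖g t‖ := fun t => by
    rw [hh]; simp only [norm_mul, Complex.norm_real, Real.norm_eq_abs, Real.abs_exp]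
  have hdom : ∀ k : ℕ, ∃ C : ℝ, 0 ≤ C ∧ ∀ x t, x ≤ t →
      (1 + ‖x‖) ^ k * Real.exp (Φ x) * ‖h t‖ ≤ C * Real.exp (x/2) * Real.exp (-(1/2) * t) := by
    intro k
    set G := 2 ^ k * (Finset.Iic (k, 0)).sup (fun m => SchwartzMap.seminorm ℝ m.1 m.2) g with hG
    have hg : ∀ x, (1 + ‖x‖) ^ k * ‖g x‖ ≤ G := fun x => by
      have := SchwartzMap.one_add_le_sup_seminorm_apply (𝕜 := ℝ) (m := (k, 0)) le_rfl le_rfl g x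
      rwa [norm_iteratedFDeriv_zero] at this
    have hGnn : 0 ≤ G := le_trans (by positivity) (hg 0)
    refine ⟨Real.exp (2 * C0) * (2 ^ k * k.factorial * Real.exp (1/2)) * G, by positivity, ?_⟩
    intro x t hxt
    rw [hnorm]
    have h1 : 1 + ‖x‖ ≤ (1 + ‖t‖) * (1 + (t - x)) := by
      have : ‖x‖ ≤ ‖t‖ + (t - x) := by
        rw [Real.norm_eq_abs, Real.norm_eq_abs]
        have := abs_sub_abs_le_abs_sub x t
        rw [abs_sub_comm, abs_of_nonneg (by linarith : 0 ≤ t - x)] at this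
        linarith
      nlinarith [norm_nonneg t]
    have h2 : Real.exp (Φ x) * Real.exp (-Φ t) ≤ Real.exp (2 * C0) * Real.exp (-(t-x)) := by
      rw [← Real.exp_add, ← Real.exp_add]
      apply Real.exp_le_exp.mpr
      linarith [hlow x t hxt]
    have hs : 0 ≤ t - x := by linarith
    calc (1 + ‖x‖) ^ k * Real.exp (Φ x) * (Real.exp (-Φ t) * ‖g t‖)
        = (1 + ‖x‖) ^ k * (Real.exp (Φ x) * Real.exp (-Φ t)) * ‖g t‖ := by ring
      _ ≤ ((1 + ‖t‖) * (1 + (t - x))) ^ k * (Real.exp (2 * C0) * Real.exp (-(t-x))) * ‖g t‖ := by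
          gcongr
      _ = Real.exp (2 * C0) * ((1 + (t - x)) ^ k * Real.exp (-(t-x))) * ((1 + ‖t‖) ^ k * ‖g t‖) := by
          rw [mul_pow]; ring
      _ ≤ Real.exp (2 * C0) * (2 ^ k * k.factorial * Real.exp (1/2) * Real.exp (-(t-x)/2)) * G := by
          have hq := pow_exp_bound k _ hs
          have hq2 := hg t
          exact mul_le_mul (mul_le_mul_of_nonneg_left hq (Real.exp_pos _).le) hq2 (by positivity)
            (by positivity)
      _ = Real.exp (2 * C0) * (2 ^ k * k.factorial * Real.exp (1/2)) * G * Real.exp (-(t-x)/2) := by ring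
      _ = _ := by
          rw [mul_assoc _ (Real.exp (x/2)), ← Real.exp_add]; ring_nf
  have hint : ∀ x, IntegrableOn h (Set.Ioi x) := by
    intro x
    obtain ⟨C, hC, hCb⟩ := hdom 0
    have hi := (integrableOn_exp_mul_Ioi (a := -(1/2)) (by norm_num) x).const_mul
      (C * Real.exp (x/2) * Real.exp (-Φ x))
    refine Integrable.mono' hi hhc.aestronglyMeasurable ?_
    refine (ae_restrict_iff' measurableSet_Ioi).mpr (Eventually.of_forall fun t ht => ?_)
    have := hCb x t (le_of_lt ht)
    rw [pow_zero, one_mul] at this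
    have e : ‖h t‖ = Real.exp (-Φ x) * (Real.exp (Φ x) * ‖h t‖) := by
      rw [← mul_assoc, ← Real.exp_add]; simp
    rw [e]
    calc _ ≤ Real.exp (-Φ x) * (C * Real.exp (x/2) * Real.exp (-(1/2) * t)) := by gcongr
      _ = _ := by ring
  set I : ℝ → ℂ := fun x => ∫ t in Set.Ioi x, h t with hI
  have hIder : ∀ x, HasDerivAt I (-h x) x := by
    intro x
    have e : I = fun y => I 0 - ∫ t in (0:ℝ)..y, h t := by
      funext y
      have := intervalIntegral.integral_interval_add_Ioi (hint 0) (hint y)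
      simp only [hI]
      rw [← this]; ring
    rw [e]
    exact ((intervalIntegral.integral_hasDerivAt_right
      (hhc.intervalIntegrable _ _) (hhc.stronglyMeasurableAtFilter _ _) hhc.continuousAt).const_sub _)
  set φ : ℝ → ℂ := fun x => ((Real.exp (Φ x) : ℝ) : ℂ) * I x with hφ
  have hφder : ∀ x, HasDerivAt φ ((((a x - c : ℝ)) : ℂ) * φ x - g x) x := by
    intro x
    have h1 : HasDerivAt (fun x => ((Real.exp (Φ x) : ℝ) : ℂ)) ((Real.exp (Φ x) * (a x - c) : ℝ) : ℂ) x :=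
      ((hΦ x).exp).ofReal_comp
    refine (h1.mul (hIder x)).congr_deriv ?_
    have e : ((Real.exp (Φ x) : ℝ) : ℂ) * ((Real.exp (-Φ x) : ℝ) : ℂ) = 1 := by
      rw [← Complex.ofReal_mul, ← Real.exp_add]; simp
    simp only [hφ, hh]
    rw [Complex.ofReal_mul]
    linear_combination (-g x) * e
  have hdec : ∀ k : ℕ, ∃ C : ℝ, ∀ x, (1 + ‖x‖) ^ k * ‖φ x‖ ≤ C := by
    intro k
    obtain ⟨C, hC, hCb⟩ := hdom k
    refine ⟨C * 2, fun x => ?_⟩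
    have hi := (integrableOn_exp_mul_Ioi (a := -(1/2)) (by norm_num) x).const_mul
      (C * Real.exp (x/2))
    have h1 : ‖((((1 + ‖x‖) ^ k * Real.exp (Φ x) : ℝ)) : ℂ) * I x‖ ≤
        ∫ t in Set.Ioi x, C * Real.exp (x/2) * Real.exp (-(1/2) * t) := by
      simp only [hI]
      rw [← integral_const_mul]
      refine norm_integral_le_of_norm_le hi ?_
      refine (ae_restrict_iff' measurableSet_Ioi).mpr (Eventually.of_forall fun t ht => ?_)
      rw [norm_mul, Complex.norm_real, Real.norm_eq_abs, abs_of_nonneg (by positivity)]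
      exact hCb x t (le_of_lt ht)
    rw [integral_const_mul, integral_exp_mul_Ioi (by norm_num)] at h1
    have e : C * Real.exp (x / 2) * (-Real.exp (-(1 / 2) * x) / -(1 / 2)) = C * 2 := by
      have : Real.exp (x/2) * Real.exp (-(1 / 2) * x) = 1 := by
        rw [← Real.exp_add]; ring_nf; simp
      linear_combination (2 * C) * this
    rw [e, norm_mul, Complex.norm_real, Real.norm_eq_abs, abs_of_nonneg (by positivity)] at h1
    refine le_trans (le_of_eq ?_) h1
    simp only [hφ]
    rw [norm_mul, Complex.norm_real, Real.norm_eq_abs (Real.exp _), Real.abs_exp, mul_assoc]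
  have htemp : (fun x => (((a x - c : ℝ)) : ℂ)).HasTemperateGrowth :=
    Function.HasTemperateGrowth.comp Function.Complex.hasTemperateGrowth_ofReal (ha.sub (Function.HasTemperateGrowth.const c))
  obtain ⟨f, hf⟩ := schwartz_of_ode _ htemp g φ hφder hdec
  refine ⟨f, fun x => ?_⟩
  rw [hf, (hφder x).deriv]
  push_cast
  ring

lemma exists_sol_minus (a : ℝ → ℝ) (ha : a.HasTemperateGrowth) (ha0 : ∀ x, 0 ≤ a x)
    (hinf : Tendsto a (cocompact ℝ) atTop) (c : ℝ) (hc : 0 ≤ c) (g : SchwartzMap ℝ ℂ) :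
    ∃ φ : SchwartzMap ℝ ℂ, ∀ x, -deriv φ x + a x * φ x - c * φ x = g x := by
  obtain ⟨φ, h⟩ := exists_sol_aux a ha ha0 hinf c hc g
  exact ⟨φ, fun x => by rw [h x]; ring⟩

lemma exists_sol_plus (a : ℝ → ℝ) (ha : a.HasTemperateGrowth) (ha0 : ∀ x, 0 ≤ a x)
    (hinf : Tendsto a (cocompact ℝ) atTop) (c : ℝ) (hc : 0 ≤ c) (g : SchwartzMap ℝ ℂ) :
    ∃ φ : SchwartzMap ℝ ℂ, ∀ x, deriv φ x + a x * φ x - c * φ x = g x := by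
  have hneg : (fun x : ℝ => -x).HasTemperateGrowth := Function.HasTemperateGrowth.id'.neg
  set R := SchwartzMap.compCLMOfContinuousLinearEquiv ℂ (F := ℂ) (ContinuousLinearEquiv.neg ℝ (M := ℝ))
  obtain ⟨φ, h⟩ := exists_sol_aux (fun x => a (-x)) (ha.comp hneg) (fun x => ha0 _)
    (hinf.comp (Homeomorph.neg ℝ).isClosedEmbedding.tendsto_cocompact) c hc (R g)
  refine ⟨R φ, fun x => ?_⟩
  have e : ⇑(R φ) = fun x => φ (-x) := rfl
  have e2 : (R g) (-x) = g x := by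
    change g (- -x) = g x
    rw [neg_neg]
  have h3 := h (-x)
  rw [e2, neg_neg] at h3
  rw [e, deriv_comp_neg, h3]
  ring

lemma sq_norm_toLp (f : SchwartzMap ℝ ℂ) : ‖f.toLp 2‖ ^ 2 = ∫ x, ‖f x‖ ^ 2 := by
  have h := SchwartzMap.inner_toL2_toL2_eq f f volume
  have h2 : ∀ x, inner ℂ (f x) (f x) = ((‖f x‖ ^ 2 : ℝ) : ℂ) := fun x => by
    rw [inner_self_eq_norm_sq_to_K]; norm_cast
  simp_rw [h2] at h
  rw [inner_self_eq_norm_sq_to_K, integral_complex_ofReal] at h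
  apply Complex.ofReal_injective
  rw [← h]; simp

lemma integrable_sq (f : SchwartzMap ℝ ℂ) : Integrable (fun x => ‖f x‖ ^ 2) := by
  have := (f.memLp 2).integrable_norm_pow (by norm_num)
  simpa using this

lemma norm_toLp_le_of (f g : SchwartzMap ℝ ℂ) (K : ℝ) (h : ∀ x, ‖f x‖ ≤ K * ‖g x‖) :
    ‖f.toLp 2‖ ≤ K * ‖g.toLp 2‖ := by
  apply Lp.norm_le_mul_norm_of_ae_le_mul
  filter_upwards [f.coeFn_toLp 2, g.coeFn_toLp 2] with x h1 h2
  rw [h1, h2]; exact h x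

lemma norm_toLp_congr (f g : SchwartzMap ℝ ℂ) (h : ∀ x, ‖f x‖ = ‖g x‖) :
    ‖f.toLp 2‖ = ‖g.toLp 2‖ := by
  apply le_antisymm
  · simpa using norm_toLp_le_of f g 1 (fun x => by simp [h x])
  · simpa using norm_toLp_le_of g f 1 (fun x => by simp [h x])

lemma eLpNorm_eq (f : SchwartzMap ℝ ℂ) : eLpNorm (⇑f) 2 volume = ENNReal.ofReal ‖f.toLp 2‖ := by
  rw [SchwartzMap.norm_toLp, ENNReal.ofReal_toReal (f.eLpNorm_lt_top 2 volume).ne]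

lemma upper_fin (C0 p r : ℝ) (hr : 0 ≤ r)
    (hint : Real.exp (-(2*C0)) * p ^ 2 - Real.exp (2 * C0) * r ^ 2 ≤ 0) :
    p ≤ Real.exp (2 * C0) * r := by
  have h5 : p ^ 2 ≤ (Real.exp (2 * C0) * r) ^ 2 := by
    have e : Real.exp (2 * C0) * Real.exp (-(2*C0)) = 1 := by rw [← Real.exp_add]; simp
    calc p ^ 2 = Real.exp (2 * C0) * (Real.exp (-(2*C0)) * p ^ 2) := by
          rw [← mul_assoc, e, one_mul]
      _ ≤ Real.exp (2 * C0) * (Real.exp (2 * C0) * r ^ 2) := by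
          exact mul_le_mul_of_nonneg_left (by linarith) (Real.exp_pos _).le
      _ = _ := by ring
  exact le_of_sq_le_sq h5 (by positivity)

set_option maxHeartbeats 800000 in
lemma upper_bound (a : ℝ → ℝ) (ha0 : ∀ x, 0 ≤ a x)
    (hinf : Tendsto a (cocompact ℝ) atTop) (c1 : ℝ) (hc1 : 0 ≤ c1) :
    ∃ N1 : ℝ, 0 < N1 ∧ ∀ c, 0 ≤ c → c ≤ c1 → ∀ v g : SchwartzMap ℝ ℂ,
      (∀ x, -deriv v x + a x * v x - c * v x = g x) → ‖v.toLp 2‖ ≤ N1 * ‖g.toLp 2‖ := by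
  obtain ⟨C0, hC0, m, m', hm, hm'c, hmb, hm'b, hmL⟩ := phi_lower a ha0 hinf c1 hc1
  refine ⟨Real.exp (2 * C0), Real.exp_pos _, fun c hc hcc v g hvg => ?_⟩
  have hmc : Continuous m := continuous_iff_continuousAt.mpr fun x => (hm x).continuousAt
  set w : ℝ → ℝ := fun x => Real.exp (2 * m x) with hw
  have hwc : Continuous w := by fun_prop
  set dv := SchwartzMap.derivCLM ℝ ℂ v with hdv
  have hdvx : ∀ x, dv x = deriv v x := fun x => by rw [hdv, SchwartzMap.derivCLM_apply]
  have hvd : ∀ x, HasDerivAt v (dv x) x := fun x => by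
    rw [hdvx]; exact (v.differentiableAt).hasDerivAt
  set F : ℝ → ℝ := fun x => w x * ‖v x‖ ^ 2 with hF
  set F' : ℝ → ℝ := fun x => w x * (2 * m' x) * ‖v x‖ ^ 2 + w x * (2 * inner ℝ (v x) (dv x)) with hF'
  have hFd : ∀ x, HasDerivAt F (F' x) x := by
    intro x
    have h1 : HasDerivAt w (w x * (2 * m' x)) x := ((hm x).const_mul 2).exp
    exact h1.mul (hvd x).norm_sq
  have hwle : ∀ x, w x ≤ Real.exp (2 * C0) := fun x => by
    apply Real.exp_le_exp.mpr; linarith [(abs_le.mp (hmb x)).2]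
  have hwge : ∀ x, Real.exp (-(2 * C0)) ≤ w x := fun x => by
    apply Real.exp_le_exp.mpr; linarith [(abs_le.mp (hmb x)).1]
  have hwpos : ∀ x, 0 < w x := fun x => Real.exp_pos _
  have hvc := v.continuous
  have hdvc := dv.continuous
  have hgc := g.continuous
  have iv := integrable_sq v
  have idv := integrable_sq dv
  have ig := integrable_sq g
  have hFi : Integrable F := by
    refine Integrable.mono' (iv.const_mul (Real.exp (2 * C0))) (by fun_prop) (Eventually.of_forall fun x => ?_)
    rw [Real.norm_eq_abs, abs_of_nonneg (mul_nonneg (hwpos x).le (sq_nonneg _))]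
    have := hwle x
    gcongr
  have hF'i : Integrable F' := by
    refine Integrable.mono' (((iv.const_mul (2 * C0)).add (iv.add idv)).const_mul (Real.exp (2 * C0)))
      (by
        apply Continuous.aestronglyMeasurable
        fun_prop) (Eventually.of_forall fun x => ?_)
    have e : F' x = w x * (2 * m' x * ‖v x‖ ^ 2 + 2 * inner ℝ (v x) (dv x)) := by
      simp only [hF']; ring
    rw [e, norm_mul, Real.norm_eq_abs (w x), abs_of_pos (hwpos x)]
    simp only [Pi.add_apply]
    have h1 : ‖2 * m' x * ‖v x‖ ^ 2 + 2 * inner ℝ (v x) (dv x)‖ ≤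
        2 * C0 * ‖v x‖ ^ 2 + (‖v x‖ ^ 2 + ‖dv x‖ ^ 2) := by
      refine (norm_add_le _ _).trans ?_
      have h2 : ‖2 * m' x * ‖v x‖ ^ 2‖ ≤ 2 * C0 * ‖v x‖ ^ 2 := by
        rw [norm_mul, norm_mul, Real.norm_eq_abs (m' x)]
        simp only [Real.norm_ofNat, norm_pow, norm_norm]
        have := hm'b x
        gcongr
      have h3 : ‖2 * inner ℝ (v x) (dv x)‖ ≤ ‖v x‖ ^ 2 + ‖dv x‖ ^ 2 := by
        rw [norm_mul, Real.norm_ofNat]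
        have := norm_inner_le_norm (𝕜 := ℝ) (v x) (dv x)
        nlinarith [sq_nonneg (‖v x‖ - ‖dv x‖)]
      linarith
    have := hwle x
    gcongr
  have hzero := integral_eq_zero_of_hasDerivAt_of_integrable hFd hF'i hFi
  have hpt : ∀ x, Real.exp (-(2*C0)) * ‖v x‖ ^ 2 - Real.exp (2 * C0) * ‖g x‖ ^ 2 ≤ F' x := by
    intro x
    have hdvg : dv x = ((a x - c : ℝ)) • v x - g x := by
      rw [hdvx, ← hvg x, Complex.real_smul]; push_cast; ring
    have hin : inner ℝ (v x) (dv x) = (a x - c) * ‖v x‖ ^ 2 - inner ℝ (v x) (g x) := by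
      rw [hdvg, inner_sub_right, inner_smul_right, real_inner_self_eq_norm_sq]
    have e : F' x = w x * (2 * (a x + m' x - c) * ‖v x‖ ^ 2 - 2 * inner ℝ (v x) (g x)) := by
      simp only [hF']; rw [hin]; ring
    rw [e]
    have h1 := real_inner_le_norm (v x) (g x)
    have h2 : ‖v x‖ ^ 2 - ‖g x‖ ^ 2 ≤ 2 * (a x + m' x - c) * ‖v x‖ ^ 2 - 2 * inner ℝ (v x) (g x) := by
      have h3 : ‖v x‖ ^ 2 ≤ (a x + m' x - c) * ‖v x‖ ^ 2 := by
        have := hmL x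
        have : 1 ≤ a x + m' x - c := by linarith
        nlinarith [sq_nonneg ‖v x‖]
      nlinarith [sq_nonneg (‖v x‖ - ‖g x‖)]
    calc _ ≤ w x * ‖v x‖ ^ 2 - w x * ‖g x‖ ^ 2 := by
            have := hwge x; have := hwle x
            gcongr
      _ = w x * (‖v x‖ ^ 2 - ‖g x‖ ^ 2) := by ring
      _ ≤ _ := mul_le_mul_of_nonneg_left h2 (hwpos x).le
  have hint : ∫ x, (Real.exp (-(2*C0)) * ‖v x‖ ^ 2 - Real.exp (2 * C0) * ‖g x‖ ^ 2) ≤ ∫ x, F' x :=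
    integral_mono ((iv.const_mul _).sub (ig.const_mul _)) hF'i hpt
  clear_value F F' w dv
  rw [hzero, integral_sub (iv.const_mul _) (ig.const_mul _), integral_const_mul, integral_const_mul,
    ← sq_norm_toLp, ← sq_norm_toLp] at hint
  exact upper_fin _ _ _ (norm_nonneg _) hint

/-- multiplication by a real temperate function -/
noncomputable def mulR (f : ℝ → ℝ) : SchwartzMap ℝ ℂ →ₗ[ℂ] SchwartzMap ℝ ℂ :=
  (SchwartzMap.smulLeftCLM ℂ (fun x => ((f x : ℝ) : ℂ))).toLinearMap

lemma mulR_apply (f : ℝ → ℝ) (hf : f.HasTemperateGrowth) (u : SchwartzMap ℝ ℂ) (x : ℝ) :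
    mulR f u x = (f x : ℂ) * u x := by
  have h : (fun x => ((f x : ℝ) : ℂ)).HasTemperateGrowth :=
    Function.HasTemperateGrowth.comp Function.Complex.hasTemperateGrowth_ofReal hf
  exact SchwartzMap.smulLeftCLM_apply_apply h u x

/-- gauge multiplication -/
noncomputable def gaugeS (b : ℝ) : SchwartzMap ℝ ℂ →ₗ[ℂ] SchwartzMap ℝ ℂ :=
  (SchwartzMap.smulLeftCLM ℂ (fun x : ℝ => Complex.exp (Complex.I * b * x))).toLinearMap

lemma gauge_apply (b : ℝ) (u : SchwartzMap ℝ ℂ) (x : ℝ) :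
    gaugeS b u x = Complex.exp (Complex.I * b * x) * u x :=
  SchwartzMap.smulLeftCLM_apply_apply (temperate_expI b) u x

lemma gauge_norm (b : ℝ) (u : SchwartzMap ℝ ℂ) : ‖(gaugeS b u).toLp 2‖ = ‖u.toLp 2‖ :=
  norm_toLp_congr _ _ fun x => by rw [gauge_apply, norm_mul, norm_expI, one_mul]

/-- derivative -/
noncomputable def Dl : SchwartzMap ℝ ℂ →ₗ[ℂ] SchwartzMap ℝ ℂ :=
  (SchwartzMap.derivCLM ℂ ℂ).toLinearMap

lemma Dl_apply (u : SchwartzMap ℝ ℂ) (x : ℝ) : Dl u x = deriv u x :=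
  SchwartzMap.derivCLM_apply ℂ u x

lemma Dl_coe (u : SchwartzMap ℝ ℂ) : ⇑(Dl u) = deriv u := funext (Dl_apply u)

lemma gauge_deriv (b : ℝ) (u : SchwartzMap ℝ ℂ) :
    Dl (gaugeS b u) = gaugeS b (Dl u + (Complex.I * (b:ℂ)) • u) := by
  ext x
  rw [gauge_apply, Dl_apply]
  have e : ⇑(gaugeS b u) = fun x : ℝ => Complex.exp (Complex.I * b * x) * u x :=
    funext (gauge_apply b u)
  have h1 : HasDerivAt (fun x : ℝ => (Complex.I * b) * (x:ℂ)) ((Complex.I * b) * 1) x :=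
    (Complex.ofRealCLM.hasDerivAt (x := x)).const_mul (Complex.I * (b:ℂ))
  have h2 := h1.cexp.mul (u.differentiableAt (x := x)).hasDerivAt
  rw [e]
  refine h2.deriv.trans ?_
  simp only [add_apply, smul_apply, smul_eq_mul, Dl_apply]
  ring

lemma gauge_inv (b : ℝ) (u : SchwartzMap ℝ ℂ) : gaugeS (-b) (gaugeS b u) = u := by
  ext x
  rw [gauge_apply, gauge_apply, ← mul_assoc, ← Complex.exp_add]
  have : Complex.I * ((-b : ℝ) : ℂ) * x + Complex.I * b * x = 0 := by push_cast; ring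
  rw [this]; simp

lemma gauge_mulR (b : ℝ) (f : ℝ → ℝ) (hf : f.HasTemperateGrowth) (u : SchwartzMap ℝ ℂ) :
    mulR f (gaugeS b u) = gaugeS b (mulR f u) := by
  ext x
  rw [gauge_apply, mulR_apply f hf, mulR_apply f hf, gauge_apply]; ring

lemma Dl_skew (u v : SchwartzMap ℝ ℂ) :
    (inner ℂ ((Dl u).toLp 2) (v.toLp 2) : ℂ) = - inner ℂ (u.toLp 2) ((Dl v).toLp 2) := by
  rw [SchwartzMap.inner_toL2_toL2_eq _ _ volume, SchwartzMap.inner_toL2_toL2_eq _ _ volume, Dl_coe, Dl_coe]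
  set L : ℂ →L[ℝ] ℂ →L[ℝ] ℂ := (ContinuousLinearMap.mul ℝ ℂ).comp (Complex.conjCLE : ℂ →L[ℝ] ℂ) with hL
  have hLi : ∀ x y : ℂ, L x y = inner ℂ x y := fun x y => by
    simp [hL, mul_comm]
  have := SchwartzMap.integral_bilinear_deriv_right_eq_neg_left u v L
  simp_rw [hLi] at this
  rw [this, neg_neg]

lemma mulR_sym (f : ℝ → ℝ) (hf : f.HasTemperateGrowth) (u v : SchwartzMap ℝ ℂ) :
    (inner ℂ ((mulR f u).toLp 2) (v.toLp 2) : ℂ) = inner ℂ (u.toLp 2) ((mulR f v).toLp 2) := by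
  rw [SchwartzMap.inner_toL2_toL2_eq _ _ volume, SchwartzMap.inner_toL2_toL2_eq _ _ volume]
  refine integral_congr_ae (Eventually.of_forall fun x => ?_)
  simp only [mulR_apply f hf]
  simp
  ring

lemma mulR_comm (f : ℝ → ℝ) (hf : f.HasTemperateGrowth) (u : SchwartzMap ℝ ℂ) :
    Dl (mulR f u) = mulR (deriv f) u + mulR f (Dl u) := by
  ext x
  rw [Dl_apply, add_apply, mulR_apply f hf, mulR_apply _ (temperate_deriv f hf), Dl_apply]
  have e : ⇑(mulR f u) = fun x : ℝ => (f x : ℂ) * u x := funext (mulR_apply f hf u)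
  rw [e]
  have h1 : HasDerivAt (fun x : ℝ => (f x : ℂ)) ((deriv f x : ℝ) : ℂ) x :=
    ((hf.1.differentiable (by simp)) x).hasDerivAt.ofReal_comp
  exact (h1.mul (u.differentiableAt (x := x)).hasDerivAt).deriv

/-- L² norm of a Schwartz function -/
noncomputable def LN (u : SchwartzMap ℝ ℂ) : ℝ := ‖u.toLp 2 volume‖

/-- the concrete system -/
noncomputable def mkSys (a q : ℝ → ℝ) (ha : a.HasTemperateGrowth) (hq : q.HasTemperateGrowth)
    (ha0 : ∀ x, 0 ≤ a x) (hq0 : ∀ x, 0 ≤ q x) (C1 : ℝ) (hC1 : 0 ≤ C1)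
    (hb : ∀ x, |deriv a x| ≤ C1 * (1 + a x)) (K : ℝ) (hK : 0 ≤ K)
    (hqb : ∀ x, q x ≤ K * (1 + a x)) :
    Sys (SchwartzMap ℝ ℂ) (Lp ℂ 2 (volume : Measure ℝ)) where
  J := (SchwartzMap.toLpCLM ℂ ℂ 2 volume).toLinearMap
  D := Dl
  A := mulR a
  A1 := mulR (deriv a)
  Q := mulR q
  D_skew := Dl_skew
  A_sym := mulR_sym a ha
  comm := mulR_comm a ha
  C1 := C1
  C1_nonneg := hC1
  A1_le u := by
    refine norm_toLp_le_of _ _ C1 fun x => ?_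
    have e : (u + mulR a u) x = ((1 + a x : ℝ) : ℂ) * u x := by
      rw [add_apply, mulR_apply a ha]; push_cast; ring
    rw [e, mulR_apply _ (temperate_deriv a ha), norm_mul, norm_mul, Complex.norm_real,
      Complex.norm_real, Real.norm_eq_abs, Real.norm_eq_abs (1 + a x),
      abs_of_nonneg (show (0:ℝ) ≤ 1 + a x by linarith [ha0 x]), ← mul_assoc]
    exact mul_le_mul_of_nonneg_right (hb x) (norm_nonneg _)
  K := K
  K_nonneg := hK
  Q_le u := by
    refine norm_toLp_le_of _ _ K fun x => ?_
    have e : (u + mulR a u) x = ((1 + a x : ℝ) : ℂ) * u x := by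
      rw [add_apply, mulR_apply a ha]; push_cast; ring
    rw [e, mulR_apply _ hq, norm_mul, norm_mul, Complex.norm_real,
      Complex.norm_real, Real.norm_eq_abs, Real.norm_eq_abs (1 + a x),
      abs_of_nonneg (show (0:ℝ) ≤ 1 + a x by linarith [ha0 x]), abs_of_nonneg (hq0 x), ← mul_assoc]
    exact mul_le_mul_of_nonneg_right (hqb x) (norm_nonneg _)
  Q_im u := by
    have e := SchwartzMap.inner_toL2_toL2_eq (mulR q u) (u + mulR a u) volume
    have e2 : ∀ x, inner ℂ (mulR q u x) ((u + mulR a u) x) =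
        ((q x * (1 + a x) * ‖u x‖ ^ 2 : ℝ) : ℂ) := fun x => by
      rw [add_apply, mulR_apply a ha, mulR_apply q hq]
      have := Complex.mul_conj' (u x)
      simp only [RCLike.inner_apply, map_mul, Complex.conj_ofReal]
      push_cast
      rw [← this]; ring
    simp_rw [e2] at e
    rw [integral_complex_ofReal] at e
    change (inner ℂ ((mulR q u).toLp 2 volume) ((u + mulR a u).toLp 2 volume) : ℂ).im = 0
    rw [e, Complex.ofReal_im]
  id_le u := by
    have := norm_toLp_le_of u (u + mulR a u) 1 fun x => by
      have e : (u + mulR a u) x = ((1 + a x : ℝ) : ℂ) * u x := by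
        rw [add_apply, mulR_apply a ha]; push_cast; ring
      rw [e, norm_mul, Complex.norm_real, Real.norm_eq_abs,
        abs_of_nonneg (show (0:ℝ) ≤ 1 + a x by linarith [ha0 x])]
      nlinarith [ha0 x, norm_nonneg (u x)]
    rwa [one_mul] at this
  A_le u := by
    have := norm_toLp_le_of (mulR a u) (u + mulR a u) 1 fun x => by
      have e : (u + mulR a u) x = ((1 + a x : ℝ) : ℂ) * u x := by
        rw [add_apply, mulR_apply a ha]; push_cast; ring
      rw [e, mulR_apply a ha, norm_mul, norm_mul, Complex.norm_real, Complex.norm_real,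
        Real.norm_eq_abs, Real.norm_eq_abs,
        abs_of_nonneg (show (0:ℝ) ≤ 1 + a x by linarith [ha0 x]), abs_of_nonneg (ha0 x)]
      nlinarith [ha0 x, norm_nonneg (u x)]
    rwa [one_mul] at this

/-- the Airy operator minus c -/
noncomputable def Bop (a : ℝ → ℝ) (c : ℝ) (u : SchwartzMap ℝ ℂ) : SchwartzMap ℝ ℂ :=
  -Dl u + mulR a u - (c : ℂ) • u

lemma Bop_apply (a : ℝ → ℝ) (ha : a.HasTemperateGrowth) (c : ℝ) (u : SchwartzMap ℝ ℂ) (x : ℝ) :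
    Bop a c u x = -deriv u x + (a x : ℂ) * u x - (c : ℂ) * u x := by
  rw [Bop, sub_apply, add_apply, neg_apply, smul_apply, Dl_apply, mulR_apply a ha, smul_eq_mul]

lemma NA_eq (a : ℝ → ℝ) (ha : a.HasTemperateGrowth) (c : ℝ) : NA a c =
    ⨆ (u : SchwartzMap ℝ ℂ) (_ : u ≠ 0), ENNReal.ofReal (LN u) / ENNReal.ofReal (LN (Bop a c u)) := by
  unfold NA LN
  congr 1; funext u; congr 1; funext _
  rw [← eLpNorm_eq, ← eLpNorm_eq]
  congr 2
  funext x
  rw [Bop_apply a ha]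

lemma LN_nonneg (u : SchwartzMap ℝ ℂ) : 0 ≤ LN u := norm_nonneg _

lemma LN_zero : LN 0 = 0 := by
  unfold LN
  have : (0 : SchwartzMap ℝ ℂ).toLp 2 volume = 0 :=
    (SchwartzMap.toLpCLM ℂ ℂ 2 volume).map_zero
  rw [this, norm_zero]

lemma LN_pos (u : SchwartzMap ℝ ℂ) (hu : u ≠ 0) : 0 < LN u := by
  apply norm_pos_iff.mpr
  intro h
  apply hu
  apply SchwartzMap.injective_toLp 2 volume
  simp only
  rw [h]
  exact ((SchwartzMap.toLpCLM ℂ ℂ 2 volume).map_zero).symm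

lemma NA_facts (a : ℝ → ℝ) (ha : a.HasTemperateGrowth) (c N1 : ℝ) (hN1 : 0 < N1)
    (hub : ∀ u, LN u ≤ N1 * LN (Bop a c u)) :
    ∃ N : ℝ, 0 ≤ N ∧ N ≤ N1 ∧ NA a c = ENNReal.ofReal N ∧ ∀ u, LN u ≤ N * LN (Bop a c u) := by
  have hle : NA a c ≤ ENNReal.ofReal N1 := by
    rw [NA_eq a ha]
    refine iSup₂_le fun u _ => ?_
    apply ENNReal.div_le_of_le_mul
    rw [← ENNReal.ofReal_mul hN1.le]
    exact ENNReal.ofReal_le_ofReal (hub u)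
  have hne : NA a c ≠ ⊤ := (hle.trans_lt ENNReal.ofReal_lt_top).ne
  have heq : NA a c = ENNReal.ofReal (NA a c).toReal := (ENNReal.ofReal_toReal hne).symm
  refine ⟨(NA a c).toReal, ENNReal.toReal_nonneg, ?_, heq, fun u => ?_⟩
  · exact ENNReal.toReal_le_of_le_ofReal hN1.le hle
  · by_cases hu : u = 0
    · subst hu
      rw [LN_zero]
      exact mul_nonneg ENNReal.toReal_nonneg (LN_nonneg _)
    have hpos : 0 < LN (Bop a c u) := by
      have h1 := LN_pos u hu
      have h2 := hub u
      by_contra h3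
      have h4 : LN (Bop a c u) = 0 := le_antisymm (not_lt.mp h3) (LN_nonneg _)
      rw [h4, mul_zero] at h2
      linarith
    have h5 : ENNReal.ofReal (LN u) / ENNReal.ofReal (LN (Bop a c u)) ≤ NA a c := by
      rw [NA_eq a ha]
      exact le_iSup₂ (f := fun (u : SchwartzMap ℝ ℂ) (_ : u ≠ 0) =>
        ENNReal.ofReal (LN u) / ENNReal.ofReal (LN (Bop a c u))) u hu
    rw [ENNReal.div_le_iff (by simpa using hpos) ENNReal.ofReal_ne_top, heq,
      ← ENNReal.ofReal_mul ENNReal.toReal_nonneg] at h5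
    exact (ENNReal.ofReal_le_ofReal_iff (mul_nonneg ENNReal.toReal_nonneg hpos.le)).mp h5

lemma exists_ne_zero_schwartz : ∃ u : SchwartzMap ℝ ℂ, u ≠ 0 := by
  let f : ContDiffBump (0 : ℝ) := ⟨1, 2, by norm_num, by norm_num⟩
  have h1 : HasCompactSupport (fun x => ((f x : ℝ) : ℂ)) :=
    f.hasCompactSupport.comp_left (g := fun y : ℝ => (y : ℂ)) (by simp)
  have h2 : ContDiff ℝ (⊤ : ℕ∞) (fun x => ((f x : ℝ) : ℂ)) :=
    Complex.ofRealCLM.contDiff.comp f.contDiff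
  refine ⟨h1.toSchwartzMap h2, fun h => ?_⟩
  have h3 : (h1.toSchwartzMap h2) 0 = 0 := by rw [h]; rfl
  have h4 : (h1.toSchwartzMap h2) 0 = ((f 0 : ℝ) : ℂ) := rfl
  rw [h4, f.one_of_mem_closedBall (by simp [f])] at h3
  simp at h3

lemma LN_Bop_le (a : ℝ → ℝ) (c : ℝ) (hc : 0 ≤ c) (u : SchwartzMap ℝ ℂ) :
    LN (Bop a c u) ≤ LN (Bop a 0 u) + c * LN u := by
  have e : Bop a c u = Bop a 0 u - (c : ℂ) • u := by
    unfold Bop; simp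
  have e2 : (Bop a c u).toLp 2 volume = (Bop a 0 u).toLp 2 volume - (c : ℂ) • (u.toLp 2 volume) := by
    rw [e]
    exact ((SchwartzMap.toLpCLM ℂ ℂ 2 volume).map_sub _ _).trans
      (by rw [map_smul]; rfl)
  unfold LN
  rw [e2]
  refine (norm_sub_le _ _).trans ?_
  rw [norm_smul, Complex.norm_real, Real.norm_eq_abs, abs_of_nonneg hc]

lemma lower_delta (a : ℝ → ℝ) (c1 : ℝ) (hc1 : 0 ≤ c1) :
    ∃ δ : ℝ, 0 < δ ∧ ∀ c N, 0 ≤ c → c ≤ c1 → 0 ≤ N → (∀ u, LN u ≤ N * LN (Bop a c u)) → δ ≤ N := by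
  obtain ⟨u, hu⟩ := exists_ne_zero_schwartz
  have hp := LN_pos u hu
  have hB := LN_nonneg (Bop a 0 u)
  set X := LN (Bop a 0 u) + c1 * LN u + 1 with hX
  have hXpos : 0 < X := by positivity
  refine ⟨LN u / X, by positivity, fun c N hc hcc hN h => ?_⟩
  rw [div_le_iff₀ hXpos]
  refine (h u).trans ?_
  have := LN_Bop_le a c hc u
  have : c * LN u ≤ c1 * LN u := by gcongr
  gcongr
  linarith

lemma sol_minus (a : ℝ → ℝ) (ha : a.HasTemperateGrowth) (ha0 : ∀ x, 0 ≤ a x)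
    (hinf : Tendsto a (cocompact ℝ) atTop) (c : ℝ) (hc : 0 ≤ c) (g : SchwartzMap ℝ ℂ) :
    ∃ φ, Bop a c φ = g := by
  obtain ⟨φ, h⟩ := exists_sol_minus a ha ha0 hinf c hc g
  refine ⟨φ, ?_⟩
  ext x
  rw [Bop_apply a ha, h x]

lemma sol_plus (a : ℝ → ℝ) (ha : a.HasTemperateGrowth) (ha0 : ∀ x, 0 ≤ a x)
    (hinf : Tendsto a (cocompact ℝ) atTop) (c : ℝ) (hc : 0 ≤ c) (g : SchwartzMap ℝ ℂ) :
    ∃ φ, Dl φ + mulR a φ - (c : ℂ) • φ = g := by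
  obtain ⟨φ, h⟩ := exists_sol_plus a ha ha0 hinf c hc g
  refine ⟨φ, ?_⟩
  ext x
  rw [← h x, sub_apply, add_apply, smul_apply, Dl_apply, mulR_apply a ha, smul_eq_mul]

lemma dual_bound (a : ℝ → ℝ) (ha : a.HasTemperateGrowth) (ha0 : ∀ x, 0 ≤ a x)
    (hinf : Tendsto a (cocompact ℝ) atTop) (c N : ℝ) (hc : 0 ≤ c)
    (h : ∀ u, LN u ≤ N * LN (Bop a c u)) (ψ : SchwartzMap ℝ ℂ) :
    LN ψ ≤ N * LN (Dl ψ + mulR a ψ - (c : ℂ) • ψ) := by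
  obtain ⟨χ, hχ⟩ := sol_minus a ha ha0 hinf c hc ψ
  have hb := h χ
  rw [hχ] at hb
  let J := SchwartzMap.toLpCLM ℂ ℂ 2 (volume : Measure ℝ)
  have h1 : (inner ℂ (J (Dl ψ)) (J χ) : ℂ) = - inner ℂ (J ψ) (J (Dl χ)) := Dl_skew ψ χ
  have h2 : (inner ℂ (J (mulR a ψ)) (J χ) : ℂ) = inner ℂ (J ψ) (J (mulR a χ)) := mulR_sym a ha ψ χ
  have key : (inner ℂ (J ψ) (J (Bop a c χ)) : ℂ) =
      inner ℂ (J (Dl ψ + mulR a ψ - (c : ℂ) • ψ)) (J χ) := by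
    unfold Bop
    simp only [map_sub, map_add, map_neg, map_smul, inner_sub_left, inner_sub_right, inner_add_left,
      inner_add_right, inner_neg_right, inner_smul_left, inner_smul_right, h1, h2, Complex.conj_ofReal]
  rw [hχ] at key
  have h3 : LN ψ * LN ψ ≤ LN (Dl ψ + mulR a ψ - (c : ℂ) • ψ) * LN χ := by
    have h4 := norm_inner_le_norm (𝕜 := ℂ) (J (Dl ψ + mulR a ψ - (c : ℂ) • ψ)) (J χ)
    rw [← key, inner_self_eq_norm_sq_to_K] at h4
    have h5 : ‖((‖J ψ‖ : ℝ) : ℂ) ^ 2‖ = ‖J ψ‖ * ‖J ψ‖ := by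
      rw [norm_pow, Complex.norm_real, norm_norm, sq]
    exact h5.symm.le.trans h4
  set H := LN (Dl ψ + mulR a ψ - (c : ℂ) • ψ) with hH
  have hHn : 0 ≤ H := LN_nonneg _
  rcases eq_or_lt_of_le (LN_nonneg ψ) with h0 | h0
  · rw [← h0] at hb ⊢
    have hχ0 : LN χ ≤ 0 := by simpa using hb
    by_cases hχz : χ = 0
    · -- then ψ = 0, need 0 ≤ N * H
      have hψ : ψ = 0 := by
        by_contra hne
        exact absurd h0 (LN_pos ψ hne).ne
      have : H = 0 := by
        rw [hH, hψ]; simp [LN_zero]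
      rw [this, mul_zero]
    · exact absurd hχ0 (not_le.mpr (LN_pos χ hχz))
  · have h6 : LN ψ * LN ψ ≤ (N * H) * LN ψ := by
      refine h3.trans ?_
      calc H * LN χ ≤ H * (N * LN ψ) := by gcongr
        _ = _ := by ring
    exact le_of_mul_le_mul_right h6 h0

lemma sol_minus_b (a : ℝ → ℝ) (ha : a.HasTemperateGrowth) (ha0 : ∀ x, 0 ≤ a x)
    (hinf : Tendsto a (cocompact ℝ) atTop) (c N b : ℝ) (hc : 0 ≤ c)
    (h : ∀ u, LN u ≤ N * LN (Bop a c u)) (g : SchwartzMap ℝ ℂ) :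
    ∃ φ, -Dl φ + mulR a φ - (c : ℂ) • φ - (Complex.I * (b : ℂ)) • φ = g ∧ LN φ ≤ N * LN g := by
  obtain ⟨φ, hφ⟩ := sol_minus a ha ha0 hinf c hc (gaugeS b g)
  refine ⟨gaugeS (-b) φ, ?_, ?_⟩
  · rw [gauge_deriv, gauge_mulR _ _ ha]
    have e : -gaugeS (-b) (Dl φ + (Complex.I * ((-b : ℝ) : ℂ)) • φ) + gaugeS (-b) (mulR a φ)
        - (c : ℂ) • gaugeS (-b) φ - (Complex.I * (b : ℂ)) • gaugeS (-b) φ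
        = gaugeS (-b) (Bop a c φ) := by
      rw [← map_smul, ← map_smul, ← map_neg, ← map_add, ← map_sub, ← map_sub]
      congr 1
      unfold Bop
      push_cast
      module
    rw [e, hφ, gauge_inv]
  · have h1 := h φ
    rw [hφ] at h1
    unfold LN at *
    rw [gauge_norm] at h1 ⊢
    exact h1

lemma sol_plus_b (a : ℝ → ℝ) (ha : a.HasTemperateGrowth) (ha0 : ∀ x, 0 ≤ a x)
    (hinf : Tendsto a (cocompact ℝ) atTop) (c N b : ℝ) (hc : 0 ≤ c)
    (h : ∀ u, LN u ≤ N * LN (Bop a c u)) (g : SchwartzMap ℝ ℂ) :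
    ∃ φ, Dl φ + mulR a φ - (c : ℂ) • φ - (Complex.I * (b : ℂ)) • φ = g ∧ LN φ ≤ N * LN g := by
  obtain ⟨φ, hφ⟩ := sol_plus a ha ha0 hinf c hc (gaugeS (-b) g)
  refine ⟨gaugeS b φ, ?_, ?_⟩
  · rw [gauge_deriv, gauge_mulR _ _ ha]
    have e : gaugeS b (Dl φ + (Complex.I * (b : ℂ)) • φ) + gaugeS b (mulR a φ)
        - (c : ℂ) • gaugeS b φ - (Complex.I * (b : ℂ)) • gaugeS b φ
        = gaugeS b (Dl φ + mulR a φ - (c : ℂ) • φ) := by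
      rw [← map_smul, ← map_smul, ← map_add, ← map_sub, ← map_sub]
      congr 1
      module
    rw [e, hφ]
    have := gauge_inv (-b) g
    rwa [neg_neg] at this
  · have h1 := dual_bound a ha ha0 hinf c N hc h φ
    rw [hφ] at h1
    unfold LN at *
    rw [gauge_norm] at h1 ⊢
    exact h1

/-- the concrete T -/
noncomputable def Tm (a q : ℝ → ℝ) (c b : ℝ) (u : SchwartzMap ℝ ℂ) : SchwartzMap ℝ ℂ :=
  -Dl (Dl u) + mulR q u + (2 * (-(c : ℂ) + Complex.I * b)) • mulR a u
    + ((-(c : ℂ) + Complex.I * b) ^ 2) • u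

lemma Tm_coe (a q : ℝ → ℝ) (ha : a.HasTemperateGrowth) (hq : q.HasTemperateGrowth) (c b : ℝ)
    (u : SchwartzMap ℝ ℂ) : Tq a q (-(c : ℂ) + Complex.I * (b : ℂ)) ⇑u = ⇑(Tm a q c b u) := by
  funext x
  unfold Tq Tm
  rw [add_apply, add_apply, add_apply, neg_apply, smul_apply, smul_apply, Dl_apply, Dl_coe,
    mulR_apply a ha, mulR_apply q hq, smul_eq_mul, smul_eq_mul]
  ring

lemma Tm_gauge (a q : ℝ → ℝ) (ha : a.HasTemperateGrowth) (hq : q.HasTemperateGrowth) (c b : ℝ)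
    (v : SchwartzMap ℝ ℂ) : Tm a q c b (gaugeS b v) = gaugeS b ((2 * Complex.I * b) • Bop a c v +
      (-Dl (Dl v) + mulR q v - (2 * c : ℂ) • mulR a v + (c ^ 2 : ℂ) • v)) := by
  unfold Tm Bop
  rw [gauge_deriv, gauge_deriv, gauge_mulR _ _ ha, gauge_mulR _ _ hq]
  simp only [map_add, map_smul, map_sub, map_neg, smul_add, smul_sub, smul_neg]
  match_scalars <;> ring

theorem stmt5 (a q : ℝ → ℝ) (h : Standing a q)
    (K : Set ℝ) (hKb : Bornology.IsBounded K) (hK : K ⊆ Set.Ici 0) :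
    ∃ C : ℝ, 0 < C ∧ ∃ b₀ : ℝ, 0 < b₀ ∧ ∀ c ∈ K, ∀ b : ℝ, b₀ ≤ |b| →
      (∀ u : SchwartzMap ℝ ℂ,
          ENNReal.ofReal (2 * |b| - C) * eLpNorm (⇑u) 2 volume
            ≤ NA a c * eLpNorm (Tq a q (-(c : ℂ) + Complex.I * (b : ℂ)) ⇑u) 2 volume) ∧
      (∀ M : ℝ, ENNReal.ofReal M < NA a c →
          ∃ u : SchwartzMap ℝ ℂ, u ≠ 0 ∧
            ENNReal.ofReal M * eLpNorm (Tq a q (-(c : ℂ) + Complex.I * (b : ℂ)) ⇑u) 2 volume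
              ≤ ENNReal.ofReal (2 * |b| + C) * eLpNorm (⇑u) 2 volume) := by
  have ha := temperate_of a h.smooth_a h.nonneg_a h.deriv_a
  have hq := temperate_of q h.smooth_q h.nonneg_q h.deriv_q
  have ha0 := h.nonneg_a
  have hinf := h.unbounded_a
  -- derivative bound
  obtain ⟨C1, hC1, hC1b⟩ : ∃ C1 : ℝ, 0 ≤ C1 ∧ ∀ x, |deriv a x| ≤ C1 * (1 + a x) := by
    obtain ⟨C, hC, hCb⟩ := h.deriv_a 1 le_rfl
    refine ⟨C, hC.le, fun x => ?_⟩
    have h1 := hCb x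
    rw [iteratedDeriv_one] at h1
    refine h1.trans ?_
    have h2 : (1 + x ^ 2) ^ (-((1 : ℕ) : ℝ) / 2) ≤ 1 := by
      apply Real.rpow_le_one_of_one_le_of_nonpos
      · nlinarith [sq_nonneg x]
      · norm_num
    have h3 : 0 ≤ C * (1 + a x) := mul_nonneg hC.le (by linarith [ha0 x])
    nlinarith
  obtain ⟨Kq, hKq, hKqb⟩ : ∃ K : ℝ, 0 ≤ K ∧ ∀ x, q x ≤ K * (1 + a x) := by
    obtain ⟨K0, hK0, x0, hx0, hb⟩ := h.q_le_a
    obtain ⟨B, hB⟩ := (isCompact_Icc (a := -x0) (b := x0)).exists_bound_of_continuousOn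
      h.smooth_q.continuous.continuousOn
    refine ⟨K0 + |B|, by positivity, fun x => ?_⟩
    have hax := ha0 x
    have hBn := abs_nonneg B
    by_cases hx : x0 < |x|
    · have := hb x hx
      nlinarith [mul_nonneg hBn hax]
    · have h1 := hB x (abs_le.mp (not_lt.mp hx))
      have h2 : q x ≤ |B| := (le_abs_self _).trans (h1.trans (le_abs_self _))
      nlinarith [mul_nonneg hBn hax, mul_nonneg hK0.le hax]
  let s := mkSys a q ha hq ha0 h.nonneg_q C1 hC1 hC1b Kq hKq hKqb
  obtain ⟨R, hR⟩ := hKb.exists_norm_le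
  set c1 := max R 0 with hc1def
  have hc1 : 0 ≤ c1 := le_max_right _ _
  have hKc : ∀ c ∈ K, 0 ≤ c ∧ c ≤ c1 := fun c hc =>
    ⟨hK hc, (le_abs_self c).trans ((hR c hc).trans (le_max_left _ _))⟩
  obtain ⟨N1, hN1, hub⟩ := upper_bound a ha0 hinf c1 hc1
  have hub' : ∀ c, 0 ≤ c → c ≤ c1 → ∀ u, LN u ≤ N1 * LN (Bop a c u) := fun c hc hcc u =>
    hub c hc hcc u (Bop a c u) fun x => (Bop_apply a ha c u x).symm
  obtain ⟨δ, hδ, hlow⟩ := lower_delta a c1 hc1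
  obtain ⟨CI, hCI, b0, hb0, hI⟩ := s.partI c1 δ N1 hc1 hδ hN1.le
  obtain ⟨CII, hCII, hII⟩ := s.partII c1 (δ/2) N1 hc1 (by positivity) hN1.le
  refine ⟨max CI CII, lt_max_of_lt_left hCI, b0, hb0, fun c hcK b hb => ?_⟩
  obtain ⟨hc, hcc⟩ := hKc c hcK
  obtain ⟨N, hN0, hNN1, hNA, hN⟩ := NA_facts a ha c N1 hN1 (hub' c hc hcc)
  have hδN := hlow c N hc hcc hN0 hN
  constructor
  · intro u
    obtain ⟨φ, hφ, hφn⟩ := sol_minus_b a ha ha0 hinf c N b hc hN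
      (-Dl u + mulR a u - (c : ℂ) • u + (Complex.I * (b : ℂ)) • u)
    obtain ⟨ψ, hψ, hψn⟩ := sol_plus_b a ha ha0 hinf c N b hc hN
      (Dl u + mulR a u - (c : ℂ) • u + (Complex.I * (b : ℂ)) • u)
    have hfin : (2 * |b| - CI) * LN u ≤ N * LN (Tm a q c b u) :=
      hI c N b hc hcc hδN hNN1 hb u φ ψ _ _ rfl rfl hφ hψ hφn hψn
    rw [Tm_coe a q ha hq, eLpNorm_eq, eLpNorm_eq, hNA, ← ENNReal.ofReal_mul hN0,
      ← ENNReal.ofReal_mul' (norm_nonneg _)]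
    apply ENNReal.ofReal_le_ofReal
    refine le_trans ?_ hfin
    exact mul_le_mul_of_nonneg_right (by linarith [le_max_left CI CII]) (norm_nonneg _)
  · intro M hM
    set M' := max M (δ/2) with hM'
    have hM'pos : 0 < M' := lt_max_of_lt_right (by positivity)
    have hNpos : 0 < N := hδ.trans_le hδN
    rw [hNA, ENNReal.ofReal_lt_ofReal_iff hNpos] at hM
    have hM'N : M' < N := max_lt hM (by linarith)
    have hlt : ENNReal.ofReal M' < NA a c := by
      rw [hNA]; exact (ENNReal.ofReal_lt_ofReal_iff hNpos).mpr hM'N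
    rw [NA_eq a ha] at hlt
    obtain ⟨f1, hlt1⟩ := lt_iSup_iff.mp hlt
    obtain ⟨hf1, hlt2⟩ := lt_iSup_iff.mp hlt1
    have hf : M' * LN (Bop a c f1) ≤ LN f1 := by
      have := ENNReal.mul_le_of_le_div hlt2.le
      rw [← ENNReal.ofReal_mul hM'pos.le] at this
      exact (ENNReal.ofReal_le_ofReal_iff (LN_nonneg _)).mp this
    obtain ⟨f2, hf2⟩ := sol_plus a ha ha0 hinf c hc f1
    obtain ⟨v, hv⟩ := sol_minus a ha ha0 hinf c hc f2
    have hfin : ((δ/2) ^ 2 * LN f1 ≤ LN v) ∧ M' * LN ((2 * Complex.I * b) • f2 +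
        (-Dl (Dl v) + mulR q v - (2 * c : ℂ) • mulR a v + (c ^ 2 : ℂ) • v)) ≤
          (2 * |b| + CII) * LN v :=
      hII c M' b hc hcc (le_max_right _ _) (hM'N.le.trans hNN1) (Bop a c f1) f1 f2 v rfl hf2 hv hf
    have hvpos : 0 < LN v := lt_of_lt_of_le (mul_pos (by positivity) (LN_pos f1 hf1)) hfin.1
    have hLu : LN (gaugeS b v) = LN v := gauge_norm b v
    refine ⟨gaugeS b v, ?_, ?_⟩
    · intro h0
      rw [h0, LN_zero] at hLu
      linarith
    · have hT : LN (Tm a q c b (gaugeS b v)) = LN ((2 * Complex.I * b) • f2 +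
          (-Dl (Dl v) + mulR q v - (2 * c : ℂ) • mulR a v + (c ^ 2 : ℂ) • v)) := by
        rw [Tm_gauge a q ha hq, hv]
        exact gauge_norm b _
      rw [← hT] at hfin
      rw [Tm_coe a q ha hq, eLpNorm_eq, eLpNorm_eq]
      change ENNReal.ofReal M * ENNReal.ofReal (LN (Tm a q c b (gaugeS b v))) ≤
        ENNReal.ofReal (2 * |b| + max CI CII) * ENNReal.ofReal (LN (gaugeS b v))
      rw [hLu, ← ENNReal.ofReal_mul' (LN_nonneg _), ← ENNReal.ofReal_mul' (LN_nonneg _)]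
      apply ENNReal.ofReal_le_ofReal
      calc M * LN (Tm a q c b (gaugeS b v)) ≤ M' * LN (Tm a q c b (gaugeS b v)) :=
            mul_le_mul_of_nonneg_right (le_max_left _ _) (LN_nonneg _)
        _ ≤ (2 * |b| + CII) * LN v := hfin.2
        _ ≤ _ := mul_le_mul_of_nonneg_right (by linarith [le_max_right CI CII]) (LN_nonneg _)
end

section
/- Under the standing assumptions on a and q, for every bounded set K ⊂ [0,∞) and every δ ∈ (0, 1/4) there exist constants C > 0 and b₀ > 0 such that for all c ∈ K, all real b ≥ b₀, and every Schwartz function u : ℝ → ℂ whose Fourier transform 𝓕u vanishes on the set (b − δb, b + δb) ∪ (−b − δb, −b + δb), setting λ = −c + i·b, one has b²·‖u‖ ≤ C·‖T(λ)u‖. -/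
open MeasureTheory Filter
open scoped ENNReal

/-- Fourier transform `𝓕u(ξ) = (2π)^(-1/2) ∫ e^(-iξx) u(x) dx`. -/
noncomputable def FT (u : ℝ → ℂ) : ℝ → ℂ :=
  fun ξ => (↑(Real.sqrt (2 * Real.pi)))⁻¹ * ∫ x : ℝ, Complex.exp (-(Complex.I * (ξ : ℂ) * (x : ℂ))) * u x

/-- Inverse Fourier transform `𝓕⁻¹u(x) = (2π)^(-1/2) ∫ e^(ixξ) u(ξ) dξ`. -/
noncomputable def FTinv (u : ℝ → ℂ) : ℝ → ℂ :=
  fun x => (↑(Real.sqrt (2 * Real.pi)))⁻¹ * ∫ ξ : ℝ, Complex.exp (Complex.I * (x : ℂ) * (ξ : ℂ)) * u ξ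

lemma aux_E (y x : ℝ) (h : y ≤ x) :
    Real.exp (Real.arsinh x - Real.arsinh y) ≤ (1 + 2 * (x - y)) ^ 2 := by
  have hE : ∀ s t : ℝ, 0 ≤ s → s ≤ t →
      Real.exp (Real.arsinh t) ≤ Real.exp (Real.arsinh s) * (1 + 2 * (t - s)) := by
    intro s t hs hst
    rw [Real.exp_arsinh, Real.exp_arsinh]
    have h1 : √(1 + t ^ 2) ≤ √(1 + s ^ 2) + (t - s) := by
      apply Real.sqrt_le_iff.2
      constructor
      · have := Real.sqrt_nonneg (1 + s ^ 2); linarith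
      · have h2 := Real.sq_sqrt (show (0:ℝ) ≤ 1 + s ^ 2 by positivity)
        have h3 : s ≤ √(1 + s ^ 2) := Real.le_sqrt_of_sq_le (by linarith)
        nlinarith
    have h4 : 1 ≤ √(1 + s ^ 2) := Real.one_le_sqrt.2 (by nlinarith)
    nlinarith [mul_nonneg (sub_nonneg.2 hst) hs, mul_nonneg (sub_nonneg.2 hst) (sub_nonneg.2 h4)]
  have hE' : ∀ s t : ℝ, 0 ≤ s → s ≤ t →
      Real.exp (Real.arsinh t - Real.arsinh s) ≤ 1 + 2 * (t - s) := by
    intro s t hs hst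
    rw [Real.exp_sub, div_le_iff₀ (Real.exp_pos _), mul_comm]
    exact hE s t hs hst
  have h0 : 1 ≤ 1 + 2 * (x - y) := by linarith
  have hsq : 1 + 2 * (x - y) ≤ (1 + 2 * (x - y)) ^ 2 := by nlinarith
  rcases le_total 0 y with hy | hy
  · exact (hE' y x hy h).trans hsq
  · rcases le_total x 0 with hx | hx
    · have := hE' (-x) (-y) (by linarith) (by linarith)
      rw [Real.arsinh_neg, Real.arsinh_neg] at this
      have e : -Real.arsinh y - -Real.arsinh x = Real.arsinh x - Real.arsinh y := by ring
      rw [e] at this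
      refine le_trans (this.trans (by linarith)) hsq
    · have h1 := hE' 0 x le_rfl hx
      have h2 := hE' 0 (-y) le_rfl (by linarith)
      rw [Real.arsinh_neg] at h2
      simp only [Real.arsinh_zero, sub_zero] at h1 h2
      rw [sub_eq_add_neg, Real.exp_add, sq]
      exact mul_le_mul (by linarith) (by linarith) (Real.exp_pos _).le (by linarith)

lemma moderate (a : ℝ → ℝ) (ha : Differentiable ℝ a) (h0 : ∀ x, 0 ≤ a x) (C : ℝ) (hC : 0 < C)
    (hd : ∀ x, |deriv a x| ≤ C * (1 + a x) * (1 + x ^ 2) ^ (-(1:ℝ) / 2)) :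
    ∃ N : ℕ, ∀ x y, 1 + a x ≤ (1 + a y) * (1 + 2 * |x - y|) ^ N := by
  obtain ⟨N, hN⟩ := exists_nat_ge C
  refine ⟨2 * N, ?_⟩
  have hpos : ∀ x, 0 < 1 + a x := fun x => by linarith [h0 x]
  have hf : ∀ x, HasDerivAt (fun x => Real.log (1 + a x)) (deriv a x / (1 + a x)) x := by
    intro x
    exact ((ha x).hasDerivAt.const_add 1).log (hpos x).ne'
  have hg : ∀ x, HasDerivAt (fun x => C * Real.arsinh x) (C * (√(1 + x ^ 2))⁻¹) x := by
    intro x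
    exact (Real.hasDerivAt_arsinh x).const_mul C
  have hb : ∀ x, |deriv a x / (1 + a x)| ≤ C * (√(1 + x ^ 2))⁻¹ := by
    intro x
    have e : (1 + x ^ 2) ^ (-(1:ℝ) / 2) = (√(1 + x ^ 2))⁻¹ := by
      rw [Real.sqrt_eq_rpow, ← Real.rpow_neg (by positivity)]; norm_num
    rw [abs_div, abs_of_pos (hpos x), div_le_iff₀ (hpos x)]
    have := hd x
    rw [e] at this
    linarith
  have m1 : Monotone (fun x => C * Real.arsinh x - Real.log (1 + a x)) := by
    apply monotone_of_hasDerivAt_nonneg (fun x => (hg x).sub (hf x))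
    intro x
    have := abs_le.1 (hb x)
    simp only [Pi.zero_apply]; linarith
  have m2 : Monotone (fun x => C * Real.arsinh x + Real.log (1 + a x)) := by
    apply monotone_of_hasDerivAt_nonneg (fun x => (hg x).add (hf x))
    intro x
    have := abs_le.1 (hb x)
    simp only [Pi.zero_apply]; linarith
  have key : ∀ y x, y ≤ x → |Real.log (1 + a x) - Real.log (1 + a y)| ≤
      2 * N * Real.log (1 + 2 * |x - y|) := by
    intro y x hyx
    have k1 := m1 hyx
    have k2 := m2 hyx
    simp only at k1 k2
    have k3 := aux_E y x hyx
    rw [abs_of_nonneg (sub_nonneg.2 hyx)]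
    have hp : 0 < 1 + 2 * (x - y) := by linarith
    rw [← Real.le_log_iff_exp_le (by positivity), Real.log_pow] at k3
    have hl : 0 ≤ Real.log (1 + 2 * (x - y)) := Real.log_nonneg (by linarith)
    have k4 : C * (Real.arsinh x - Real.arsinh y) ≤ 2 * N * Real.log (1 + 2 * (x - y)) := by
      push_cast at k3
      calc _ ≤ C * (2 * Real.log (1 + 2 * (x - y))) := by gcongr
        _ ≤ N * (2 * Real.log (1 + 2 * (x - y))) := by gcongr
        _ = _ := by ring
    rw [abs_le]
    constructor <;> linarith
  have key' : ∀ y x, Real.log (1 + a x) - Real.log (1 + a y) ≤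
      2 * N * Real.log (1 + 2 * |x - y|) := by
    intro y x
    rcases le_total y x with h | h
    · exact (le_abs_self _).trans (key y x h)
    · have := key x y h
      rw [abs_sub_comm, abs_sub_comm y x] at this
      exact (le_abs_self _).trans this
  intro x y
  have hp : 0 < 1 + 2 * |x - y| := by positivity
  rw [← Real.log_le_log_iff (hpos x) (mul_pos (hpos y) (by positivity)),
    Real.log_mul (hpos y).ne' (by positivity), Real.log_pow]
  have := key' y x
  push_cast
  linarith

lemma poly_int (k : SchwartzMap ℝ ℂ) (N : ℕ) :
    Integrable (fun z => ‖k z‖ * (1 + 2 * |z|) ^ N) := by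
  have h1 := (k.integrable (μ := volume)).norm.add
    (k.integrable_pow_mul volume N)
  refine ((h1.const_mul (3 ^ N : ℝ))).mono' (by fun_prop) (ae_of_all _ fun z => ?_)
  rw [Real.norm_of_nonneg (by positivity)]
  have : (1 + 2 * |z|) ^ N ≤ 3 ^ N * (1 + |z| ^ N) := by
    rcases le_total (|z|) 1 with h | h
    · calc _ ≤ (3:ℝ) ^ N := by gcongr; linarith
        _ ≤ _ := by nlinarith [pow_nonneg (abs_nonneg z) N, pow_pos (show (0:ℝ) < 3 by norm_num) N]
    · calc _ ≤ (3 * |z|) ^ N := by gcongr; linarith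
        _ = 3 ^ N * |z| ^ N := by rw [mul_pow]
        _ ≤ _ := by gcongr; linarith
  calc _ ≤ ‖k z‖ * (3 ^ N * (1 + |z| ^ N)) := by gcongr
    _ = _ := by simp only [Pi.add_apply, Real.norm_eq_abs]; ring

open FourierTransform in
lemma kernel_exists (δ : ℝ) (hδ : δ ∈ Set.Ioo (0 : ℝ) (1 / 4)) (N : ℕ) :
    ∃ M : ℝ, 0 < M ∧ ∀ b : ℝ, 1 ≤ b → ∃ κ : SchwartzMap ℝ ℂ,
      (∀ η : ℝ, |2 * Real.pi * η| ≤ (1 - δ) * b → 𝓕 κ η = 1) ∧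
      (∀ η : ℝ, (1 + δ) * b ≤ |2 * Real.pi * η| → 𝓕 κ η = 0) ∧
      ∫⁻ z, ENNReal.ofReal (‖κ z‖ * (1 + 2 * |z|) ^ N) ≤ ENNReal.ofReal M := by
  obtain ⟨hδ0, hδ1⟩ := hδ
  have hpi := Real.pi_pos
  let φ : ContDiffBump (0:ℝ) := ⟨(1 - δ) / (2 * Real.pi), (1 + δ) / (2 * Real.pi),
    by apply div_pos <;> linarith, by gcongr; linarith⟩
  let χ : ℝ → ℂ := fun x => ((φ x : ℝ) : ℂ)
  have hχc : HasCompactSupport χ := φ.hasCompactSupport.comp_left (g := fun r : ℝ => (r : ℂ)) (by simp)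
  have hχs : ContDiff ℝ (⊤ : ℕ∞) χ := Complex.ofRealCLM.contDiff.comp φ.contDiff
  let χS : SchwartzMap ℝ ℂ := hχc.toSchwartzMap hχs
  let k : SchwartzMap ℝ ℂ := 𝓕⁻ χS
  have hint := poly_int k N
  refine ⟨(∫ z, ‖k z‖ * (1 + 2 * |z|) ^ N) + 1, by positivity, fun b hb => ?_⟩
  have hb0 : 0 < b := by linarith
  let e : ℝ ≃L[ℝ] ℝ := ContinuousLinearEquiv.unitsEquivAut ℝ (Units.mk0 b hb0.ne')
  have he : ∀ x, e x = x * b := fun x => rfl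
  let κ : SchwartzMap ℝ ℂ := (b : ℂ) • SchwartzMap.compCLMOfContinuousLinearEquiv ℂ e k
  have hκ : ∀ x, κ x = (b : ℂ) * k (b * x) := by
    intro x
    simp [κ, he, mul_comm x b]
  have hF : ∀ η, 𝓕 κ η = φ (η / b) := by
    intro η
    have h1 : 𝓕 k (η / b) = χ (η / b) := by
      simp only [k, FourierTransform.fourier_fourierInv_eq]
      rfl
    change _ = χ (η / b)
    rw [← h1, SchwartzMap.fourier_coe, SchwartzMap.fourier_coe, Real.fourier_real_eq, Real.fourier_real_eq]
    have := MeasureTheory.Measure.integral_comp_mul_left (fun v => Real.fourierChar (-(v * (η / b))) • k v) b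
    rw [abs_of_pos (by positivity), eq_inv_smul_iff₀ hb0.ne', ← integral_smul] at this
    rw [← this]
    congr 1
    ext v
    rw [hκ]
    have e2 : b * v * (η / b) = v * η := by field_simp
    rw [e2]
    simp only [Circle.smul_def, smul_eq_mul, Complex.real_smul]
    ring
  refine ⟨κ, ?_, ?_, ?_⟩
  · intro η hη
    rw [hF, φ.one_of_mem_closedBall]; · simp
    simp only [mem_closedBall_zero_iff, Real.norm_eq_abs, φ]
    rw [abs_mul, abs_of_pos (by positivity)] at hη
    rw [abs_div, abs_of_pos hb0, div_le_div_iff₀ hb0 (by positivity)]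
    linarith
  · intro η hη
    rw [hF, φ.zero_of_le_dist]; · simp
    simp only [dist_zero_right, Real.norm_eq_abs, φ]
    rw [abs_mul, abs_of_pos (by positivity)] at hη
    rw [abs_div, abs_of_pos hb0, div_le_div_iff₀ (by positivity) hb0]
    linarith
  · have hi2 : Integrable (fun z => b * (‖k (b * z)‖ * (1 + 2 * |b * z|) ^ N)) :=
      (hint.comp_mul_left' hb0.ne').const_mul b
    have hle : ∀ z, ‖κ z‖ * (1 + 2 * |z|) ^ N ≤ b * (‖k (b * z)‖ * (1 + 2 * |b * z|) ^ N) := by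
      intro z
      rw [hκ, norm_mul, Complex.norm_real, Real.norm_of_nonneg hb0.le, mul_assoc]
      have hz : 1 + 2 * |z| ≤ 1 + 2 * |b * z| := by
        rw [abs_mul, abs_of_pos hb0]
        nlinarith [abs_nonneg z]
      have := pow_le_pow_left₀ (by positivity) hz N
      exact mul_le_mul_of_nonneg_left (mul_le_mul_of_nonneg_left this (norm_nonneg _)) hb0.le
    calc _ ≤ ∫⁻ z, ENNReal.ofReal (b * (‖k (b * z)‖ * (1 + 2 * |b * z|) ^ N)) :=
          lintegral_mono fun z => ENNReal.ofReal_le_ofReal (hle z)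
      _ = ENNReal.ofReal (∫ z, b * (‖k (b * z)‖ * (1 + 2 * |b * z|) ^ N)) :=
          (ofReal_integral_eq_lintegral_ofReal hi2 (ae_of_all _ fun z => by positivity)).symm
      _ ≤ _ := by
          apply ENNReal.ofReal_le_ofReal
          rw [integral_const_mul, MeasureTheory.Measure.integral_comp_mul_left (fun z => ‖k z‖ * (1 + 2 * |z|) ^ N) b,
            abs_of_pos (by positivity), smul_eq_mul, mul_inv_cancel_left₀ hb0.ne']
          linarith

open scoped Convolution in
lemma conv_bound (W : ℝ → ℝ) (hW : Continuous W) (hW0 : ∀ x, 0 ≤ W x) (N : ℕ)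
    (hmod : ∀ x y, W x ≤ W y * (1 + 2 * |x - y|) ^ N) (κ u : SchwartzMap ℝ ℂ) (M : ℝ) (hM : 0 < M)
    (hκ : ∫⁻ z, ENNReal.ofReal (‖κ z‖ * (1 + 2 * |z|) ^ N) ≤ ENNReal.ofReal M) 
    (hu : Integrable (fun x => W x * ‖u x‖ ^ 2)) (w : SchwartzMap ℝ ℂ)
    (hw : w = SchwartzMap.convolution (ContinuousLinearMap.mul ℂ ℂ) κ u) :
    Integrable (fun x => W x * ‖u x‖ * ‖w x‖) ∧
    ∫ x, W x * ‖u x‖ * ‖w x‖ ≤ 2 * M * ∫ x, W x * ‖u x‖ ^ 2 := by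
  set P : ℝ → ℝ≥0∞ := fun z => ENNReal.ofReal (‖κ z‖ * (1 + 2 * |z|) ^ N) with hP
  set G : ℝ → ℝ≥0∞ := fun x => ENNReal.ofReal (W x * ‖u x‖ ^ 2) with hG
  have hPm : Measurable P := by 
    apply ENNReal.measurable_ofReal.comp
    apply Continuous.measurable
    fun_prop
  have hGm : Measurable G := by 
    apply ENNReal.measurable_ofReal.comp
    apply Continuous.measurable
    fun_prop
  have hGi : ∫⁻ x, G x = ENNReal.ofReal (∫ x, W x * ‖u x‖ ^ 2) :=
    (ofReal_integral_eq_lintegral_ofReal hu (ae_of_all _ fun z => mul_nonneg (hW0 z) (by positivity))).symm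
  have hwx : ∀ x, ENNReal.ofReal ‖w x‖ ≤ ∫⁻ t, ENNReal.ofReal (‖κ t‖ * ‖u (x - t)‖) := by
    intro x
    rw [hw, SchwartzMap.convolution_apply, ofReal_norm]
    unfold MeasureTheory.convolution
    refine (enorm_integral_le_lintegral_enorm _).trans (lintegral_mono fun t => ?_)
    rw [← ofReal_norm]
    simp [-ofReal_norm]
  have hmain : ∫⁻ x, ENNReal.ofReal (W x * ‖u x‖ * ‖w x‖) ≤
      ENNReal.ofReal (2 * M * ∫ x, W x * ‖u x‖ ^ 2) := by
    calc _ ≤ ∫⁻ x, ∫⁻ t, P t * (G x + G (x - t)) := by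
          apply lintegral_mono
          intro x
          dsimp only
          rw [ENNReal.ofReal_mul (mul_nonneg (hW0 x) (norm_nonneg _))]
          refine (mul_le_mul_right (hwx x) _).trans ?_
          rw [← lintegral_const_mul' _ _ ENNReal.ofReal_ne_top]
          apply lintegral_mono
          intro t
          dsimp only [P, G]
          have w0 := hW0 x
          have w1 := hW0 (x - t)
          rw [← ENNReal.ofReal_mul (by positivity), ← ENNReal.ofReal_add (by positivity) (by positivity),
            ← ENNReal.ofReal_mul (by positivity)]
          apply ENNReal.ofReal_le_ofReal
          have hm := hmod x (x - t)
          rw [sub_sub_cancel] at hm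
          have h1 : 1 ≤ (1 + 2 * |t|) ^ N := one_le_pow₀ (by linarith [abs_nonneg t])
          set m := (1 + 2 * |t|) ^ N
          set p := ‖u x‖
          set r := ‖u (x - t)‖
          have h2 : W x * (p * r) ≤ m * (W x * p ^ 2 + W (x - t) * r ^ 2) := by
            have a1 : W x * (p * r) ≤ W x * p ^ 2 + W x * r ^ 2 := by
              nlinarith [mul_nonneg w0 (sq_nonneg (p - r)), mul_nonneg w0 (sq_nonneg (p + r)), mul_nonneg w0 (sq_nonneg p), mul_nonneg w0 (sq_nonneg r)]
            have a2 : W x * r ^ 2 ≤ W (x - t) * m * r ^ 2 := by gcongr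
            have a3 : W x * p ^ 2 ≤ m * (W x * p ^ 2) := le_mul_of_one_le_left (by positivity) h1
            linarith
          calc _ = ‖κ t‖ * (W x * (p * r)) := by ring
            _ ≤ ‖κ t‖ * (m * (W x * p ^ 2 + W (x - t) * r ^ 2)) := by gcongr
            _ = _ := by ring
      _ = ∫⁻ t, ∫⁻ x, P t * (G x + G (x - t)) := by
          apply lintegral_lintegral_swap
          apply Measurable.aemeasurable
          unfold Function.uncurry
          fun_prop
      _ = ∫⁻ t, P t * (2 * ∫⁻ x, G x) := by
          congr 1
          ext t
          rw [lintegral_const_mul _ (by fun_prop), lintegral_add_left hGm,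
            lintegral_sub_right_eq_self G t, two_mul]
      _ = (∫⁻ t, P t) * (2 * ∫⁻ x, G x) := by
          rw [lintegral_mul_const _ hPm]
      _ ≤ ENNReal.ofReal M * (2 * ∫⁻ x, G x) := by gcongr
      _ = _ := by
          rw [hGi, ENNReal.ofReal_mul (by positivity), ENNReal.ofReal_mul (by positivity)]
          simp only [ENNReal.ofReal_ofNat]
          ring
  have hnn : ∀ x, 0 ≤ W x * ‖u x‖ * ‖w x‖ := fun x => by have := hW0 x; positivity
  have hI : Integrable (fun x => W x * ‖u x‖ * ‖w x‖) := by
    refine ⟨by fun_prop, ?_⟩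
    rw [hasFiniteIntegral_iff_ofReal (ae_of_all _ hnn)]
    exact hmain.trans_lt ENNReal.ofReal_lt_top
  refine ⟨hI, ?_⟩
  rw [← ofReal_integral_eq_lintegral_ofReal hI (ae_of_all _ hnn)] at hmain
  exact (ENNReal.ofReal_le_ofReal_iff (mul_nonneg (by positivity) (integral_nonneg fun x => mul_nonneg (hW0 x) (by positivity)))).1 hmain

lemma integ_nn {f g : ℝ → ℂ} (hf : MemLp f 2 volume) (hg : MemLp g 2 volume) :
    Integrable (fun x => ‖f x‖ * ‖g x‖) := hf.norm.integrable_mul hg.norm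

lemma integ_inner {f g : ℝ → ℂ} (hf : MemLp f 2 volume) (hg : MemLp g 2 volume) :
    Integrable (fun x => inner ℂ (f x) (g x)) :=
  (integ_nn hf hg).mono' (hf.1.inner hg.1) (ae_of_all _ fun _ => norm_inner_le_norm _ _)

open FourierTransform in
lemma FT_eq (u : SchwartzMap ℝ ℂ) (η : ℝ) (h : FT (⇑u) (2 * Real.pi * η) = 0) : 𝓕 u η = 0 := by
  unfold FT at h
  have hpi := Real.pi_pos
  rcases mul_eq_zero.1 h with h | h
  · rw [inv_eq_zero, Complex.ofReal_eq_zero, Real.sqrt_eq_zero (by positivity)] at h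
    linarith
  · rw [SchwartzMap.fourier_coe, Real.fourier_real_eq_integral_exp_smul, ← h]
    congr 1
    ext x
    rw [smul_eq_mul]
    congr 2
    push_cast
    ring

/-- the Schwartz function `-u'' - b² u`. -/
noncomputable def gS (b : ℝ) (u : SchwartzMap ℝ ℂ) : SchwartzMap ℝ ℂ :=
  -(SchwartzMap.derivCLM ℂ ℂ (SchwartzMap.derivCLM ℂ ℂ u)) - ((b : ℂ) ^ 2) • u

lemma gS_apply (b : ℝ) (u : SchwartzMap ℝ ℂ) (x : ℝ) :
    gS b u x = - deriv (deriv u) x - (b : ℂ) ^ 2 * u x := by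
  rfl

open FourierTransform in
lemma fourier_deriv_S (u : SchwartzMap ℝ ℂ) (η : ℝ) :
    𝓕 (SchwartzMap.derivCLM ℂ ℂ u) η = 2 * Real.pi * Complex.I * η * 𝓕 u η := by
  have h := Real.fourier_deriv (f := u) u.integrable u.differentiable
    (SchwartzMap.derivCLM ℂ ℂ u).integrable
  have := congrFun h η
  simp only [smul_eq_mul] at this
  rw [SchwartzMap.fourier_coe, SchwartzMap.fourier_coe, ← this]
  rfl

open FourierTransform in
lemma fourier_gS (b : ℝ) (u : SchwartzMap ℝ ℂ) (η : ℝ) :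
    𝓕 (gS b u) η = (((2 * Real.pi * η) ^ 2 - b ^ 2 : ℝ) : ℂ) * 𝓕 u η := by
  have : 𝓕 (gS b u) = -(𝓕 (SchwartzMap.derivCLM ℂ ℂ (SchwartzMap.derivCLM ℂ ℂ u))) - ((b : ℂ) ^ 2) • 𝓕 u := by
    unfold gS
    rw [← SchwartzMap.fourierTransformCLM_apply ℂ]
    simp only [map_sub, map_neg, map_smul]
    rfl
  rw [this]
  simp only [sub_apply, neg_apply, smul_apply, fourier_deriv_S, smul_eq_mul]
  push_cast
  linear_combination (-(2 * Real.pi * η : ℂ) ^ 2 * 𝓕 u η) * Complex.I_sq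

open FourierTransform in
lemma im_gS (b : ℝ) (u : SchwartzMap ℝ ℂ) : ∫ x, (inner ℂ (u x) (gS b u x)).im = 0 := by
  have h := SchwartzMap.integral_inner_fourier_fourier u (gS b u)
  have h1 := integ_inner (SchwartzMap.memLp u 2 volume) (SchwartzMap.memLp (gS b u) 2 volume)
  have h2 := integ_inner (SchwartzMap.memLp (𝓕 u) 2 volume) (SchwartzMap.memLp (𝓕 (gS b u)) 2 volume)
  have e1 := integral_im h1
  have e2 := integral_im h2
  simp only [RCLike.im_to_complex] at e1 e2
  rw [e1, ← h, ← e2]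
  rw [← integral_zero ℝ ℝ (μ := volume)]
  congr 1
  ext η
  rw [fourier_gS, RCLike.inner_apply, mul_assoc, Complex.mul_conj, ← Complex.ofReal_mul, Complex.ofReal_im]

open FourierTransform in
lemma J_prop (δ : ℝ) (hδ : δ ∈ Set.Ioo (0 : ℝ) (1 / 4)) (b : ℝ) (hb : 1 ≤ b)
    (κ u w v : SchwartzMap ℝ ℂ)
    (h1 : ∀ η : ℝ, |2 * Real.pi * η| ≤ (1 - δ) * b → 𝓕 κ η = 1)
    (h2 : ∀ η : ℝ, (1 + δ) * b ≤ |2 * Real.pi * η| → 𝓕 κ η = 0)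
    (hu : ∀ η : ℝ, (1 - δ) * b < |2 * Real.pi * η| → |2 * Real.pi * η| < (1 + δ) * b → 𝓕 u η = 0)
    (hw : w = SchwartzMap.convolution (ContinuousLinearMap.mul ℂ ℂ) κ u)
    (hv : v = u - (2 : ℂ) • w) :
    ∫ x, ‖v x‖ ^ 2 = ∫ x, ‖u x‖ ^ 2 ∧
    δ * b ^ 2 * ∫ x, ‖u x‖ ^ 2 ≤ ∫ x, (inner ℂ (v x) (gS b u x)).re := by
  obtain ⟨hδ0, hδ1⟩ := hδ
  have hFw : ∀ η, 𝓕 w η = 𝓕 κ η * 𝓕 u η := by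
    intro η
    rw [hw, SchwartzMap.fourier_convolution]
    simp
  have hFv : ∀ η, 𝓕 v η = 𝓕 u η - 2 * (𝓕 κ η * 𝓕 u η) := by
    intro η
    rw [← hFw]
    have : 𝓕 v = 𝓕 u - (2 : ℂ) • 𝓕 w := by
      rw [hv, ← SchwartzMap.fourierTransformCLM_apply ℂ]
      simp only [map_sub, map_smul]
      rfl
    rw [this]
    simp
  have hcase : ∀ η, 𝓕 u η = 0 ∨ (|2 * Real.pi * η| ≤ (1 - δ) * b ∧ 𝓕 v η = - 𝓕 u η) ∨
      ((1 + δ) * b ≤ |2 * Real.pi * η| ∧ 𝓕 v η = 𝓕 u η) := by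
    intro η
    rcases le_or_gt (|2 * Real.pi * η|) ((1 - δ) * b) with h | h
    · right; left; refine ⟨h, ?_⟩
      rw [hFv, h1 η h]; ring
    · rcases le_or_gt ((1 + δ) * b) (|2 * Real.pi * η|) with h' | h'
      · right; right; refine ⟨h', ?_⟩
        rw [hFv, h2 η h']; ring
      · left; exact hu η h h'
  constructor
  · rw [← SchwartzMap.integral_norm_sq_fourier v, ← SchwartzMap.integral_norm_sq_fourier u]
    congr 1
    ext η
    rcases hcase η with h | ⟨_, h⟩ | ⟨_, h⟩
    · rw [hFv, h]; simp
    · rw [h, norm_neg]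
    · rw [h]
  · have h := SchwartzMap.integral_inner_fourier_fourier v (gS b u)
    have i1 := integ_inner (SchwartzMap.memLp v 2 volume) (SchwartzMap.memLp (gS b u) 2 volume)
    have i2 := integ_inner (SchwartzMap.memLp (𝓕 v) 2 volume) (SchwartzMap.memLp (𝓕 (gS b u)) 2 volume)
    have e1 := integral_re i1
    have e2 := integral_re i2
    simp only [RCLike.re_to_complex] at e1 e2
    rw [e1, ← h, ← e2, ← SchwartzMap.integral_norm_sq_fourier u, ← integral_const_mul]
    refine integral_mono ?_ i2.re ?_
    · exact ((memLp_two_iff_integrable_sq_norm (𝓕 u).continuous.aestronglyMeasurable).1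
        (SchwartzMap.memLp (𝓕 u) 2 volume)).const_mul _
    · intro η
      dsimp only
      rw [fourier_gS, RCLike.inner_apply, mul_assoc (Complex.ofReal _)]
      rcases hcase η with h | ⟨h', h⟩ | ⟨h', h⟩
      · rw [h]; simp
      · rw [h, map_neg, mul_neg, Complex.mul_conj, ← Complex.ofReal_neg, ← Complex.ofReal_mul,
          Complex.normSq_eq_norm_sq]
        simp only [RCLike.re_to_complex, Complex.ofReal_re]
        have : (2 * Real.pi * η) ^ 2 ≤ ((1 - δ) * b) ^ 2 := by
          rw [← sq_abs]; gcongr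
        have h3 : δ * b ^ 2 ≤ b ^ 2 - (2 * Real.pi * η) ^ 2 := by nlinarith [sq_nonneg b, mul_nonneg hδ0.le (sq_nonneg b), mul_nonneg (mul_nonneg hδ0.le (sub_nonneg.2 hδ1.le)) (sq_nonneg b)]
        nlinarith [mul_le_mul_of_nonneg_right h3 (sq_nonneg ‖𝓕 u η‖)]
      · rw [h, Complex.mul_conj, ← Complex.ofReal_mul, Complex.normSq_eq_norm_sq]
        simp only [RCLike.re_to_complex, Complex.ofReal_re]
        have : ((1 + δ) * b) ^ 2 ≤ (2 * Real.pi * η) ^ 2 := by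
          rw [← sq_abs (2 * Real.pi * η)]; gcongr
        have h3 : δ * b ^ 2 ≤ (2 * Real.pi * η) ^ 2 - b ^ 2 := by nlinarith [sq_nonneg b, mul_nonneg hδ0.le (sq_nonneg b), mul_nonneg (mul_nonneg hδ0.le hδ0.le) (sq_nonneg b)]
        nlinarith [mul_le_mul_of_nonneg_right h3 (sq_nonneg ‖𝓕 u η‖)]

lemma memLp_weight (W : ℝ → ℝ) (hW : Continuous W) (hW1 : ∀ x, 1 ≤ W x) (N : ℕ)
    (hmod : ∀ x y, W x ≤ W y * (1 + 2 * |x - y|) ^ N) (u : SchwartzMap ℝ ℂ) :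
    Integrable (fun x => (W x * ‖u x‖) ^ 2) := by
  obtain ⟨B, hB⟩ : ∃ B, ∀ x, ‖u x‖ ≤ B := ⟨_, fun x => SchwartzMap.norm_le_seminorm ℝ u x⟩
  have h1 := (poly_int u (N * 2)).const_mul (W 0 ^ 2 * B)
  refine h1.mono' (by fun_prop) (ae_of_all _ fun x => ?_)
  rw [Real.norm_of_nonneg (by positivity)]
  have h2 := hmod x 0
  rw [sub_zero] at h2
  have h3 : 0 ≤ W x := by linarith [hW1 x]
  have h4 : 0 ≤ W 0 := by linarith [hW1 0]
  calc (W x * ‖u x‖) ^ 2 = W x ^ 2 * (‖u x‖ * ‖u x‖) := by ring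
    _ ≤ (W 0 * (1 + 2 * |x|) ^ N) ^ 2 * (B * ‖u x‖) := by gcongr; exact hB x
    _ = _ := by rw [mul_pow, ← pow_mul]; ring

lemma amgm {f g : ℝ → ℂ} (hf : MemLp f 2 volume) (hg : MemLp g 2 volume) (t : ℝ) (ht : 0 < t) :
    2 * ∫ x, ‖f x‖ * ‖g x‖ ≤ t * (∫ x, ‖f x‖ ^ 2) + t⁻¹ * ∫ x, ‖g x‖ ^ 2 := by
  have i1 := ((memLp_two_iff_integrable_sq_norm hf.1).1 hf).const_mul t
  have i2 := ((memLp_two_iff_integrable_sq_norm hg.1).1 hg).const_mul t⁻¹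
  rw [← integral_const_mul, ← integral_const_mul, ← integral_const_mul, ← integral_add i1 i2]
  refine integral_mono ((integ_nn hf hg).const_mul 2) (i1.add i2) fun x => ?_
  dsimp only [Pi.add_apply]
  have := mul_nonneg (inv_nonneg.2 ht.le) (sq_nonneg (t * ‖f x‖ - ‖g x‖))
  have e : t⁻¹ * (t * ‖f x‖ - ‖g x‖) ^ 2 = t * ‖f x‖ ^ 2 + t⁻¹ * ‖g x‖ ^ 2 - 2 * (‖f x‖ * ‖g x‖) := by
    field_simp
    ring
  linarith

lemma eLpNorm_eq_sqrt {f : ℝ → ℂ} (hf : MemLp f 2 volume) :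
    eLpNorm f 2 volume = ENNReal.ofReal (√(∫ x, ‖f x‖ ^ 2)) := by
  rw [hf.eLpNorm_eq_integral_rpow_norm (by norm_num) (by norm_num), Real.sqrt_eq_rpow]
  simp

lemma final_arith (δ b L R S X A Q1 Q2 : ℝ) (hδ0 : 0 < δ) (hb0 : 0 < b) (hL0 : 0 ≤ L)
    (hS0 : 0 ≤ S) (hX0 : 0 ≤ X) (hI1 : 2 * b * (A - (1 + R) * S) ≤ Q1)
    (hI2 : δ * b ^ 2 * S ≤ Q2 + L * b * A) (hbL : 4 * L * (1 + R) ≤ δ * b)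
    (g1 : 2 * Q1 ≤ δ / (2 * (1 + L)) * b ^ 2 * S + (δ / (2 * (1 + L)) * b ^ 2)⁻¹ * X)
    (g2 : 2 * Q2 ≤ δ / (2 * (1 + L)) * b ^ 2 * S + (δ / (2 * (1 + L)) * b ^ 2)⁻¹ * X) :
    b ^ 2 * b ^ 2 * S ≤ (2 * (1 + L) / δ) ^ 2 * X := by
  set s := δ / (2 * (1 + L)) with hs
  have hs0 : 0 < s := by positivity
  have k1 : L * b * A ≤ L * (Q1 / 2) + L * b * (1 + R) * S := by
    have := mul_le_mul_of_nonneg_left hI1 hL0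
    linarith
  have k2 : L * b * (1 + R) * S ≤ δ * b ^ 2 * S / 4 := by
    have := mul_le_mul_of_nonneg_right hbL (mul_nonneg hb0.le hS0)
    linarith
  set Y := s * b ^ 2 * S + (s * b ^ 2)⁻¹ * X with hY
  have k3 : (3 / 4) * (δ * b ^ 2 * S) ≤ (1 + L) * (Y / 2) := by
    have Y0 : 0 ≤ Y := by positivity
    have : L * (Q1 / 2) ≤ L * (Y / 4) := by
      apply mul_le_mul_of_nonneg_left _ hL0
      linarith
    have := mul_nonneg hL0 Y0
    linarith
  have k4 : (1 + L) * (s * b ^ 2 * S) = δ * b ^ 2 * S / 2 := by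
    rw [hs]; field_simp
  have k5 : (1 / 2) * (δ * b ^ 2 * S) ≤ (1 + L) * ((s * b ^ 2)⁻¹ * X) / 2 := by
    rw [hY] at k3; linarith
  have k6 : b ^ 2 * b ^ 2 * S * δ ≤ (1 + L) / s * X := by
    have := mul_le_mul_of_nonneg_left k5 (show 0 ≤ 2 * b ^ 2 by positivity)
    have e : 2 * b ^ 2 * ((1 + L) * ((s * b ^ 2)⁻¹ * X) / 2) = (1 + L) / s * X := by
      field_simp
    rw [e] at this
    linarith
  have e8 : (1 + L) / s = 2 * (1 + L) ^ 2 / δ := by rw [hs]; field_simp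
  rw [e8] at k6
  have k7 : b ^ 2 * b ^ 2 * S ≤ 2 * (1 + L) ^ 2 / δ * X / δ := by
    rwa [le_div_iff₀ hδ0]
  refine k7.trans ?_
  have e9 : (2 * (1 + L) / δ) ^ 2 * X = 2 * (2 * (1 + L) ^ 2 / δ * X / δ) := by
    field_simp
  rw [e9]
  have : 0 ≤ 2 * (1 + L) ^ 2 / δ * X / δ := by positivity
  linarith

set_option maxHeartbeats 1000000 in
open FourierTransform in
lemma core (a q : ℝ → ℝ) (ha : Continuous a) (hq : Continuous q) (ha0 : ∀ x, 0 ≤ a x)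
    (hq0 : ∀ x, 0 ≤ q x) (Kq : ℝ) (hKq : 0 ≤ Kq) (hqa : ∀ x, q x ≤ Kq * (1 + a x)) (N : ℕ)
    (hmod : ∀ x y, 1 + a x ≤ (1 + a y) * (1 + 2 * |x - y|) ^ N)
    (R : ℝ) (hR : 0 ≤ R) (δ : ℝ) (hδ : δ ∈ Set.Ioo (0 : ℝ) (1 / 4)) (M : ℝ) (hM : 0 < M)
    (L : ℝ) (hL : L = (Kq + 2 * R + R ^ 2 + 2 * (1 + R)) * (1 + 4 * M))
    (c b : ℝ) (hc0 : 0 ≤ c) (hcR : c ≤ R) (hb : 1 ≤ b) (hbL : 4 * L * (1 + R) ≤ δ * b)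
    (κ u : SchwartzMap ℝ ℂ)
    (h1 : ∀ η : ℝ, |2 * Real.pi * η| ≤ (1 - δ) * b → 𝓕 κ η = 1)
    (h2 : ∀ η : ℝ, (1 + δ) * b ≤ |2 * Real.pi * η| → 𝓕 κ η = 0)
    (hκ : ∫⁻ z, ENNReal.ofReal (‖κ z‖ * (1 + 2 * |z|) ^ N) ≤ ENNReal.ofReal M)
    (hu : ∀ η : ℝ, (1 - δ) * b < |2 * Real.pi * η| → |2 * Real.pi * η| < (1 + δ) * b → 𝓕 u η = 0) :
    ENNReal.ofReal (b ^ 2) * eLpNorm (⇑u) 2 volume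
      ≤ ENNReal.ofReal (2 * (1 + L) / δ) *
          eLpNorm (Tq a q (-(c : ℂ) + Complex.I * (b : ℂ)) ⇑u) 2 volume := by
  set W : ℝ → ℝ := fun x => 1 + a x with hWdef
  have hW1 : ∀ x, 1 ≤ W x := fun x => by simp only [W]; linarith [ha0 x]
  have hW0 : ∀ x, 0 ≤ W x := fun x => by linarith [hW1 x]
  have hWc : Continuous W := by fun_prop
  set V : ℝ → ℂ := fun x => ((q x - 2 * c * a x + c ^ 2 : ℝ) : ℂ) + ((2 * b * (a x - c) : ℝ) : ℂ) * Complex.I with hV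
  set F := Tq a q (-(c : ℂ) + Complex.I * (b : ℂ)) ⇑u with hF
  have hVc : Continuous V := by fun_prop
  have hFx : ∀ x, F x = gS b u x + V x * u x := by
    intro x
    simp only [hF, Tq, gS_apply, V]
    push_cast
    linear_combination (b : ℂ) ^ 2 * u x * Complex.I_sq
  set D := Kq + 2 * R + R ^ 2 + 2 * (1 + R) with hD
  have hD0 : 0 ≤ D := by positivity
  have hVb : ∀ x, ‖V x‖ ≤ D * b * W x := by
    intro x
    have hw := hW1 x
    have hax : a x = W x - 1 := by simp [W]
    have a1 : |q x - 2 * c * a x + c ^ 2| ≤ (Kq + 2 * R + R ^ 2) * W x := by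
      have e1 : q x ≤ Kq * W x := hqa x
      have e2 : 2 * c * a x ≤ 2 * R * W x := by
        have := mul_le_mul hcR (show a x ≤ W x by linarith) (ha0 x) hR
        linarith
      have e3 : c ^ 2 ≤ R ^ 2 * W x := by
        have : c ^ 2 ≤ R ^ 2 := by gcongr
        nlinarith [sq_nonneg R]
      have e4 : 0 ≤ 2 * c * a x := by have := ha0 x; positivity
      rw [abs_le]
      constructor <;> nlinarith [hq0 x, sq_nonneg c, mul_nonneg hKq (hW0 x), mul_nonneg (sq_nonneg R) (hW0 x), mul_nonneg hR (hW0 x)]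
    have a2 : |2 * b * (a x - c)| ≤ 2 * (1 + R) * b * W x := by
      rw [abs_mul, abs_of_nonneg (by linarith)]
      have : |a x - c| ≤ (1 + R) * W x := by
        rw [abs_le]
        have := ha0 x
        constructor <;> nlinarith [mul_nonneg hR (sub_nonneg.2 hw)]
      calc _ ≤ 2 * b * ((1 + R) * W x) := by gcongr
        _ = _ := by ring
    have a3 : (Kq + 2 * R + R ^ 2) * W x ≤ (Kq + 2 * R + R ^ 2) * W x * b :=
      le_mul_of_one_le_right (mul_nonneg (by positivity) (hW0 x)) hb
    calc ‖V x‖ ≤ |q x - 2 * c * a x + c ^ 2| + |2 * b * (a x - c)| := by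
          refine (norm_add_le _ _).trans ?_
          rw [norm_mul, Complex.norm_I, mul_one, Complex.norm_real, Complex.norm_real]
          rfl
      _ ≤ _ := by rw [hD]; linarith
  have mu := SchwartzMap.memLp u 2 volume
  have mg := SchwartzMap.memLp (gS b u) 2 volume
  have hWu2 := memLp_weight W hWc hW1 N hmod u
  have mWu : MemLp (fun x => (W x : ℂ) * u x) 2 volume := by
    rw [memLp_two_iff_integrable_sq_norm (by fun_prop)]
    refine hWu2.congr (ae_of_all _ fun x => ?_)
    dsimp only
    rw [norm_mul, Complex.norm_real, Real.norm_of_nonneg (hW0 x)]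
  have mVu : MemLp (fun x => V x * u x) 2 volume := by
    refine mWu.of_le_mul (c := D * b) (by fun_prop) (ae_of_all _ fun x => ?_)
    rw [norm_mul, norm_mul, Complex.norm_real, Real.norm_of_nonneg (hW0 x), ← mul_assoc]
    exact mul_le_mul_of_nonneg_right (hVb x) (norm_nonneg _)
  have mF : MemLp F 2 volume := by
    have : F = fun x => gS b u x + V x * u x := funext hFx
    rw [this]
    exact mg.add mVu
  have hA : Integrable (fun x => W x * ‖u x‖ ^ 2) := by
    refine hWu2.mono' (by fun_prop) (ae_of_all _ fun x => ?_)
    rw [Real.norm_of_nonneg (mul_nonneg (hW0 x) (by positivity)), mul_pow]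
    gcongr
    nlinarith [hW1 x]
  have hS : Integrable (fun x => ‖u x‖ ^ 2) := (memLp_two_iff_integrable_sq_norm mu.1).1 mu
  obtain ⟨w, hw⟩ : ∃ w, w = SchwartzMap.convolution (ContinuousLinearMap.mul ℂ ℂ) κ u := ⟨_, rfl⟩
  obtain ⟨v, hv⟩ : ∃ v, v = u - (2 : ℂ) • w := ⟨_, rfl⟩
  have mv := SchwartzMap.memLp v 2 volume
  obtain ⟨hcI, hcB⟩ := conv_bound W hWc hW0 N hmod κ u M hM hκ hA w hw
  obtain ⟨hJ1, hJ2⟩ := J_prop δ hδ b hb κ u w v h1 h2 hu hw hv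
  set S := ∫ x, ‖u x‖ ^ 2 with hSdef
  set X := ∫ x, ‖F x‖ ^ 2 with hXdef
  set A := ∫ x, W x * ‖u x‖ ^ 2 with hAdef
  set Q1 := ∫ x, ‖u x‖ * ‖F x‖ with hQ1
  set Q2 := ∫ x, ‖v x‖ * ‖F x‖ with hQ2
  have hS0 : 0 ≤ S := integral_nonneg fun x => by positivity
  have hX0 : 0 ≤ X := integral_nonneg fun x => by positivity
  -- imaginary part estimate
  have hI1 : 2 * b * (A - (1 + R) * S) ≤ Q1 := by
    have ii : Integrable (fun x => (inner ℂ (u x) (gS b u x)).im) := (integ_inner mu mg).im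
    have ij : Integrable (fun x => 2 * b * (W x * ‖u x‖ ^ 2 - (1 + R) * ‖u x‖ ^ 2)) :=
      (hA.sub (hS.const_mul (1 + R))).const_mul (2 * b)
    have e0 : 2 * b * (A - (1 + R) * S) =
        ∫ x, ((inner ℂ (u x) (gS b u x)).im + 2 * b * (W x * ‖u x‖ ^ 2 - (1 + R) * ‖u x‖ ^ 2)) := by
      rw [integral_add ii ij, im_gS, zero_add, integral_const_mul,
        integral_sub hA (hS.const_mul (1 + R)), integral_const_mul]
    rw [e0]
    refine integral_mono (ii.add ij) (integ_nn mu mF) fun x => ?_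
    dsimp only
    have e1 : (inner ℂ (u x) (F x)).im = (inner ℂ (u x) (gS b u x)).im + 2 * b * (a x - c) * ‖u x‖ ^ 2 := by
      rw [hFx, inner_add_right, Complex.add_im, RCLike.inner_apply (u x) (V x * u x), mul_assoc,
        Complex.mul_conj, Complex.im_mul_ofReal, Complex.normSq_eq_norm_sq]
      have e4 : (V x).im = 2 * b * (a x - c) := by
        simp only [V, Complex.add_im, Complex.ofReal_im, Complex.im_ofReal_mul, Complex.I_im]
        ring
      rw [e4]
    have e2 : (inner ℂ (u x) (F x)).im ≤ ‖u x‖ * ‖F x‖ :=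
      ((le_abs_self _).trans (Complex.abs_im_le_norm _)).trans (norm_inner_le_norm _ _)
    rw [e1] at e2
    refine le_trans ?_ e2
    have e3 : 2 * b * (W x * ‖u x‖ ^ 2 - (1 + R) * ‖u x‖ ^ 2) = 2 * b * (a x - R) * ‖u x‖ ^ 2 := by
      simp only [W]; ring
    rw [e3]
    gcongr
  -- real part estimate
  have hI2 : δ * b ^ 2 * S ≤ Q2 + L * b * A := by
    have i3 : Integrable (fun x => W x * ‖u x‖ ^ 2 + 2 * (W x * ‖u x‖ * ‖w x‖)) :=
      hA.add (hcI.const_mul 2)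
    have i4 := (integ_nn mv mF).add (i3.const_mul (D * b))
    have e0 : ∫ x, (inner ℂ (v x) (gS b u x)).re ≤
        ∫ x, (‖v x‖ * ‖F x‖ + D * b * (W x * ‖u x‖ ^ 2 + 2 * (W x * ‖u x‖ * ‖w x‖))) := by
      refine integral_mono (integ_inner mv mg).re i4 fun x => ?_
      dsimp only
      have e1 : gS b u x = F x - V x * u x := by rw [hFx]; ring
      have e2 : ‖v x‖ ≤ ‖u x‖ + 2 * ‖w x‖ := by
        have : v x = u x - 2 * w x := by rw [hv]; rfl
        rw [this]
        refine (norm_sub_le _ _).trans ?_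
        rw [norm_mul]; simp
      have e3 : ‖V x * u x‖ ≤ D * b * W x * ‖u x‖ := by
        rw [norm_mul]; exact mul_le_mul_of_nonneg_right (hVb x) (norm_nonneg _)
      calc RCLike.re (inner ℂ (v x) (gS b u x)) ≤ ‖v x‖ * ‖gS b u x‖ :=
            (RCLike.re_le_norm _).trans (norm_inner_le_norm _ _)
        _ ≤ ‖v x‖ * (‖F x‖ + ‖V x * u x‖) := by
            rw [e1]; gcongr; exact norm_sub_le _ _
        _ = ‖v x‖ * ‖F x‖ + ‖v x‖ * ‖V x * u x‖ := by ring
        _ ≤ ‖v x‖ * ‖F x‖ + (‖u x‖ + 2 * ‖w x‖) * (D * b * W x * ‖u x‖) := by gcongr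
        _ = _ := by ring
    have e5 : ∫ x, (‖v x‖ * ‖F x‖ + D * b * (W x * ‖u x‖ ^ 2 + 2 * (W x * ‖u x‖ * ‖w x‖))) =
        Q2 + D * b * (A + 2 * ∫ x, W x * ‖u x‖ * ‖w x‖) := by
      rw [integral_add (integ_nn mv mF) (i3.const_mul (D * b)), integral_const_mul,
        integral_add hA (hcI.const_mul 2), integral_const_mul]
    have e6 : D * b * (A + 2 * ∫ x, W x * ‖u x‖ * ‖w x‖) ≤ D * b * (A + 2 * (2 * M * A)) := by
      gcongr
    have e7 : D * b * (A + 2 * (2 * M * A)) = L * b * A := by rw [hL]; ring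
    linarith
  have hL0 : 0 ≤ L := by rw [hL]; positivity
  have hδ0 := hδ.1
  have hb0 : 0 < b := by linarith
  have hm : b ^ 2 * b ^ 2 * S ≤ (2 * (1 + L) / δ) ^ 2 * X := by
    have hs0 : 0 < δ / (2 * (1 + L)) := by positivity
    have g1 := amgm mu mF (δ / (2 * (1 + L)) * b ^ 2) (by positivity)
    have g2 := amgm mv mF (δ / (2 * (1 + L)) * b ^ 2) (by positivity)
    rw [hJ1] at g2
    exact final_arith δ b L R S X A Q1 Q2 hδ0 hb0 hL0 hS0 hX0 hI1 hI2 hbL g1 g2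
  rw [eLpNorm_eq_sqrt mu, eLpNorm_eq_sqrt mF, ← ENNReal.ofReal_mul (by positivity),
    ← ENNReal.ofReal_mul (by positivity)]
  apply ENNReal.ofReal_le_ofReal
  refine (pow_le_pow_iff_left₀ (by positivity) (by positivity) two_ne_zero).1 ?_
  rw [mul_pow, mul_pow, Real.sq_sqrt hS0, Real.sq_sqrt hX0]
  linarith

theorem stmt6 (a q : ℝ → ℝ) (h : Standing a q)
    (K : Set ℝ) (hKb : Bornology.IsBounded K) (hK : K ⊆ Set.Ici 0)
    (δ : ℝ) (hδ : δ ∈ Set.Ioo (0 : ℝ) (1 / 4)) :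
    ∃ C : ℝ, 0 < C ∧ ∃ b₀ : ℝ, 0 < b₀ ∧ ∀ c ∈ K, ∀ b : ℝ, b₀ ≤ b →
      ∀ u : SchwartzMap ℝ ℂ,
        (∀ ξ ∈ Set.Ioo (b - δ * b) (b + δ * b) ∪ Set.Ioo (-b - δ * b) (-b + δ * b),
          FT (⇑u) ξ = 0) →
        ENNReal.ofReal (b ^ 2) * eLpNorm (⇑u) 2 volume
          ≤ ENNReal.ofReal C *
              eLpNorm (Tq a q (-(c : ℂ) + Complex.I * (b : ℂ)) ⇑u) 2 volume := by
  obtain ⟨R, hR, hKR⟩ : ∃ R : ℝ, 0 ≤ R ∧ ∀ c ∈ K, c ≤ R := by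
    obtain ⟨R, hR⟩ := hKb.bddAbove
    exact ⟨max R 0, le_max_right _ _, fun c hc => (hR hc).trans (le_max_left _ _)⟩
  have hda : Differentiable ℝ a := h.smooth_a.differentiable (by simp)
  obtain ⟨C1, hC1, hd⟩ := h.deriv_a 1 le_rfl
  obtain ⟨N, hmod⟩ := moderate a hda h.nonneg_a C1 hC1 (by simpa using hd)
  obtain ⟨Kq, hKq, hqa⟩ : ∃ Kq : ℝ, 0 ≤ Kq ∧ ∀ x, q x ≤ Kq * (1 + a x) := by
    obtain ⟨K₀, hK₀, x₀, hx₀, hq⟩ := h.q_le_a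
    obtain ⟨B, hB⟩ := (isCompact_Icc (a := -x₀) (b := x₀)).bddAbove_image h.smooth_q.continuous.continuousOn
    refine ⟨max B K₀, hK₀.le.trans (le_max_right _ _), fun x => ?_⟩
    have hm1 := le_max_left B K₀
    have hm2 := le_max_right B K₀
    have hax := h.nonneg_a x
    rcases le_or_gt (|x|) x₀ with hx | hx
    · have : q x ≤ B := hB ⟨x, abs_le.1 hx, rfl⟩
      nlinarith [mul_nonneg (hK₀.le.trans hm2) hax]
    · have := hq x hx
      nlinarith [mul_le_mul_of_nonneg_right hm2 hax]
  obtain ⟨M, hM, hker⟩ := kernel_exists δ hδ N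
  obtain ⟨L, hL⟩ : ∃ L, L = (Kq + 2 * R + R ^ 2 + 2 * (1 + R)) * (1 + 4 * M) := ⟨_, rfl⟩
  have hL0 : 0 ≤ L := by rw [hL]; positivity
  have hδ0 := hδ.1
  refine ⟨2 * (1 + L) / δ, by positivity, max 1 (4 * L * (1 + R) / δ), by positivity, ?_⟩
  intro c hc b hb u hu
  have hb1 : 1 ≤ b := (le_max_left _ _).trans hb
  have hb2 : 4 * L * (1 + R) ≤ δ * b := by
    have := (le_max_right _ _).trans hb
    rw [div_le_iff₀ hδ0] at this
    linarith
  obtain ⟨κ, k1, k2, k3⟩ := hker b hb1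
  refine core a q hda.continuous h.smooth_q.continuous h.nonneg_a h.nonneg_q Kq hKq hqa N hmod R hR δ hδ M hM
    L hL c b (hK hc) (hKR c hc) hb1 hb2 κ u k1 k2 k3 ?_
  intro η e1 e2
  apply FT_eq
  apply hu
  rcases abs_cases (2 * Real.pi * η) with ⟨h3, _⟩ | ⟨h3, _⟩
  · left; rw [h3] at e1 e2; constructor <;> linarith
  · right; rw [h3] at e1 e2; constructor <;> linarith
end
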